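/- arXiv:2109.13709 — 4 statements merged into one kernel-verified Lean document; each statement's English description precedes it below -/
import Mathlib

section
/- The forcing polynomial of the benzenoid parallelogram M(k,m) with k ≥ 1 columns and m ≥ 1 rows satisfies F(M(k,m), x) = Σ_{i=0}^{k−1} F(M(i, m−1), x)·x + Σ_{j=0}^{m−1} F(M(k−1, j), x)·x, with F(M(0,n), x) = F(M(n,0), x) = 1 for all n ≥ 0. -/
open SimpleGraph

/-- `M` is a perfect matching of the graph `G` restricted to the vertex set `A`:
a set of pairwise disjoint edges of `G`, with all endpoints in `A`, covering every
vertex of `A`. -/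
def IsPMOn {V : Type*} (G : SimpleGraph V) (A : Set V) (M : Set (Sym2 V)) : Prop :=
  M ⊆ G.edgeSet ∧ (∀ e ∈ M, ∀ v ∈ e, v ∈ A) ∧
    (M.Pairwise fun e f => ∀ v, v ∈ e → v ∉ f) ∧ (∀ v ∈ A, ∃ e ∈ M, v ∈ e)

/-- `S` is a forcing set of the perfect matching `M` of `G` (restricted to `A`):
`S ⊆ M` and `M` is the unique perfect matching containing `S`. -/
def IsForcingOn {V : Type*} (G : SimpleGraph V) (A : Set V) (M S : Set (Sym2 V)) : Prop :=
  S ⊆ M ∧ ∀ M', IsPMOn G A M' → S ⊆ M' → M' = M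

/-- The forcing number of a perfect matching: minimum size of a forcing set. -/
noncomputable def forcingNumOn {V : Type*} (G : SimpleGraph V) (A : Set V)
    (M : Set (Sym2 V)) : ℕ :=
  sInf {n | ∃ S, IsForcingOn G A M S ∧ S.ncard = n}

/-- Vertices remaining after deleting the endpoints of edges in `S`. -/
def delVerts {V : Type*} (S : Set (Sym2 V)) : Set V := {v | ∀ e ∈ S, v ∉ e}

/-- A closed walk `c` is an `M`-alternating cycle: it is a cycle and its edges
alternate between `M` and its complement (including around the wrap). -/
def IsAltCycle {V : Type*} (G : SimpleGraph V) (M : Set (Sym2 V)) {v : V}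
    (c : G.Walk v v) : Prop :=
  c.IsCycle ∧ c.edges.Chain' (fun e f => e ∈ M ↔ f ∉ M) ∧
    ∀ e f, c.edges.head? = some e → c.edges.getLast? = some f → (f ∈ M ↔ e ∉ M)

/-- The six vertices of the hexagon with bottom-left corner `c` in the
brick-wall representation of the hexagonal lattice. -/
def hexVerts (c : ℤ × ℤ) : Set (ℤ × ℤ) :=
  {(c.1, c.2), (c.1 + 1, c.2), (c.1 + 2, c.2),
   (c.1, c.2 + 1), (c.1 + 1, c.2 + 1), (c.1 + 2, c.2 + 1)}

/-- Adjacency in the brick-wall hexagonal lattice: horizontal neighbours always,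
vertical neighbours when the parity condition holds. -/
def brickAdj (u v : ℤ × ℤ) : Prop :=
  (u.2 = v.2 ∧ (u.1 = v.1 + 1 ∨ v.1 = u.1 + 1)) ∨
    (u.1 = v.1 ∧ ((u.2 = v.2 + 1 ∧ Even (u.1 + v.2)) ∨ (v.2 = u.2 + 1 ∧ Even (u.1 + u.2))))

/-- The hexagonal system determined by a set `H` of hexagon corners: the union of
the corresponding hexagons, as a subgraph of the hexagonal (brick-wall) lattice. -/
def hexGraph (H : Set (ℤ × ℤ)) : SimpleGraph (ℤ × ℤ) :=
  SimpleGraph.fromRel fun u v =>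
    brickAdj u v ∧ ∃ c ∈ H, u ∈ hexVerts c ∧ v ∈ hexVerts c

/-- Vertex set of the hexagonal system with hexagon set `H`. -/
def hexVertexSet (H : Set (ℤ × ℤ)) : Set (ℤ × ℤ) := ⋃ c ∈ H, hexVerts c

/-- Perfect matchings of the hexagonal system with hexagon set `H`. -/
def hexPM (H : Set (ℤ × ℤ)) (M : Set (Sym2 (ℤ × ℤ))) : Prop :=
  IsPMOn (hexGraph H) (hexVertexSet H) M

/-- Forcing number of a perfect matching of a hexagonal system. -/
noncomputable def hexForcingNum (H : Set (ℤ × ℤ)) (M : Set (Sym2 (ℤ × ℤ))) : ℕ :=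
  forcingNumOn (hexGraph H) (hexVertexSet H) M

/-- `hexOmega H i` is the number of perfect matchings with forcing number `i`,
i.e. the coefficient of `x^i` in the forcing polynomial. -/
noncomputable def hexOmega (H : Set (ℤ × ℤ)) (i : ℕ) : ℕ :=
  {M | hexPM H M ∧ hexForcingNum H M = i}.ncard

/-- The benzenoid parallelogram with `k` columns and `m` rows. -/
def parallelogram (k m : ℕ) : Set (ℤ × ℤ) :=
  {p | ∃ i : ℕ, ∃ j : ℕ, i < k ∧ j < m ∧ p = (2 * (i : ℤ) + (j : ℤ), (j : ℤ))}

namespace FP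

/-- Move one step right (`true`) or up (`false`). -/
def inc : Bool → ℤ × ℤ → ℤ × ℤ
  | true, z => (z.1 + 1, z.2)
  | false, z => (z.1, z.2 + 1)

/-- `z` lies on the lattice path with word `w` starting at `p`. -/
def On : ℤ × ℤ → List Bool → ℤ × ℤ → Prop
  | p, [], z => z = p
  | p, c :: w, z => z = p ∨ On (inc c p) w z

/-- The path has a `c`-step leaving `z`. -/
def St : ℤ × ℤ → List Bool → Bool → ℤ × ℤ → Prop
  | _, [], _, _ => False
  | p, d :: w, c, z => (c = d ∧ z = p) ∨ St (inc d p) w c z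

/-- Edges of the hexagonal system, as items: `none` an off-path point, `some c` a step. -/
abbrev Item := Option Bool × (ℤ × ℤ)

def comp (p : ℤ × ℤ) (w : List Bool) : Item → Prop
  | (none, z) => ¬ On p w z
  | (some c, z) => St p w c z

/-- the forcing number of a word -/
def h : List Bool → ℕ
  | [] => 0
  | [_] => 0
  | c :: d :: w => if c = d then h (d :: w) else 1 + h w

def endp (p : ℤ × ℤ) (w : List Bool) : ℤ × ℤ :=
  (p.1 + w.count true, p.2 + w.count false)

lemma endp_cons (p : ℤ × ℤ) (c : Bool) (w : List Bool) :
    endp p (c :: w) = endp (inc c p) w := by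
  cases c <;> simp [endp, inc] <;> ring

lemma inc1 (c : Bool) (z : ℤ × ℤ) : z.1 ≤ (inc c z).1 ∧ z.2 ≤ (inc c z).2 ∧
    (inc c z).1 + (inc c z).2 = z.1 + z.2 + 1 := by
  cases c <;> simp [inc] <;> omega

lemma inc_inj {c : Bool} {z z' : ℤ × ℤ} (hh : inc c z = inc c z') : z = z' := by
  cases c <;> simp [inc, Prod.ext_iff] at hh ⊢ <;> omega

lemma inc_inj' {c d : Bool} {z : ℤ × ℤ} (hh : inc c z = inc d z) : c = d := by
  cases c <;> cases d <;> simp [inc, Prod.ext_iff] at hh ⊢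

lemma On_ge {p w z} (hz : On p w z) : p.1 ≤ z.1 ∧ p.2 ≤ z.2 := by
  induction w generalizing p with
  | nil => simp [On] at hz; subst hz; simp
  | cons c w ih =>
    rcases hz with rfl | hz
    · simp
    · have := ih hz; have := inc1 c p; omega

lemma St_On {p w c z} (hz : St p w c z) : On p w z ∧ On p w (inc c z) := by
  induction w generalizing p with
  | nil => simp [St] at hz
  | cons d w ih =>
    rcases hz with ⟨rfl, rfl⟩ | hz
    · refine ⟨Or.inl rfl, Or.inr ?_⟩
      cases w <;> simp [On]
    · exact ⟨Or.inr (ih hz).1, Or.inr (ih hz).2⟩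

lemma St_ge {p w c z} (hz : St p w c z) : p.1 ≤ z.1 ∧ p.2 ≤ z.2 := On_ge (St_On hz).1

lemma On_le {p w z} (hz : On p w z) : z.1 ≤ (endp p w).1 ∧ z.2 ≤ (endp p w).2 := by
  induction w generalizing p with
  | nil => simp [On] at hz; subst hz; simp [endp]
  | cons c w ih =>
    rcases hz with rfl | hz
    · simp [endp]
    · rw [endp_cons]; exact ih hz

lemma On_start (p w) : On p w p := by
  cases w <;> simp [On]

lemma On_end (p w) : On p w (endp p w) := by
  induction w generalizing p with
  | nil => simp [On, endp]
  | cons c w ih => rw [endp_cons]; exact Or.inr (ih _)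

lemma On_out {p w z} (hz : On p w z) : z = endp p w ∨ ∃ c, St p w c z := by
  induction w generalizing p with
  | nil => simp [On] at hz; subst hz; simp [endp]
  | cons c w ih =>
    rcases hz with rfl | hz
    · exact Or.inr ⟨c, Or.inl ⟨rfl, rfl⟩⟩
    · rw [endp_cons]
      rcases ih hz with hh | ⟨d, hd⟩
      · exact Or.inl hh
      · exact Or.inr ⟨d, Or.inr hd⟩

lemma On_in {p w z} (hz : On p w z) : z = p ∨ ∃ c z', St p w c z' ∧ inc c z' = z := by
  induction w generalizing p with
  | nil => exact Or.inl hz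
  | cons c w ih =>
    rcases hz with rfl | hz
    · exact Or.inl rfl
    · rcases ih hz with hh | ⟨d, z', hd, hd'⟩
      · exact Or.inr ⟨c, p, Or.inl ⟨rfl, rfl⟩, hh.symm⟩
      · exact Or.inr ⟨d, z', Or.inr hd, hd'⟩

lemma St_out_unique {p w c d z} (h1 : St p w c z) (h2 : St p w d z) : c = d := by
  induction w generalizing p with
  | nil => exact h1.elim
  | cons a w ih =>
    rcases h1 with ⟨rfl, rfl⟩ | h1 <;> rcases h2 with ⟨rfl, h2⟩ | h2
    · rfl
    · have := St_ge h2; have := inc1 c z; omega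
    · subst h2; have := St_ge h1; have := inc1 d z; omega
    · exact ih h1 h2

lemma St_in_unique {p w c d z z'} (h1 : St p w c z) (h2 : St p w d z')
    (he : inc c z = inc d z') : c = d ∧ z = z' := by
  induction w generalizing p with
  | nil => exact h1.elim
  | cons a w ih =>
    have i1 := inc1 c z
    have i2 := inc1 d z'
    rw [he] at i1
    have i3 := inc1 a p
    rcases h1 with ⟨rfl, rfl⟩ | h1 <;> rcases h2 with ⟨rfl, h2⟩ | h2
    · exact ⟨rfl, h2.symm⟩
    · have := St_ge h2; omega
    · subst h2; have := St_ge h1; omega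
    · exact ih h1 h2

lemma St_append {p w c d z} : St p (w ++ [d]) c z ↔ St p w c z ∨ (c = d ∧ z = endp p w) := by
  induction w generalizing p with
  | nil => simp [St, endp]
  | cons a w ih => simp [St, ih, endp_cons, or_assoc]

lemma word_inj {p w w'} (hl : w.length = w'.length)
    (hs : ∀ c z, St p w c z → St p w' c z) : w = w' := by
  induction w generalizing p w' with
  | nil => simp at hl; exact (List.length_eq_zero_iff.mp hl.symm).symm
  | cons a w ih =>
    cases w' with
    | nil => simp at hl
    | cons b w' =>
      have hab : a = b := by
        rcases hs a p (Or.inl ⟨rfl, rfl⟩) with ⟨h1, _⟩ | h1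
        · exact h1
        · have := St_ge h1; have := inc1 b p; omega
      subst hab
      congr 1
      apply ih (p := inc a p) (by simpa using hl)
      intro c z hz
      rcases hs c z (Or.inr hz) with ⟨_, rfl⟩ | h1
      · have := St_ge hz; have := inc1 a z; omega
      · exact h1

/-! ### Forcing at the level of words -/

def Forces (p : ℤ × ℤ) (w : List Bool) (S : Finset Item) : Prop :=
  (∀ s ∈ S, comp p w s) ∧
    ∀ u : List Bool, u.Perm w → (∀ s ∈ S, comp p u s) → u = w

def geq (p : ℤ × ℤ) (s : Item) : Prop := p.1 ≤ s.2.1 ∧ p.2 ≤ s.2.2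

instance (p : ℤ × ℤ) : DecidablePred (geq p) := fun s => by unfold geq; infer_instance

lemma Forces.tail {p c w S} (hf : Forces p (c :: w) S) :
    Forces (inc c p) w (S.filter (geq (inc c p))) := by
  have ic := inc1 c p
  constructor
  · rintro ⟨_ | d, z⟩ hs <;> simp only [Finset.mem_filter] at hs
    · exact fun hz => hf.1 _ hs.1 (Or.inr hz)
    · rcases hf.1 _ hs.1 with ⟨_, rfl⟩ | h1
      · have := hs.2; simp only [geq] at this; omega
      · exact h1
  · intro u hu hc
    have := hf.2 (c :: u) (hu.cons c) ?_
    · simpa using this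
    · rintro ⟨_ | d, z⟩ hs
      · have h0 := hf.1 _ hs
        rintro (rfl | hz)
        · exact h0 (Or.inl rfl)
        · exact hc (none, z) (by simp [hs, geq]; exact On_ge hz) hz
      · rcases hf.1 _ hs with h1 | h1
        · exact Or.inl h1
        · exact Or.inr (hc (some d, z) (by simp [hs, geq]; exact St_ge h1))

lemma h_le {p w S} (hf : Forces p w S) : h w ≤ S.card := by
  induction w using h.induct generalizing p S with
  | case1 => simp [h]
  | case2 => simp [h]
  | case3 d w ih =>
    simp only [h, if_true]
    exact (ih hf.tail).trans (Finset.card_filter_le _ _)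
  | case4 c d w hcd ih =>
    simp only [h, if_neg hcd]
    have h2 := ih hf.tail.tail
    have hne : ∃ s ∈ S, ¬ comp p (d :: c :: w) s := by
      by_contra! hall
      have := hf.2 _ (List.Perm.swap _ _ _) hall
      simp at this
      exact hcd this.1.symm
    obtain ⟨s, hs, hns⟩ := hne
    have hcom : inc d (inc c p) = inc c (inc d p) := by
      cases c <;> cases d <;> simp [inc]
    have hlt : ((S.filter (geq (inc c p))).filter (geq (inc d (inc c p)))).card < S.card := by
      apply Finset.card_lt_card
      refine ⟨fun x hx => by simp at hx; exact hx.1.1, fun hsub => ?_⟩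
      have hg := hsub hs
      simp only [Finset.mem_filter] at hg
      have hc := hf.1 s hs
      have hg2 := hg.2
      apply hns
      have i1 := inc1 c p
      have i2 := inc1 d (inc c p)
      have i3 := inc1 d p
      have i4 := inc1 c (inc d p)
      rw [← hcom] at i4
      rcases s with ⟨_ | e, z⟩
      · simp only [comp, On, geq, not_or] at hc hg2 ⊢
        refine ⟨hc.1, ?_, ?_⟩
        · rintro rfl; omega
        · rw [← hcom]; exact hc.2.2
      · simp only [comp, St, geq] at hc hg2 ⊢
        rcases hc with ⟨_, rfl⟩ | ⟨_, rfl⟩ | hc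
        · omega
        · omega
        · rw [← hcom]; exact Or.inr (Or.inr hc)
    omega

def shift (c : Bool) (n : ℕ) (p : ℤ × ℤ) : ℤ × ℤ := (inc c)^[n] p

lemma step_run {q c n u} (hu : St q u (!c) ((inc c)^[n] q)) :
    ∃ u', u = List.replicate n c ++ (!c) :: u' := by
  induction n generalizing q u with
  | zero =>
    cases u with
    | nil => exact hu.elim
    | cons d u =>
      rcases hu with ⟨rfl, _⟩ | hu
      · exact ⟨u, by simp⟩
      · have := St_ge hu; have := inc1 d q; simp at *; omega
  | succ n ih =>
    have key : ∀ n : ℕ, (inc c)^[n] q = if c then (q.1 + n, q.2) else (q.1, q.2 + n) := by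
      intro n
      induction n with
      | zero => simp
      | succ n ih => rw [Function.iterate_succ_apply', ih]; cases c <;> simp [inc] <;> ring
    cases u with
    | nil => exact hu.elim
    | cons d u =>
      rcases hu with ⟨rfl, hq⟩ | hu
      · rw [key] at hq
        cases c <;> simp [Prod.ext_iff] at hq <;> omega
      · have hdc : d = c := by
          have hg := St_ge hu
          rw [key] at hg
          cases c <;> cases d <;> simp [inc] at hg ⊢
        subst hdc
        rw [Function.iterate_succ_apply] at hu
        obtain ⟨u', rfl⟩ := ih hu
        exact ⟨u', by simp [List.replicate_succ]⟩

lemma St_run {q c n u d z} (hu : St q (List.replicate n c ++ u) d z) :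
    St ((inc c)^[n] q) u d z ∨ (z.1 + z.2 < ((inc c)^[n] q).1 + ((inc c)^[n] q).2) := by
  induction n generalizing q with
  | zero => left; simpa using hu
  | succ n ih =>
    rw [List.replicate_succ, List.cons_append] at hu
    rw [Function.iterate_succ_apply]
    rcases hu with ⟨_, rfl⟩ | hu
    · right
      have : ∀ (n : ℕ) (r : ℤ × ℤ), r.1 + r.2 ≤ ((inc c)^[n] r).1 + ((inc c)^[n] r).2 := by
        intro n
        induction n with
        | zero => simp
        | succ n ih =>
          intro r
          rw [Function.iterate_succ_apply]
          have := ih (inc c r); have := inc1 c r; omega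
      have := this n (inc c z); have := inc1 c z; omega
    · exact ih hu

lemma exists_forcing (w : List Bool) (p : ℤ × ℤ) : ∃ S : Finset Item, S.card = h w ∧
    (∀ s ∈ S, ∃ c z, s = (some c, z) ∧ St p w c z) ∧
    ∀ c, (w = [] ∨ ∃ v, w = c :: v) → ∀ (n : ℕ) (q : ℤ × ℤ), (inc c)^[n] q = p →
      ∀ u : List Bool, u.Perm (List.replicate n c ++ w) → (∀ s ∈ S, comp q u s) →
        u = List.replicate n c ++ w := by
  induction w using h.induct generalizing p with
  | case1 =>
    refine ⟨∅, by simp [h], by simp, ?_⟩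
    intro c _ n q _ u hu _
    simpa using List.perm_replicate.mp (by simpa using hu)
  | case2 d =>
    refine ⟨∅, by simp [h], by simp, ?_⟩
    intro c hc n q _ u hu _
    obtain rfl : c = d := by
      rcases hc with hc | ⟨v, hv⟩
      · simp at hc
      · simp at hv; exact hv.1.symm
    have e : List.replicate n c ++ [c] = List.replicate (n + 1) c := List.replicate_succ'.symm
    rw [e] at hu ⊢
    exact List.perm_replicate.mp hu
  | case3 d w ih =>
    obtain ⟨S, h1, h2, h3⟩ := ih (inc d p)
    refine ⟨S, by simpa [h] using h1, ?_, ?_⟩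
    · intro s hs
      obtain ⟨c, z, rfl, hz⟩ := h2 s hs
      exact ⟨c, z, rfl, Or.inr hz⟩
    · intro c hc n q hq u hu hS
      obtain rfl : c = d := by
        rcases hc with hc | ⟨v, hv⟩
        · simp at hc
        · simp at hv; exact hv.1.symm
      have e : List.replicate n c ++ c :: c :: w = List.replicate (n + 1) c ++ c :: w := by
        rw [List.replicate_succ']; simp
      rw [e] at hu ⊢
      refine h3 c (Or.inr ⟨w, rfl⟩) (n + 1) q ?_ u hu hS
      rw [Function.iterate_succ_apply', hq]
  | case4 a b w hab ih =>
    obtain ⟨S, h1, h2, h3⟩ := ih (inc b (inc a p))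
    obtain rfl : b = !a := by cases a <;> cases b <;> simp at hab ⊢
    have hnot : ((some (!a), inc a p) : Item) ∉ S := by
      intro hs
      obtain ⟨c, z, he, hz⟩ := h2 _ hs
      simp at he
      have := St_ge hz
      have := inc1 (!a) (inc a p)
      rw [← he.2] at *
      omega
    refine ⟨insert (some (!a), inc a p) S, ?_, ?_, ?_⟩
    · rw [Finset.card_insert_of_notMem hnot, h1]; simp [h]; omega
    · intro s hs
      rcases Finset.mem_insert.mp hs with rfl | hs
      · exact ⟨_, _, rfl, Or.inr (Or.inl ⟨rfl, rfl⟩)⟩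
      · obtain ⟨c, z, rfl, hz⟩ := h2 s hs
        exact ⟨c, z, rfl, Or.inr (Or.inr hz)⟩
    · intro c hc n q hq u hu hS
      obtain rfl : c = a := by
        rcases hc with hc | ⟨v, hv⟩
        · simp at hc
        · simp at hv; exact hv.1.symm
      have hq' : (inc c)^[n + 1] q = inc c p := by rw [Function.iterate_succ_apply', hq]
      have e : List.replicate n c ++ c :: (!c) :: w
          = List.replicate (n + 1) c ++ (!c) :: w := by
        rw [List.replicate_succ']; simp
      rw [e] at hu ⊢
      have hst : St q u (!c) ((inc c)^[n + 1] q) := by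
        rw [hq']; exact hS _ (Finset.mem_insert_self _ _)
      obtain ⟨u', rfl⟩ := step_run hst
      have hu' : u'.Perm w := by
        have := (List.perm_append_left_iff _).mp hu
        exact (List.perm_cons _).mp this
      have hS' : ∀ s ∈ S, comp (inc (!c) (inc c p)) u' s := by
        intro s hs
        have hc1 := hS s (Finset.mem_insert_of_mem hs)
        obtain ⟨d, z, rfl, hz⟩ := h2 s hs
        have hge := St_ge hz
        have i1 := inc1 (!c) (inc c p)
        rcases St_run hc1 with hh | hh
        · rw [hq'] at hh
          rcases hh with ⟨_, rfl⟩ | hh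
          · omega
          · exact hh
        · rw [hq'] at hh; omega
      have : u' = w := by
        cases w with
        | nil => simpa using hu'
        | cons d w =>
          simpa using h3 d (Or.inr ⟨w, rfl⟩) 0 _ rfl u' (by simpa using hu') hS'
      rw [this]

lemma exists_forces (w : List Bool) (p : ℤ × ℤ) : ∃ S : Finset Item, S.card = h w ∧
    (∀ s ∈ S, ∃ c z, s = (some c, z) ∧ St p w c z) ∧ Forces p w S := by
  obtain ⟨S, h1, h2, h3⟩ := exists_forcing w p
  refine ⟨S, h1, h2, ?_, ?_⟩
  · intro s hs
    obtain ⟨c, z, rfl, hz⟩ := h2 s hs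
    exact hz
  · intro u hu hS
    cases w with
    | nil => simpa using hu
    | cons d w => simpa using h3 d (Or.inr ⟨w, rfl⟩) 0 p rfl u (by simpa using hu) hS

/-! ### Counting words -/

def Wd (k m : ℕ) : Set (List Bool) := {w | w.count true = k ∧ w.count false = m}

noncomputable def N (pre : List Bool) (k m i : ℕ) : ℕ :=
  {w | w ∈ Wd k m ∧ h (pre ++ w) = i}.ncard

lemma Wd_length {k m w} (hw : w ∈ Wd k m) : w.length = k + m := by
  obtain ⟨rfl, rfl⟩ := hw
  exact (List.count_true_add_count_false w).symm

lemma Wd_perm {k m w w'} (hw : w ∈ Wd k m) (hw' : w' ∈ Wd k m) : w.Perm w' := by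
  rw [List.perm_iff_count]
  rintro (_ | _)
  · rw [hw.2, hw'.2]
  · rw [hw.1, hw'.1]

lemma Wd_finite (k m : ℕ) : (Wd k m).Finite :=
  (List.finite_length_eq Bool (k + m)).subset fun _ hw => Wd_length hw

lemma Nset_finite (pre k m i) : {w | w ∈ Wd k m ∧ h (pre ++ w) = i}.Finite :=
  (Wd_finite k m).subset fun _ hw => hw.1

/-- the part of `N` from first letter right / up -/
lemma N_split (pre : List Bool) (k m i : ℕ) (hkm : k + m ≠ 0) :
    N pre k m i = (if k = 0 then 0 else N (pre ++ [true]) (k - 1) m i) +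
      (if m = 0 then 0 else N (pre ++ [false]) k (m - 1) i) := by
  have e : {w | w ∈ Wd k m ∧ h (pre ++ w) = i} =
      (List.cons true '' (if k = 0 then ∅ else {w | w ∈ Wd (k-1) m ∧ h ((pre ++ [true]) ++ w) = i}))
      ∪ (List.cons false '' (if m = 0 then ∅ else {w | w ∈ Wd k (m-1) ∧ h ((pre ++ [false]) ++ w) = i})) := by
    ext w
    cases w with
    | nil =>
      simp [Wd]; omega
    | cons c w =>
      cases c
      · rcases m with _ | m <;> simp [Wd]
      · rcases k with _ | k <;> simp [Wd]
  unfold N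
  rw [e, Set.ncard_union_eq ?_ ?_ ?_]
  · rw [Set.ncard_image_of_injective _ (List.cons_injective),
      Set.ncard_image_of_injective _ (List.cons_injective)]
    congr 1 <;> split_ifs <;> simp
  · rw [Set.disjoint_left]
    rintro _ ⟨a, _, rfl⟩ ⟨b, _, hb⟩
    simp at hb
  · apply Set.Finite.image
    split_ifs
    · exact Set.finite_empty
    · exact Nset_finite _ _ _ _
  · apply Set.Finite.image
    split_ifs
    · exact Set.finite_empty
    · exact Nset_finite _ _ _ _

lemma N_same (c : Bool) (k m i : ℕ) : N [c, c] k m i = N [c] k m i := by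
  simp [N, h]

lemma N_diff (c : Bool) (k m i : ℕ) : N [c, !c] k m (i + 1) = N [] k m i := by
  unfold N
  congr 1
  ext w
  simp [h]; intro _; omega

lemma N_diff0 (c : Bool) (k m : ℕ) : N [c, !c] k m 0 = 0 := by
  unfold N
  rw [Set.ncard_eq_zero (Nset_finite _ _ _ _)]
  ext w
  simp [h]

lemma N_true (k m i : ℕ) :
    N [true] k (m + 1) (i + 1) = ∑ i' ∈ Finset.range (k + 1), N [] i' m i := by
  induction k with
  | zero =>
    rw [N_split _ _ _ _ (by omega)]
    simpa using N_diff true 0 m i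
  | succ k ih =>
    rw [N_split _ _ _ _ (by omega), Finset.sum_range_succ, ← ih]
    simpa [N_same] using N_diff true (k+1) m i

lemma N_false (k m i : ℕ) :
    N [false] (k + 1) m (i + 1) = ∑ j ∈ Finset.range (m + 1), N [] k j i := by
  induction m with
  | zero =>
    rw [N_split _ _ _ _ (by omega)]
    simpa using N_diff false k 0 i
  | succ m ih =>
    rw [N_split _ _ _ _ (by omega), Finset.sum_range_succ, ← ih]
    have := N_diff false k (m+1) i
    simp [N_same] at this ⊢
    omega

lemma N_true0 (k m : ℕ) : N [true] k (m + 1) 0 = 0 := by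
  induction k with
  | zero =>
    rw [N_split _ _ _ _ (by omega)]
    simpa using N_diff0 true 0 m
  | succ k ih =>
    rw [N_split _ _ _ _ (by omega)]
    simpa [N_same, ih] using N_diff0 true (k+1) m

lemma N_false0 (k m : ℕ) : N [false] (k + 1) m 0 = 0 := by
  induction m with
  | zero =>
    rw [N_split _ _ _ _ (by omega)]
    simpa using N_diff0 false k 0
  | succ m ih =>
    rw [N_split _ _ _ _ (by omega)]
    simpa [N_same, ih] using N_diff0 false k (m+1)

lemma N_rec (k m i : ℕ) : N [] (k + 1) (m + 1) (i + 1) =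
    (∑ i' ∈ Finset.range (k + 1), N [] i' m i) + ∑ j ∈ Finset.range (m + 1), N [] k j i := by
  rw [N_split _ _ _ _ (by omega), ← N_true, ← N_false]
  simp

lemma N_rec0 (k m : ℕ) : N [] (k + 1) (m + 1) 0 = 0 := by
  rw [N_split _ _ _ _ (by omega)]
  simp [N_true0, N_false0]

lemma h_replicate (n : ℕ) (c : Bool) : h (List.replicate n c) = 0 := by
  induction n with
  | zero => rfl
  | succ n ih =>
    cases n with
    | zero => rfl
    | succ n => simpa [List.replicate_succ, h] using ih

lemma N_replicate (k m n i : ℕ) (c : Bool) (hW : Wd k m = {List.replicate n c}) :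
    N [] k m i = if i = 0 then 1 else 0 := by
  unfold N
  rw [hW]
  split_ifs with hi
  · subst hi
    rw [Set.ncard_eq_one]
    refine ⟨List.replicate n c, ?_⟩
    ext w; simp; rintro rfl; exact h_replicate _ _
  · have : {w | w ∈ ({List.replicate n c} : Set (List Bool)) ∧ h ([] ++ w) = i} = ∅ := by
      ext w; simp; rintro rfl; rw [h_replicate]; omega
    rw [this]; simp

lemma N_zero_left (n i : ℕ) : N [] 0 n i = if i = 0 then 1 else 0 := by
  apply N_replicate 0 n n i false
  ext w
  constructor
  · intro hw
    have : w.Perm (List.replicate n false) := Wd_perm hw ⟨by simp [List.count_replicate], by simp⟩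
    exact List.perm_replicate.mp this
  · rintro rfl; exact ⟨by simp [List.count_replicate], by simp⟩

lemma N_zero_right (n i : ℕ) : N [] n 0 i = if i = 0 then 1 else 0 := by
  apply N_replicate n 0 n i true
  ext w
  constructor
  · intro hw
    have : w.Perm (List.replicate n true) := Wd_perm hw ⟨by simp, by simp [List.count_replicate]⟩
    exact List.perm_replicate.mp this
  · rintro rfl; exact ⟨by simp, by simp [List.count_replicate]⟩

/-! ### Items and edges -/

def U (z : ℤ × ℤ) : ℤ × ℤ := (2 * z.1 + z.2, z.2)
def Dn (z : ℤ × ℤ) : ℤ × ℤ := (2 * z.1 + z.2 - 1, z.2)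

def hd : Item → ℤ × ℤ
  | (none, z) => z
  | (some c, z) => inc c z

def E (it : Item) : Sym2 (ℤ × ℤ) := s(U it.2, Dn (hd it))

lemma U_inj {z z'} (hh : U z = U z') : z = z' := by
  simp only [U, Prod.ext_iff] at hh ⊢; omega

lemma Dn_inj {z z'} (hh : Dn z = Dn z') : z = z' := by
  simp only [Dn, Prod.ext_iff] at hh ⊢; omega

lemma U_ne_Dn (z z') : U z ≠ Dn z' := by
  intro hh
  simp only [U, Dn, Prod.ext_iff] at hh; omega

lemma U_mem {z it} : U z ∈ E it ↔ it.2 = z := by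
  simp only [E, Sym2.mem_iff, U_ne_Dn, or_false]
  exact ⟨fun hh => (U_inj hh).symm, fun hh => by rw [hh]⟩

lemma Dn_mem {z it} : Dn z ∈ E it ↔ hd it = z := by
  simp only [E, Sym2.mem_iff, (U_ne_Dn _ _).symm, false_or]
  exact ⟨fun hh => (Dn_inj hh).symm, fun hh => by rw [hh]⟩

lemma item_ext {a b : Item} (h1 : a.2 = b.2) (h2 : hd a = hd b) : a = b := by
  rcases a with ⟨_ | c, z⟩ <;> rcases b with ⟨_ | d, z'⟩ <;> simp only [hd] at h1 h2 <;> subst h1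
  · rfl
  · have := inc1 d z; rw [← h2] at this; omega
  · have := inc1 c z; rw [h2] at this; omega
  · rw [inc_inj' h2]

lemma E_inj : Function.Injective E := by
  intro a b hab
  apply item_ext
  · have : U b.2 ∈ E a := hab ▸ U_mem.mpr rfl
    exact U_mem.mp this
  · have : Dn (hd b) ∈ E a := hab ▸ Dn_mem.mpr rfl
    exact Dn_mem.mp this

def Box (k m : ℕ) (z : ℤ × ℤ) : Prop := 0 ≤ z.1 ∧ z.1 ≤ k ∧ 0 ≤ z.2 ∧ z.2 ≤ m

def Valid (k m : ℕ) : Item → Prop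
  | (none, z) => Box k m z ∧ 0 < z.1 + z.2 ∧ z.1 + z.2 < k + m
  | (some c, z) => Box k m z ∧ Box k m (inc c z)

lemma mem_hex (u c : ℤ × ℤ) : u ∈ hexVerts c ↔
    c.1 ≤ u.1 ∧ u.1 ≤ c.1 + 2 ∧ c.2 ≤ u.2 ∧ u.2 ≤ c.2 + 1 := by
  simp only [hexVerts, Set.mem_insert_iff, Set.mem_singleton_iff, Prod.ext_iff]
  omega

lemma edge_aux {k m : ℕ} {u v c : ℤ × ℤ} (hb : brickAdj u v) (hc : c ∈ parallelogram k m)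
    (hu : u ∈ hexVerts c) (hv : v ∈ hexVerts c) : ∃ it, Valid k m it ∧ s(u, v) = E it := by
  obtain ⟨i, j, hi, hj, rfl⟩ := hc
  rw [mem_hex] at hu hv
  obtain ⟨x, y⟩ := u
  obtain ⟨x', y'⟩ := v
  simp only at hu hv
  have hor : ∀ a b : ℤ, 2 * (i:ℤ) + j ≤ a → a + 1 ≤ 2 * (i:ℤ) + j + 2 → (j:ℤ) ≤ b → b ≤ (j:ℤ) + 1 →
      ∃ it, Valid k m it ∧ s((a, b), (a + 1, b)) = E it := by
    intro a b h1 h2 h3 h4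
    have hbj : b = j ∨ b = j + 1 := by omega
    rcases Int.even_or_odd' (a - b) with ⟨t, ht | ht⟩
    · refine ⟨(some true, (t, b)), ?_, ?_⟩
      · simp only [Valid, Box, inc]; rcases hbj with rfl | rfl <;> omega
      · simp only [E, U, Dn, hd, inc]
        apply congrArg₂ (fun x y => s(x, y)) <;> simp only [Prod.ext_iff, and_true] <;> omega
    · refine ⟨(none, (t + 1, b)), ?_, ?_⟩
      · simp only [Valid, Box]; rcases hbj with rfl | rfl <;> omega
      · rw [Sym2.eq_swap]; simp only [E, U, Dn, hd]
        apply congrArg₂ (fun x y => s(x, y)) <;> simp only [Prod.ext_iff, and_true] <;> omega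
  have ver : ∀ a b : ℤ, Even (a + b) → 2 * (i:ℤ) + j ≤ a → a ≤ 2 * (i:ℤ) + j + 2 →
      (j:ℤ) ≤ b → b + 1 ≤ (j:ℤ) + 1 →
      ∃ it, Valid k m it ∧ s((a, b), (a, b + 1)) = E it := by
    intro a b he h1 h2 h3 h4
    obtain ⟨t, ht⟩ := he
    refine ⟨(some false, (t - b, b)), ?_, ?_⟩
    · simp only [Valid, Box, inc]; omega
    · simp only [E, U, Dn, hd, inc]
      apply congrArg₂ (fun x y => s(x, y)) <;> simp only [Prod.ext_iff, and_true] <;> omega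
  simp only [brickAdj] at hb
  rcases hb with ⟨rfl, rfl | rfl⟩ | ⟨rfl, ⟨rfl, he⟩ | ⟨rfl, he⟩⟩
  · rw [Sym2.eq_swap]; apply hor <;> omega
  · apply hor <;> omega
  · rw [Sym2.eq_swap]; apply ver _ _ he <;> omega
  · apply ver _ _ he <;> omega

lemma edge_to {k m : ℕ} {e} (he : e ∈ (hexGraph (parallelogram k m)).edgeSet) :
    ∃ it, Valid k m it ∧ e = E it := by
  induction e using Sym2.ind with
  | _ u v =>
    rw [SimpleGraph.mem_edgeSet] at he
    obtain ⟨_, ⟨hb, c, hc, hu, hv⟩ | ⟨hb, c, hc, hu, hv⟩⟩ := he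
    · exact edge_aux hb hc hu hv
    · rw [Sym2.eq_swap]; exact edge_aux hb hc hu hv

lemma edge_of {k m : ℕ} (hk : 1 ≤ k) (hm : 1 ≤ m) {it} (hv : Valid k m it) :
    E it ∈ (hexGraph (parallelogram k m)).edgeSet := by
  have key : ∀ (u v : ℤ × ℤ), u ≠ v → brickAdj u v → (∃ i j : ℤ, 0 ≤ i ∧ i < k ∧ 0 ≤ j ∧ j < m ∧
      u ∈ hexVerts (2 * i + j, j) ∧ v ∈ hexVerts (2 * i + j, j)) →
      s(u, v) ∈ (hexGraph (parallelogram k m)).edgeSet := by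
    rintro u v hne hb ⟨i, j, h1, h2, h3, h4, h5, h6⟩
    rw [SimpleGraph.mem_edgeSet]
    refine ⟨hne, Or.inl ⟨hb, (2 * i + j, j), ⟨i.toNat, j.toNat, by omega, by omega, ?_⟩, h5, h6⟩⟩
    simp only [Prod.ext_iff]; omega
  apply key _ _ (U_ne_Dn _ _)
  · rcases it with ⟨_ | _ | _, z⟩
    · left; simp only [U, Dn, hd, true_and]; omega
    · right
      refine ⟨by simp only [U, Dn, hd, inc]; omega, Or.inr ⟨by simp only [U, Dn, hd, inc], ?_⟩⟩
      simp only [U]; exact ⟨z.1 + z.2, by ring⟩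
    · left; simp only [U, Dn, hd, inc, true_and]; omega
  · simp only [mem_hex]
    rcases it with ⟨_ | _ | _, z⟩ <;> simp only [Valid, Box, inc] at hv <;>
      simp only [U, Dn, hd, inc]
    · by_cases hz : 1 ≤ z.1 ∧ z.2 < m
      · exact ⟨z.1 - 1, z.2, by omega⟩
      · exact ⟨z.1, z.2 - 1, by omega⟩
    · by_cases hz : z.1 < k
      · exact ⟨z.1, z.2, by omega⟩
      · exact ⟨z.1 - 1, z.2, by omega⟩
    · by_cases hz : z.2 < m
      · exact ⟨z.1, z.2, by omega⟩
      · exact ⟨z.1, z.2 - 1, by omega⟩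

lemma edge_verts {H : Set (ℤ × ℤ)} {e v} (he : e ∈ (hexGraph H).edgeSet) (hv : v ∈ e) :
    v ∈ hexVertexSet H := by
  induction e using Sym2.ind with
  | _ a b =>
    rw [SimpleGraph.mem_edgeSet] at he
    simp only [hexVertexSet, Set.mem_iUnion]
    obtain ⟨_, ⟨_, c, hc, ha, hb⟩ | ⟨_, c, hc, hb, ha⟩⟩ := he <;>
    · refine ⟨c, hc, ?_⟩
      rcases Sym2.mem_iff.mp hv with rfl | rfl
      · exact ha
      · exact hb

lemma vert_to {k m : ℕ} {v} (hv : v ∈ hexVertexSet (parallelogram k m)) :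
    (∃ z, Box k m z ∧ z.1 + z.2 < k + m ∧ v = U z) ∨
    (∃ z, Box k m z ∧ 0 < z.1 + z.2 ∧ v = Dn z) := by
  simp only [hexVertexSet, Set.mem_iUnion] at hv
  obtain ⟨_, ⟨i, j, hi, hj, rfl⟩, hv⟩ := hv
  rw [mem_hex] at hv
  obtain ⟨x, y⟩ := v
  simp only at hv
  have hyj : y = j ∨ y = j + 1 := by omega
  rcases Int.even_or_odd' (x - y) with ⟨t, ht | ht⟩
  · left
    refine ⟨(t, y), ?_, ?_, ?_⟩ <;> simp only [Box, U, Prod.ext_iff, and_true] <;>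
      rcases hyj with rfl | rfl <;> omega
  · right
    refine ⟨(t + 1, y), ?_, ?_, ?_⟩ <;> simp only [Box, Dn, Prod.ext_iff, and_true] <;>
      rcases hyj with rfl | rfl <;> omega

lemma vert_U {k m : ℕ} (hk : 1 ≤ k) (hm : 1 ≤ m) {z} (hz : Box k m z) (hz' : z.1 + z.2 < k + m) :
    U z ∈ hexVertexSet (parallelogram k m) := by
  simp only [Box] at hz
  by_cases hh : z.1 < k
  · apply edge_verts (edge_of hk hm (it := (some true, z)) ?_) (U_mem.mpr rfl)
    simp only [Valid, Box, inc]; omega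
  · apply edge_verts (edge_of hk hm (it := (some false, z)) ?_) (U_mem.mpr rfl)
    simp only [Valid, Box, inc]; omega

lemma vert_Dn {k m : ℕ} (hk : 1 ≤ k) (hm : 1 ≤ m) {z} (hz : Box k m z) (hz' : 0 < z.1 + z.2) :
    Dn z ∈ hexVertexSet (parallelogram k m) := by
  simp only [Box] at hz
  by_cases hh : 0 < z.1
  · apply edge_verts (edge_of hk hm (it := (some true, (z.1 - 1, z.2))) ?_) (Dn_mem.mpr ?_)
    · simp only [Valid, Box, inc]; omega
    · simp [hd, inc]
  · apply edge_verts (edge_of hk hm (it := (some false, (z.1, z.2 - 1))) ?_) (Dn_mem.mpr ?_)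
    · simp only [Valid, Box, inc]; omega
    · simp [hd, inc]

/-! ### Matchings and words -/

def matchOf (k m : ℕ) (w : List Bool) : Set (Sym2 (ℤ × ℤ)) :=
  E '' {it | Valid k m it ∧ comp (0, 0) w it}

lemma endp_Wd {k m w} (hw : w ∈ Wd k m) : endp (0, 0) w = ((k : ℤ), (m : ℤ)) := by
  simp [endp, hw.1, hw.2]

lemma On_box {k m w z} (hw : w ∈ Wd k m) (hz : On (0, 0) w z) : Box k m z := by
  have h1 := On_ge hz
  have h2 := On_le hz
  rw [endp_Wd hw] at h2
  simp only [Box] at *; omega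

lemma St_valid {k m w c z} (hw : w ∈ Wd k m) (hz : St (0, 0) w c z) :
    Valid k m (some c, z) := ⟨On_box hw (St_On hz).1, On_box hw (St_On hz).2⟩

lemma comp_tail_unique {w a b} (ha : comp (0, 0) w a) (hb : comp (0, 0) w b)
    (hab : a.2 = b.2) : a = b := by
  rcases a with ⟨_ | c, z⟩ <;> rcases b with ⟨_ | d, z'⟩ <;> simp only at hab <;> subst hab
  · rfl
  · exact (ha (St_On hb).1).elim
  · exact (hb (St_On ha).1).elim
  · rw [St_out_unique ha hb]

lemma comp_head_unique {w a b} (ha : comp (0, 0) w a) (hb : comp (0, 0) w b)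
    (hab : hd a = hd b) : a = b := by
  rcases a with ⟨_ | c, z⟩ <;> rcases b with ⟨_ | d, z'⟩ <;> simp only [hd] at hab
  · rw [hab]
  · subst hab; exact (ha (St_On hb).2).elim
  · subst hab; exact (hb (St_On ha).2).elim
  · obtain ⟨rfl, rfl⟩ := St_in_unique ha hb hab; rfl

lemma matchOf_PM {k m : ℕ} (hk : 1 ≤ k) (hm : 1 ≤ m) {w} (hw : w ∈ Wd k m) :
    hexPM (parallelogram k m) (matchOf k m w) := by
  have hsub : matchOf k m w ⊆ (hexGraph (parallelogram k m)).edgeSet := by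
    rintro _ ⟨it, ⟨hv, _⟩, rfl⟩
    exact edge_of hk hm hv
  refine ⟨hsub, fun e he v hv => edge_verts (hsub he) hv, ?_, ?_⟩
  · rintro _ ⟨a, ⟨_, ha⟩, rfl⟩ _ ⟨b, ⟨_, hb⟩, rfl⟩ hne v hva hvb
    apply hne
    rcases Sym2.mem_iff.mp hva with rfl | rfl
    · rw [comp_tail_unique ha hb (U_mem.mp hvb).symm]
    · rw [comp_head_unique ha hb (Dn_mem.mp hvb).symm]
  · intro v hv
    rcases vert_to hv with ⟨z, hz, hz', rfl⟩ | ⟨z, hz, hz', rfl⟩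
    · by_cases hon : On (0, 0) w z
      · rcases On_out hon with hh | ⟨c, hc⟩
        · rw [endp_Wd hw] at hh; subst hh; simp at hz'
        · exact ⟨_, ⟨(some c, z), ⟨St_valid hw hc, hc⟩, rfl⟩, U_mem.mpr rfl⟩
      · refine ⟨_, ⟨(none, z), ⟨⟨hz, ?_, hz'⟩, hon⟩, rfl⟩, U_mem.mpr rfl⟩
        by_contra hneg
        apply hon
        have : z = (0, 0) := by simp only [Box, Prod.ext_iff] at *; omega
        rw [this]; exact On_start _ _
    · by_cases hon : On (0, 0) w z
      · rcases On_in hon with hh | ⟨c, z', hc, rfl⟩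
        · subst hh; simp at hz'
        · exact ⟨_, ⟨(some c, z'), ⟨St_valid hw hc, hc⟩, rfl⟩, Dn_mem.mpr rfl⟩
      · refine ⟨_, ⟨(none, z), ⟨⟨hz, hz', ?_⟩, hon⟩, rfl⟩, Dn_mem.mpr rfl⟩
        by_contra hneg
        apply hon
        have : z = endp (0, 0) w := by
          rw [endp_Wd hw]; simp only [Box, Prod.ext_iff] at *; omega
        rw [this]; exact On_end _ _

lemma PM_unique {V : Type*} {G : SimpleGraph V} {A M} (hM : IsPMOn G A M) {e f v}
    (he : e ∈ M) (hf : f ∈ M) (hve : v ∈ e) (hvf : v ∈ f) : e = f := by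
  by_contra hne
  exact hM.2.2.1 he hf hne v hve hvf

lemma PM_sub {V : Type*} {G : SimpleGraph V} {A M M'} (hM : IsPMOn G A M) (hM' : IsPMOn G A M')
    (hs : M ⊆ M') : M = M' := by
  apply hs.antisymm
  intro e he
  have hv : ∃ v, v ∈ e := by
    induction e using Sym2.ind with
    | _ a b => exact ⟨a, by simp⟩
  obtain ⟨v, hv⟩ := hv
  obtain ⟨f, hf, hvf⟩ := hM.2.2.2 v (hM'.2.1 e he v hv)
  rwa [PM_unique hM' he (hs hf) hv hvf]

lemma exists_word {k m : ℕ} (hk : 1 ≤ k) (hm : 1 ≤ m) {M}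
    (hM : hexPM (parallelogram k m) M) : ∃ w ∈ Wd k m, M = matchOf k m w := by
  have val : ∀ a, E a ∈ M → Valid k m a := by
    intro a ha
    obtain ⟨b, hb, hab⟩ := edge_to (hM.1 ha)
    rwa [E_inj hab]
  have uU : ∀ a b, E a ∈ M → E b ∈ M → a.2 = b.2 → a = b := fun a b ha hb hab =>
    E_inj (PM_unique hM ha hb (v := U b.2) (U_mem.mpr hab) (U_mem.mpr rfl))
  have uD : ∀ a b, E a ∈ M → E b ∈ M → hd a = hd b → a = b := fun a b ha hb hab =>
    E_inj (PM_unique hM ha hb (v := Dn (hd b)) (Dn_mem.mpr hab) (Dn_mem.mpr rfl))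
  have cU : ∀ z, Box k m z → z.1 + z.2 < k + m → ∃ a, E a ∈ M ∧ a.2 = z := by
    intro z hz hz'
    obtain ⟨e, he, hv⟩ := hM.2.2.2 _ (vert_U hk hm hz hz')
    obtain ⟨a, _, rfl⟩ := edge_to (hM.1 he)
    exact ⟨a, he, U_mem.mp hv⟩
  have cD : ∀ z, Box k m z → 0 < z.1 + z.2 → ∃ a, E a ∈ M ∧ hd a = z := by
    intro z hz hz'
    obtain ⟨e, he, hv⟩ := hM.2.2.2 _ (vert_Dn hk hm hz hz')
    obtain ⟨a, _, rfl⟩ := edge_to (hM.1 he)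
    exact ⟨a, he, Dn_mem.mp hv⟩
  have build : ∀ n : ℕ, n ≤ k + m → ∃ w : List Bool, w.length = n ∧
      (∀ c z, St (0, 0) w c z → E (some c, z) ∈ M) ∧ Box k m (endp (0, 0) w) := by
    intro n
    induction n with
    | zero => exact fun _ => ⟨[], rfl, fun c z hz => hz.elim, by simp [endp, Box]⟩
    | succ n ih =>
      intro hn
      obtain ⟨w, hl, hst, hb⟩ := ih (by omega)
      have hsum : (endp (0, 0) w).1 + (endp (0, 0) w).2 = n := by
        have := List.count_true_add_count_false w
        simp only [endp]; omega
      obtain ⟨a, ha, ha2⟩ := cU _ hb (by omega)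
      rcases a with ⟨_ | c, z⟩
      · exfalso
        simp only at ha2
        rcases On_in (On_end (0, 0) w) with hh | ⟨c, z', hc, hh⟩
        · have := (val _ ha).2.1
          rw [ha2, hh] at this; simp at this
        · have := uD _ _ ha (hst c z' hc) (by simp only [hd]; rw [ha2, hh])
          simp at this
      · simp only at ha2
        subst ha2
        refine ⟨w ++ [c], by simp [hl], ?_, ?_⟩
        · intro d z hz
          rcases St_append.mp hz with hz | ⟨rfl, rfl⟩
          · exact hst _ _ hz
          · exact ha
        · have e : endp (0, 0) (w ++ [c]) = inc c (endp (0, 0) w) := by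
            cases c <;> simp [endp, inc]
          rw [e]; exact (val _ ha).2
  obtain ⟨w, hl, hst, hb⟩ := build (k + m) le_rfl
  have hw : w ∈ Wd k m := by
    have := List.count_true_add_count_false w
    simp only [Box, endp] at hb
    constructor <;> omega
  refine ⟨w, hw, (PM_sub (matchOf_PM hk hm hw) hM ?_).symm⟩
  have off : ∀ (n : ℕ) (z : ℤ × ℤ), z.1 + z.2 = n → Box k m z → ¬ On (0, 0) w z →
      E (none, z) ∈ M := by
    intro n
    induction n with
    | zero =>
      intro z hz hbz hon
      have : z = (0, 0) := by simp only [Box, Prod.ext_iff] at *; omega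
      exact (hon (this ▸ On_start _ _)).elim
    | succ n ih =>
      intro z hz hbz hon
      obtain ⟨⟨_ | c, z'⟩, ha, ha2⟩ := cD z hbz (by omega)
      · simp only [hd] at ha2; rwa [← ha2]
      · exfalso
        simp only [hd] at ha2
        subst ha2
        have hi := inc1 c z'
        have hbz' := (val _ ha).1
        by_cases hon' : On (0, 0) w z'
        · rcases On_out hon' with hh | ⟨d, hd'⟩
          · rw [endp_Wd hw] at hh
            subst hh
            simp only [Box] at hbz; omega
          · have := uU _ _ ha (hst d z' hd') rfl
            simp at this
            subst this
            exact hon (St_On hd').2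
        · have := uU _ _ ha (ih z' (by push_cast at hz; omega) hbz' hon') rfl
          simp at this
  rintro _ ⟨⟨_ | c, z⟩, ⟨hv, hc⟩, rfl⟩
  · exact off (z.1 + z.2).toNat z (by have := hv.2.1; omega) hv.1 hc
  · exact hst _ _ hc

lemma comp_of_mem {k m w it} (hh : E it ∈ matchOf k m w) : Valid k m it ∧ comp (0, 0) w it := by
  obtain ⟨a, ha, hE⟩ := hh
  rw [← E_inj hE]; exact ha

lemma matchOf_inj {k m w w'} (hw : w ∈ Wd k m) (hw' : w' ∈ Wd k m)
    (he : matchOf k m w = matchOf k m w') : w = w' := by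
  apply word_inj (p := (0, 0)) (by rw [Wd_length hw, Wd_length hw'])
  intro c z hz
  have : E (some c, z) ∈ matchOf k m w := ⟨_, ⟨St_valid hw hz, hz⟩, rfl⟩
  rw [he] at this
  exact (comp_of_mem this).2

lemma Valid_finite (k m : ℕ) : {it | Valid k m it}.Finite := by
  have : (Set.univ ×ˢ (Set.Icc (0 : ℤ) k ×ˢ Set.Icc (0 : ℤ) m) : Set Item).Finite :=
    Set.finite_univ.prod ((Set.finite_Icc _ _).prod (Set.finite_Icc _ _))
  refine this.subset ?_
  rintro ⟨_ | c, z⟩ hz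
  · have := hz.1; simp only [Box] at this
    simp only [Set.mem_prod, Set.mem_univ, Set.mem_Icc, true_and]; omega
  · have := hz.1; simp only [Box] at this
    simp only [Set.mem_prod, Set.mem_univ, Set.mem_Icc, true_and]; omega

lemma forcing_eq {k m : ℕ} (hk : 1 ≤ k) (hm : 1 ≤ m) {w} (hw : w ∈ Wd k m) :
    hexForcingNum (parallelogram k m) (matchOf k m w) = h w := by
  unfold hexForcingNum forcingNumOn
  apply IsLeast.csInf_eq
  constructor
  · obtain ⟨S, h1, h2, h3⟩ := exists_forces w (0, 0)
    refine ⟨E '' (S : Set Item), ⟨?_, ?_⟩, ?_⟩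
    · rintro _ ⟨s, hs, rfl⟩
      obtain ⟨c, z, rfl, hz⟩ := h2 s hs
      exact ⟨_, ⟨St_valid hw hz, hz⟩, rfl⟩
    · intro M' hM' hS
      obtain ⟨u, hu, rfl⟩ := exists_word hk hm hM'
      rw [h3.2 u (Wd_perm hu hw) fun s hs => (comp_of_mem (hS ⟨s, hs, rfl⟩)).2]
    · rw [Set.ncard_image_of_injective _ E_inj, Set.ncard_coe_finset, h1]
  · rintro _ ⟨S, ⟨hSM, hS⟩, rfl⟩
    have hfin : (E ⁻¹' S).Finite :=
      (Valid_finite k m).subset fun a ha => (comp_of_mem (hSM ha)).1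
    have hT : S = E '' (hfin.toFinset : Set Item) := by
      ext e
      simp only [Set.Finite.coe_toFinset, Set.mem_image, Set.mem_preimage]
      constructor
      · intro he
        obtain ⟨a, _, rfl⟩ := hSM he
        exact ⟨a, he, rfl⟩
      · rintro ⟨a, ha, rfl⟩; exact ha
    have hF : Forces (0, 0) w hfin.toFinset := by
      constructor
      · intro s hs
        exact (comp_of_mem (hSM (by simpa using hs))).2
      · intro u hu hc
        have hu' : u ∈ Wd k m := ⟨by rw [hu.count_eq, hw.1], by rw [hu.count_eq, hw.2]⟩
        apply matchOf_inj hu' hw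
        apply hS _ (matchOf_PM hk hm hu')
        intro e he
        obtain ⟨a, ⟨hv, _⟩, rfl⟩ := hSM he
        exact ⟨a, ⟨hv, hc a (by simpa using he)⟩, rfl⟩
    have := h_le hF
    rwa [hT, Set.ncard_image_of_injective _ E_inj, Set.ncard_coe_finset]

lemma omega_pos {k m : ℕ} (hk : 1 ≤ k) (hm : 1 ≤ m) (i : ℕ) :
    hexOmega (parallelogram k m) i = N [] k m i := by
  unfold hexOmega N
  have e : {M | hexPM (parallelogram k m) M ∧ hexForcingNum (parallelogram k m) M = i} =
      matchOf k m '' {w | w ∈ Wd k m ∧ h ([] ++ w) = i} := by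
    ext M
    constructor
    · rintro ⟨hM, hf⟩
      obtain ⟨w, hw, rfl⟩ := exists_word hk hm hM
      exact ⟨w, ⟨hw, by rw [← hf, forcing_eq hk hm hw]; rfl⟩, rfl⟩
    · rintro ⟨w, ⟨hw, hh⟩, rfl⟩
      exact ⟨matchOf_PM hk hm hw, by rw [forcing_eq hk hm hw]; exact hh⟩
  rw [e]
  exact Set.InjOn.ncard_image fun a ha b hb hab => matchOf_inj ha.1 hb.1 hab

lemma omega_empty (i : ℕ) : hexOmega ∅ i = if i = 0 then 1 else 0 := by
  have hpm : ∀ M, hexPM ∅ M ↔ M = ∅ := by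
    intro M
    constructor
    · intro hM
      ext e
      simp only [Set.mem_empty_iff_false, iff_false]
      intro he
      have := hM.1 he
      induction e using Sym2.ind with
      | _ a b =>
        rw [SimpleGraph.mem_edgeSet] at this
        obtain ⟨_, ⟨_, c, hc, _⟩ | ⟨_, c, hc, _⟩⟩ := this <;> exact hc
    · rintro rfl
      exact ⟨by simp, by simp, by simp, by simp [hexVertexSet]⟩
  have hf : hexForcingNum ∅ ∅ = 0 := by
    unfold hexForcingNum forcingNumOn
    apply Nat.sInf_eq_zero.mpr
    left
    exact ⟨∅, ⟨subset_rfl, fun M' hM' _ => (hpm M').mp hM'⟩, by simp⟩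
  unfold hexOmega
  split_ifs with hi
  · rw [Set.ncard_eq_one]
    refine ⟨∅, ?_⟩
    ext M
    simp only [Set.mem_ofPred_eq, Set.mem_singleton_iff, hpm]
    constructor
    · exact fun hh => hh.1
    · rintro rfl; exact ⟨rfl, by rw [hf, hi]⟩
  · have : {M | hexPM ∅ M ∧ hexForcingNum ∅ M = i} = ∅ := by
      ext M
      simp only [Set.mem_ofPred_eq, hpm, Set.mem_empty_iff_false, iff_false]
      rintro ⟨rfl, hh⟩
      rw [hf] at hh; exact hi hh.symm
    rw [this]; simp

lemma par_zero_left (n : ℕ) : parallelogram 0 n = ∅ := by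
  ext p; simp [parallelogram]

lemma par_zero_right (n : ℕ) : parallelogram n 0 = ∅ := by
  ext p; simp [parallelogram]

lemma omega_eq (k m i : ℕ) : hexOmega (parallelogram k m) i = N [] k m i := by
  rcases k with _ | k
  · rw [par_zero_left, omega_empty, N_zero_left]
  rcases m with _ | m
  · rw [par_zero_right, omega_empty, N_zero_right]
  exact omega_pos (by omega) (by omega) i

end FP

/-- The forcing polynomial of the benzenoid parallelogram `M(k,m)` satisfies
`F(M(k,m),x) = Σ_{i=0}^{k-1} F(M(i,m-1),x)·x + Σ_{j=0}^{m-1} F(M(k-1,j),x)·x`,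
with `F(M(0,n),x) = F(M(n,0),x) = 1` (stated coefficientwise). -/
theorem forcingPoly_parallelogram_recurrence (k m : ℕ) (hk : 1 ≤ k) (hm : 1 ≤ m) :
    ((∀ i : ℕ, hexOmega (parallelogram k m) (i + 1) =
        (∑ i' ∈ Finset.range k, hexOmega (parallelogram i' (m - 1)) i) +
          ∑ j ∈ Finset.range m, hexOmega (parallelogram (k - 1) j) i) ∧
      hexOmega (parallelogram k m) 0 = 0) ∧
    (∀ n i : ℕ, hexOmega (parallelogram 0 n) i = if i = 0 then 1 else 0) ∧
    (∀ n i : ℕ, hexOmega (parallelogram n 0) i = if i = 0 then 1 else 0) := by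
  obtain ⟨k, rfl⟩ : ∃ k', k = k' + 1 := ⟨k - 1, by omega⟩
  obtain ⟨m, rfl⟩ : ∃ m', m = m' + 1 := ⟨m - 1, by omega⟩
  simp only [FP.omega_eq, Nat.add_sub_cancel]
  exact ⟨⟨fun i => FP.N_rec k m i, FP.N_rec0 k m⟩, FP.N_zero_left, FP.N_zero_right⟩
end

section
/- The forcing spectrum of a truncated parallelogram CHS(k_1,...,k_m; 1,...,1) with 1 ≤ k_1 ≤ k_2 ≤ ... ≤ k_m is an integer interval of the form {1, 2, ..., F}, where F is the maximum forcing number; i.e., for every integer i with 1 ≤ i ≤ F there exists a perfect matching with forcing number exactly i, and every forcing number lies in this interval. -/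
open SimpleGraph

/-- The truncated parallelogram `CHS(k_1,…,k_m;1,…,1)`: row `i` is a linear chain
of `k i` hexagons at positions `1,…,k i`, rows stacked monotonically. -/
def truncPar (m : ℕ) (k : Fin m → ℕ) : Set (ℤ × ℤ) :=
  {p | ∃ i : Fin m, ∃ j : ℕ, 1 ≤ j ∧ j ≤ k i ∧
    p = (2 * ((j : ℤ) - 1) + (i : ℤ), -(i : ℤ))}

set_option linter.unusedSimpArgs false

namespace TP

/-- Extended row lengths. -/
def K (m : ℕ) (k : Fin m → ℕ) (i : ℤ) : ℤ :=
  if h : 0 ≤ i ∧ i < m then (k ⟨i.toNat, by omega⟩ : ℤ) else -1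

def Ev (i t : ℤ) : ℤ × ℤ := (i + 2 * t, -i)
def Od (i t : ℤ) : ℤ × ℤ := (i + 2 * t + 1, -i)
def eV (i t : ℤ) : Sym2 (ℤ × ℤ) := s(Od (i - 1) t, Ev i t)
def eR (i t : ℤ) : Sym2 (ℤ × ℤ) := s(Ev i t, Od i t)
def eL (i t : ℤ) : Sym2 (ℤ × ℤ) := s(Od i t, Ev i (t + 1))

lemma Ev_inj {i t i' t' : ℤ} : Ev i t = Ev i' t' ↔ i = i' ∧ t = t' := by
  simp only [Ev, Prod.mk.injEq]; omega
lemma Od_inj {i t i' t' : ℤ} : Od i t = Od i' t' ↔ i = i' ∧ t = t' := by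
  simp only [Od, Prod.mk.injEq]; omega
lemma Ev_ne {i t i' t' : ℤ} : Ev i t ≠ Od i' t' := by
  simp only [Od, Ev, ne_eq, Prod.mk.injEq]; omega
lemma Od_ne {i t i' t' : ℤ} : Od i t ≠ Ev i' t' := by
  simp only [Od, Ev, ne_eq, Prod.mk.injEq]; omega

variable {m : ℕ} {k : Fin m → ℕ}

lemma K_fin (i : Fin m) : K m k (i : ℤ) = k i := by
  unfold K
  rw [dif_pos ⟨by omega, by omega⟩]
  simp

lemma K_range {i : ℤ} (h : 0 ≤ K m k i) : 0 ≤ i ∧ i < m := by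
  unfold K at h
  split_ifs at h with h1
  · exact h1
  · omega

lemma K_pos (hk1 : ∀ i, 1 ≤ k i) {i : ℤ} (h0 : 0 ≤ i) (h1 : i < m) : 1 ≤ K m k i := by
  unfold K
  rw [dif_pos ⟨h0, h1⟩]
  exact_mod_cast hk1 _

lemma K_out {i : ℤ} (h : ¬ (0 ≤ i ∧ i < m)) : K m k i = -1 := by
  unfold K
  rw [dif_neg h]

lemma K_mono (hmono : Monotone k) {i : ℤ} (h1 : i + 1 < m) (h0 : 0 ≤ i) :
    K m k i ≤ K m k (i + 1) := by
  unfold K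
  rw [dif_pos ⟨h0, by omega⟩, dif_pos ⟨by omega, h1⟩]
  exact_mod_cast hmono (by simp only [Fin.mk_le_mk]; omega)

lemma mem_truncPar {c : ℤ × ℤ} :
    c ∈ truncPar m k ↔ ∃ i t, 0 ≤ t ∧ t < K m k i ∧ c = Ev i t := by
  constructor
  · rintro ⟨i, j, h1, h2, rfl⟩
    refine ⟨i, j - 1, by omega, ?_, ?_⟩
    · rw [K_fin]; omega
    · simp only [Ev, Prod.mk.injEq, and_true]; omega
  · rintro ⟨i, t, h0, h1, rfl⟩
    have h := K_range (m := m) (k := k) (i := i) (by omega)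
    obtain ⟨n, rfl⟩ := Int.eq_ofNat_of_zero_le h.1
    obtain ⟨s, rfl⟩ := Int.eq_ofNat_of_zero_le h0
    have hn : n < m := by omega
    have := K_fin (k := k) ⟨n, hn⟩
    simp only at this
    refine ⟨⟨n, hn⟩, s + 1, by omega, ?_, ?_⟩
    · omega
    simp only [Ev, Prod.mk.injEq, and_true]; push_cast; omega

lemma hexVerts_Ev {i t : ℤ} {v : ℤ × ℤ} : v ∈ hexVerts (Ev i t) ↔
    v = Ev i t ∨ v = Od i t ∨ v = Ev i (t + 1) ∨ v = Od (i - 1) t ∨ v = Ev (i - 1) (t + 1) ∨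
      v = Od (i - 1) (t + 1) := by
  obtain ⟨x, y⟩ := v
  simp only [hexVerts, Ev, Od, Set.mem_insert_iff, Set.mem_singleton_iff, Prod.mk.injEq]
  omega

lemma mem_A {v : ℤ × ℤ} : v ∈ hexVertexSet (truncPar m k) ↔
    ∃ i t, 0 ≤ t ∧ t < K m k i ∧ v ∈ hexVerts (Ev i t) := by
  simp only [hexVertexSet, Set.mem_iUnion, mem_truncPar, exists_prop]
  constructor
  · rintro ⟨c, ⟨i, t, h0, h1, rfl⟩, hv⟩
    exact ⟨i, t, h0, h1, hv⟩
  · rintro ⟨i, t, h0, h1, hv⟩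
    exact ⟨_, ⟨i, t, h0, h1, rfl⟩, hv⟩

lemma Ev_mem (hk1 : ∀ i, 1 ≤ k i) {i t : ℤ} : Ev i t ∈ hexVertexSet (truncPar m k) ↔
    (0 ≤ t ∧ t ≤ K m k i) ∨ (1 ≤ t ∧ t ≤ K m k (i + 1)) := by
  simp only [mem_A, hexVerts_Ev, Ev_inj, Ev_ne, false_or, or_false]
  constructor
  · rintro ⟨i', t', h0, h1, ⟨rfl, rfl⟩ | ⟨rfl, rfl⟩ | ⟨rfl, rfl⟩⟩
    · omega
    · omega
    · right; rw [sub_add_cancel]; omega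
  · rintro (⟨h0, h1⟩ | ⟨h0, h1⟩)
    · have hr := K_range (m := m) (k := k) (i := i) (by omega)
      have := K_pos hk1 hr.1 hr.2
      by_cases h : t < K m k i
      · exact ⟨i, t, h0, h, by simp⟩
      · exact ⟨i, t - 1, by omega, by omega, by simp⟩
    · exact ⟨i + 1, t - 1, by omega, by omega, by simp⟩

lemma Od_mem (hk1 : ∀ i, 1 ≤ k i) {i t : ℤ} : Od i t ∈ hexVertexSet (truncPar m k) ↔
    (0 ≤ t ∧ t < K m k i) ∨ (0 ≤ t ∧ t ≤ K m k (i + 1)) := by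
  simp only [mem_A, hexVerts_Ev, Od_inj, Od_ne, false_or, or_false]
  constructor
  · rintro ⟨i', t', h0, h1, ⟨rfl, rfl⟩ | ⟨rfl, rfl⟩ | ⟨rfl, rfl⟩⟩
    · omega
    · right; rw [sub_add_cancel]; omega
    · right; rw [sub_add_cancel]; omega
  · rintro (⟨h0, h1⟩ | ⟨h0, h1⟩)
    · exact ⟨i, t, h0, h1, by simp⟩
    · have hr := K_range (m := m) (k := k) (i := i + 1) (by omega)
      have := K_pos hk1 hr.1 hr.2
      by_cases h : t < K m k (i + 1)
      · exact ⟨i + 1, t, h0, h, by simp⟩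
      · exact ⟨i + 1, t - 1, by omega, by omega, by simp⟩

lemma A_cases {v : ℤ × ℤ} (h : v ∈ hexVertexSet (truncPar m k)) :
    ∃ i t, v = Ev i t ∨ v = Od i t := by
  obtain ⟨i, t, _, _, h⟩ := mem_A.1 h
  rcases hexVerts_Ev.1 h with h | h | h | h | h | h <;> exact ⟨_, _, by simp [h]; tauto⟩

lemma hex_edges {i t : ℤ} {u v : ℤ × ℤ} (hb : brickAdj u v) (hu : u ∈ hexVerts (Ev i t))
    (hv : v ∈ hexVerts (Ev i t)) : s(u, v) = eV i t ∨ s(u, v) = eV i (t + 1) ∨ s(u, v) = eR i t ∨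
      s(u, v) = eL i t ∨ s(u, v) = eL (i - 1) t ∨ s(u, v) = eR (i - 1) (t + 1) := by
  obtain ⟨x, y⟩ := u
  obtain ⟨z, w⟩ := v
  simp only [hexVerts, Ev, Set.mem_insert_iff, Set.mem_singleton_iff, Prod.mk.injEq] at hu hv
  simp only [brickAdj, Int.even_iff] at hb
  simp only [eV, eR, eL, Ev, Od, Sym2.eq_iff, Prod.mk.injEq]
  rcases hu with ⟨hu1, hu2⟩ | ⟨hu1, hu2⟩ | ⟨hu1, hu2⟩ | ⟨hu1, hu2⟩ | ⟨hu1, hu2⟩ | ⟨hu1, hu2⟩ <;>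
  rcases hv with ⟨hv1, hv2⟩ | ⟨hv1, hv2⟩ | ⟨hv1, hv2⟩ | ⟨hv1, hv2⟩ | ⟨hv1, hv2⟩ | ⟨hv1, hv2⟩ <;>
  first
  | (exfalso; omega)
  | (left; omega)
  | (right; left; omega)
  | (right; right; left; omega)
  | (right; right; right; left; omega)
  | (right; right; right; right; left; omega)
  | (right; right; right; right; right; omega)

lemma hexG_adj {H : Set (ℤ × ℤ)} {u v c : ℤ × ℤ} (hb : brickAdj u v) (hc : c ∈ H)
    (hu : u ∈ hexVerts c) (hv : v ∈ hexVerts c) : s(u, v) ∈ (hexGraph H).edgeSet := by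
  rw [SimpleGraph.mem_edgeSet, hexGraph, SimpleGraph.fromRel_adj]
  refine ⟨?_, Or.inl ⟨hb, c, hc, hu, hv⟩⟩
  rintro rfl
  simp only [brickAdj] at hb
  omega

lemma mem_edge {e : Sym2 (ℤ × ℤ)} : e ∈ (hexGraph (truncPar m k)).edgeSet ↔
    ∃ i t, 0 ≤ t ∧ t < K m k i ∧ (e = eV i t ∨ e = eV i (t + 1) ∨ e = eR i t ∨
      e = eL i t ∨ e = eL (i - 1) t ∨ e = eR (i - 1) (t + 1)) := by
  constructor
  · induction e with | _ u v
    rw [SimpleGraph.mem_edgeSet, hexGraph, SimpleGraph.fromRel_adj]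
    rintro ⟨-, ⟨hb, c, hc, hu, hv⟩ | ⟨hb, c, hc, hu, hv⟩⟩
    · obtain ⟨i, t, h0, h1, rfl⟩ := mem_truncPar.1 hc
      exact ⟨i, t, h0, h1, hex_edges hb hu hv⟩
    · obtain ⟨i, t, h0, h1, rfl⟩ := mem_truncPar.1 hc
      rw [Sym2.eq_swap]
      exact ⟨i, t, h0, h1, hex_edges hb hu hv⟩
  · rintro ⟨i, t, h0, h1, h⟩
    have hc : Ev i t ∈ truncPar m k := mem_truncPar.2 ⟨i, t, h0, h1, rfl⟩
    rcases h with rfl | rfl | rfl | rfl | rfl | rfl <;>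
    · refine hexG_adj ?_ hc (by rw [hexVerts_Ev]; simp) (by rw [hexVerts_Ev]; simp)
      simp only [brickAdj, Int.even_iff, Ev, Od, true_and, or_true, true_or]
      try omega

lemma eV_inj {i t i' t' : ℤ} : eV i t = eV i' t' ↔ i = i' ∧ t = t' := by
  simp only [eV, Sym2.eq_iff, Ev_inj, Od_inj, Ev_ne, Od_ne, and_false, false_and,
    or_false, false_or, not_false_eq_true]; try omega
lemma eR_inj {i t i' t' : ℤ} : eR i t = eR i' t' ↔ i = i' ∧ t = t' := by
  simp only [eR, Sym2.eq_iff, Ev_inj, Od_inj, Ev_ne, Od_ne, and_false, false_and,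
    or_false, false_or, not_false_eq_true]; try omega
lemma eL_inj {i t i' t' : ℤ} : eL i t = eL i' t' ↔ i = i' ∧ t = t' := by
  simp only [eL, Sym2.eq_iff, Ev_inj, Od_inj, Ev_ne, Od_ne, and_false, false_and,
    or_false, false_or, not_false_eq_true]; try omega
lemma eVR {i t i' t' : ℤ} : eV i t ≠ eR i' t' := by
  simp only [ne_eq, eV, eR, Sym2.eq_iff, Ev_inj, Od_inj, Ev_ne, Od_ne, and_false, false_and,
    or_false, false_or, not_false_eq_true]; try omega
lemma eVL {i t i' t' : ℤ} : eV i t ≠ eL i' t' := by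
  simp only [ne_eq, eV, eL, Sym2.eq_iff, Ev_inj, Od_inj, Ev_ne, Od_ne, and_false, false_and,
    or_false, false_or, not_false_eq_true]; try omega
lemma eRL {i t i' t' : ℤ} : eR i t ≠ eL i' t' := by
  simp only [ne_eq, eR, eL, Sym2.eq_iff, Ev_inj, Od_inj, Ev_ne, Od_ne, and_false, false_and,
    or_false, false_or, not_false_eq_true]; try omega

lemma eV_mem (hk1 : ∀ i, 1 ≤ k i) {i t : ℤ} : eV i t ∈ (hexGraph (truncPar m k)).edgeSet ↔
    0 ≤ t ∧ t ≤ K m k i := by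
  simp only [mem_edge, eV_inj, eVR, eVL, or_false]
  constructor
  · rintro ⟨i, t, h0, h1, ⟨rfl, rfl⟩ | ⟨rfl, rfl⟩⟩ <;> omega
  · rintro ⟨h0, h1⟩
    have hr := K_range (m := m) (k := k) (i := i) (by omega)
    have := K_pos hk1 hr.1 hr.2
    by_cases h : t < K m k i
    · exact ⟨i, t, h0, h, by simp⟩
    · exact ⟨i, t - 1, by omega, by omega, by simp⟩

lemma eR_mem {i t : ℤ} : eR i t ∈ (hexGraph (truncPar m k)).edgeSet ↔
    (0 ≤ t ∧ t < K m k i) ∨ (1 ≤ t ∧ t ≤ K m k (i + 1)) := by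
  simp only [mem_edge, eR_inj, eVR.symm, eRL, or_false, false_or]
  constructor
  · rintro ⟨i, t, h0, h1, ⟨rfl, rfl⟩ | ⟨rfl, rfl⟩⟩
    · omega
    · rw [sub_add_cancel]; omega
  · rintro (⟨h0, h1⟩ | ⟨h0, h1⟩)
    · exact ⟨i, t, h0, h1, by simp⟩
    · exact ⟨i + 1, t - 1, by omega, by omega, by simp⟩

lemma eL_mem {i t : ℤ} : eL i t ∈ (hexGraph (truncPar m k)).edgeSet ↔
    (0 ≤ t ∧ t < K m k i) ∨ (0 ≤ t ∧ t < K m k (i + 1)) := by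
  simp only [mem_edge, eL_inj, eVL.symm, eRL.symm, or_false, false_or]
  constructor
  · rintro ⟨i, t, h0, h1, ⟨rfl, rfl⟩ | ⟨rfl, rfl⟩⟩
    · omega
    · rw [sub_add_cancel]; omega
  · rintro (⟨h0, h1⟩ | ⟨h0, h1⟩)
    · exact ⟨i, t, h0, h1, by simp⟩
    · exact ⟨i + 1, t, by omega, by omega, by simp⟩

lemma edge_cases {e : Sym2 (ℤ × ℤ)} (h : e ∈ (hexGraph (truncPar m k)).edgeSet) :
    ∃ i t, e = eV i t ∨ e = eR i t ∨ e = eL i t := by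
  obtain ⟨i, t, _, _, h⟩ := mem_edge.1 h
  rcases h with h | h | h | h | h | h <;> exact ⟨_, _, by rw [h]; tauto⟩

lemma Ev_mem_eV {i t i' t' : ℤ} : Ev i t ∈ eV i' t' ↔ i' = i ∧ t' = t := by
  simp only [eV, Sym2.mem_iff, Ev_inj, Ev_ne, false_or]; omega
lemma Ev_mem_eR {i t i' t' : ℤ} : Ev i t ∈ eR i' t' ↔ i' = i ∧ t' = t := by
  simp only [eR, Sym2.mem_iff, Ev_inj, Ev_ne, or_false]; omega
lemma Ev_mem_eL {i t i' t' : ℤ} : Ev i t ∈ eL i' t' ↔ i' = i ∧ t' = t - 1 := by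
  simp only [eL, Sym2.mem_iff, Ev_inj, Ev_ne, false_or]; omega
lemma Od_mem_eV {i t i' t' : ℤ} : Od i t ∈ eV i' t' ↔ i' = i + 1 ∧ t' = t := by
  simp only [eV, Sym2.mem_iff, Od_inj, Od_ne, or_false]; omega
lemma Od_mem_eR {i t i' t' : ℤ} : Od i t ∈ eR i' t' ↔ i' = i ∧ t' = t := by
  simp only [eR, Sym2.mem_iff, Od_inj, Od_ne, false_or]; omega
lemma Od_mem_eL {i t i' t' : ℤ} : Od i t ∈ eL i' t' ↔ i' = i ∧ t' = t := by
  simp only [eL, Sym2.mem_iff, Od_inj, Od_ne, or_false]; omega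

/-- Combinatorial facts about a perfect matching. -/
structure Good (m : ℕ) (k : Fin m → ℕ) (N : Set (Sym2 (ℤ × ℤ))) : Prop where
  rV : ∀ i t, eV i t ∈ N → 0 ≤ t ∧ t ≤ K m k i
  rR : ∀ i t, eR i t ∈ N → (0 ≤ t ∧ t < K m k i) ∨ (1 ≤ t ∧ t ≤ K m k (i + 1))
  rL : ∀ i t, eL i t ∈ N → (0 ≤ t ∧ t < K m k i) ∨ (0 ≤ t ∧ t < K m k (i + 1))
  cE : ∀ i t, (0 ≤ t ∧ t ≤ K m k i) ∨ (1 ≤ t ∧ t ≤ K m k (i + 1)) →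
    eV i t ∈ N ∨ eR i t ∈ N ∨ eL i (t - 1) ∈ N
  cO : ∀ i t, (0 ≤ t ∧ t < K m k i) ∨ (0 ≤ t ∧ t ≤ K m k (i + 1)) →
    eV (i + 1) t ∈ N ∨ eR i t ∈ N ∨ eL i t ∈ N
  EVR : ∀ i t, eV i t ∈ N → eR i t ∉ N
  EVL : ∀ i t, eV i t ∈ N → eL i (t - 1) ∉ N
  ERL : ∀ i t, eR i t ∈ N → eL i (t - 1) ∉ N
  OVR : ∀ i t, eV (i + 1) t ∈ N → eR i t ∉ N
  OVL : ∀ i t, eV (i + 1) t ∈ N → eL i t ∉ N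
  ORL : ∀ i t, eR i t ∈ N → eL i t ∉ N

lemma good (hk1 : ∀ i, 1 ≤ k i) {N} (hN : hexPM (truncPar m k) N) : Good m k N := by
  obtain ⟨h1, -, h3, h4⟩ := hN
  have key : ∀ e f v, v ∈ e → v ∈ f → e ≠ f → e ∈ N → f ∉ N :=
    fun e f v he hf hne heN hfN => h3 heN hfN hne v he hf
  refine ⟨fun i t h => (eV_mem hk1).1 (h1 h), fun i t h => eR_mem.1 (h1 h),
    fun i t h => eL_mem.1 (h1 h), ?_, ?_, ?_, ?_, ?_, ?_, ?_, ?_⟩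
  · intro i t h
    obtain ⟨e, he, hv⟩ := h4 _ ((Ev_mem hk1).2 h)
    obtain ⟨i', t', rfl | rfl | rfl⟩ := edge_cases (h1 he)
    · obtain ⟨rfl, rfl⟩ := Ev_mem_eV.1 hv; tauto
    · obtain ⟨rfl, rfl⟩ := Ev_mem_eR.1 hv; tauto
    · obtain ⟨rfl, rfl⟩ := Ev_mem_eL.1 hv; tauto
  · intro i t h
    obtain ⟨e, he, hv⟩ := h4 _ ((Od_mem hk1).2 h)
    obtain ⟨i', t', rfl | rfl | rfl⟩ := edge_cases (h1 he)
    · obtain ⟨rfl, rfl⟩ := Od_mem_eV.1 hv; tauto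
    · obtain ⟨rfl, rfl⟩ := Od_mem_eR.1 hv; tauto
    · obtain ⟨rfl, rfl⟩ := Od_mem_eL.1 hv; tauto
  · exact fun i t => key _ _ (Ev i t) (by simp [Ev_mem_eV]) (by simp [Ev_mem_eR]) eVR
  · exact fun i t => key _ _ (Ev i t) (by simp [Ev_mem_eV]) (by simp [Ev_mem_eL]) eVL
  · exact fun i t => key _ _ (Ev i t) (by simp [Ev_mem_eR]) (by simp [Ev_mem_eL]) eRL
  · exact fun i t => key _ _ (Od i t) (by simp [Od_mem_eV]) (by simp [Od_mem_eR]) eVR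
  · exact fun i t => key _ _ (Od i t) (by simp [Od_mem_eV]) (by simp [Od_mem_eL]) eVL
  · exact fun i t => key _ _ (Od i t) (by simp [Od_mem_eR]) (by simp [Od_mem_eL]) eRL

lemma Good.back {N} (g : Good m k N) {i t : ℤ} (h : eV i t ∈ N) (n : ℕ) :
    (0 ≤ t - 1 - n ∨ (t - 1 - n = -1 ∧ 1 ≤ K m k (i - 1))) →
    (∃ r, t - 1 - n < r ∧ r ≤ t ∧ eV (i - 1) r ∈ N) ∨ eL (i - 1) (t - 1 - n) ∈ N := by
  have hr := g.rV _ _ h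
  have hii : i - 1 + 1 = i := by ring
  induction n with
  | zero =>
    intro hn
    push_cast at hn ⊢
    rw [sub_zero] at hn ⊢
    have hR : eR (i - 1) t ∉ N := g.OVR (i - 1) t (by rwa [hii])
    have hc : (0 ≤ t ∧ t ≤ K m k (i - 1)) ∨ (1 ≤ t ∧ t ≤ K m k (i - 1 + 1)) := by
      rw [hii]; omega
    rcases g.cE (i - 1) t hc with h1 | h1 | h1
    · exact Or.inl ⟨t, by omega, le_refl _, h1⟩
    · exact absurd h1 hR
    · exact Or.inr h1
  | succ n ih =>
    intro hn
    push_cast at hn ⊢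
    rcases ih (by omega) with ⟨r, h1, h2, h3⟩ | h1
    · exact Or.inl ⟨r, by omega, h2, h3⟩
    · have hR : eR (i - 1) (t - 1 - n) ∉ N := fun h2 => g.ORL _ _ h2 h1
      have hc : (0 ≤ (t - 1 - n) ∧ (t - 1 - n) ≤ K m k (i - 1)) ∨
          (1 ≤ (t - 1 - n) ∧ (t - 1 - n) ≤ K m k (i - 1 + 1)) := by
        rw [hii]; omega
      rcases g.cE (i - 1) (t - 1 - n) hc with h4 | h4 | h4
      · exact Or.inl ⟨_, by omega, by omega, h4⟩
      · exact absurd h4 hR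
      · right
        rwa [show t - 1 - ((n : ℤ) + 1) = t - 1 - n - 1 by ring]

/-- Below a vertical edge in row `i` there is one weakly to the left in row `i-1`. -/
lemma Good.up (hk1 : ∀ i, 1 ≤ k i) {N} (g : Good m k N) {i t : ℤ} (h : eV i t ∈ N) (hi : 1 ≤ i) :
    ∃ r, r ≤ t ∧ eV (i - 1) r ∈ N := by
  have hr := g.rV _ _ h
  have hK := K_range (m := m) (k := k) (i := i) (by omega)
  have := K_pos hk1 (i := i - 1) (by omega) (by omega)
  rcases g.back h t.toNat (Or.inr ⟨by omega, this⟩) with ⟨r, _, h2, h3⟩ | h1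
  · exact ⟨r, h2, h3⟩
  · have := g.rL _ _ h1
    omega

lemma Good.uniq_aux (hk1 : ∀ i, 1 ≤ k i) {N} (g : Good m k N) (n : ℕ) :
    ∀ s t : ℤ, s < t → eV n s ∈ N → eV n t ∈ N → False := by
  induction n with
  | zero =>
    intro s t hst hs ht
    have hr := g.rV _ _ hs
    rcases g.back ht (t - 1 - s).toNat (Or.inl (by omega)) with ⟨r, _, h2, h3⟩ | h1
    · have := g.rV _ _ h3
      have := K_range (m := m) (k := k) (i := ((0 : ℕ) : ℤ) - 1) (by omega)
      omega
    · rw [show t - 1 - ((t - 1 - s).toNat : ℤ) = s by omega] at h1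
      refine g.OVL _ s ?_ h1
      simpa using hs
  | succ n ih =>
    intro s t hst hs ht
    have hr := g.rV _ _ hs
    rcases g.back ht (t - 1 - s).toNat (Or.inl (by omega)) with ⟨r, h1, h2, h3⟩ | h1
    · obtain ⟨r', h4, h5⟩ := g.up hk1 hs (by omega)
      rw [show ((n + 1 : ℕ) : ℤ) - 1 = n by omega] at h3 h5
      exact ih r' r (by omega) h5 h3
    · rw [show t - 1 - ((t - 1 - s).toNat : ℤ) = s by omega] at h1
      refine g.OVL _ s ?_ h1
      rw [sub_add_cancel]; exact hs

lemma Good.uniq (hk1 : ∀ i, 1 ≤ k i) {N} (g : Good m k N) {i s t : ℤ} (hs : eV i s ∈ N)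
    (ht : eV i t ∈ N) : s = t := by
  have hr := g.rV _ _ hs
  have hK := K_range (m := m) (k := k) (i := i) (by omega)
  obtain ⟨n, rfl⟩ := Int.eq_ofNat_of_zero_le hK.1
  rcases lt_trichotomy s t with h | h | h
  · exact (g.uniq_aux hk1 n s t h hs ht).elim
  · exact h
  · exact (g.uniq_aux hk1 n t s h ht hs).elim

lemma Good.right_aux (hk1 : ∀ i, 1 ≤ k i) {N} (g : Good m k N) {i t : ℤ} (h : eV i t ∈ N)
    (n : ℕ) : (n : ℤ) < t → eR i n ∈ N := by
  have hr := g.rV _ _ h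
  have hV : ∀ s : ℤ, s < t → eV i s ∉ N := fun s hs h1 => by
    have := g.uniq hk1 h1 h
    omega
  induction n with
  | zero =>
    intro hn
    rcases g.cE i ((0 : ℕ) : ℤ) (Or.inl ⟨by omega, by omega⟩) with h1 | h1 | h1
    · exact absurd h1 (hV _ hn)
    · exact h1
    · have := g.rL _ _ h1
      omega
  | succ n ih =>
    intro hn
    have := ih (by omega)
    rcases g.cE i ((n + 1 : ℕ) : ℤ) (Or.inl ⟨by omega, by omega⟩) with h1 | h1 | h1
    · exact absurd h1 (hV _ hn)
    · exact h1
    · rw [show ((n + 1 : ℕ) : ℤ) - 1 = n by omega] at h1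
      exact absurd h1 (g.ORL _ _ this)

lemma Good.right (hk1 : ∀ i, 1 ≤ k i) {N} (g : Good m k N) {i t : ℤ} (h : eV i (t + 1) ∈ N)
    (ht : 0 ≤ t) : eR i t ∈ N := by
  obtain ⟨n, rfl⟩ := Int.eq_ofNat_of_zero_le ht
  exact g.right_aux hk1 h n (by omega)

/-- Matchings with the same vertical edges have the same edges. -/
lemma Good.det {N N'} (g : Good m k N) (g' : Good m k N')
    (hV : ∀ i t, eV i t ∈ N ↔ eV i t ∈ N') (i : ℤ) (n : ℕ) :
    (eR i n ∈ N ↔ eR i n ∈ N') ∧ (eL i n ∈ N ↔ eL i n ∈ N') := by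
  have stepR : ∀ {N N'}, Good m k N → Good m k N' → (∀ i t, eV i t ∈ N ↔ eV i t ∈ N') →
      ∀ t, (eL i (t - 1) ∈ N ↔ eL i (t - 1) ∈ N') → eR i t ∈ N → eR i t ∈ N' := by
    intro N N' g g' hV t hL h
    have h0 := g.rR _ _ h
    rcases g'.cE i t (by omega) with h1 | h1 | h1
    · exact absurd h (g.EVR _ _ ((hV _ _).2 h1))
    · exact h1
    · exact absurd (hL.2 h1) (g.ERL _ _ h)
  have stepL : ∀ {N N'}, Good m k N → Good m k N' → (∀ i t, eV i t ∈ N ↔ eV i t ∈ N') →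
      ∀ t, (eR i t ∈ N ↔ eR i t ∈ N') → eL i t ∈ N → eL i t ∈ N' := by
    intro N N' g g' hV t hR h
    have h0 := g.rL _ _ h
    rcases g'.cO i t (by omega) with h1 | h1 | h1
    · exact absurd h (g.OVL _ _ ((hV _ _).2 h1))
    · exact absurd h (g.ORL _ _ (hR.2 h1))
    · exact h1
  have hV' : ∀ i t, eV i t ∈ N' ↔ eV i t ∈ N := fun i t => (hV i t).symm
  have fin : ∀ t, (eL i (t - 1) ∈ N ↔ eL i (t - 1) ∈ N') →
      (eR i t ∈ N ↔ eR i t ∈ N') ∧ (eL i t ∈ N ↔ eL i t ∈ N') := by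
    intro t hL
    have hR : eR i t ∈ N ↔ eR i t ∈ N' := ⟨stepR g g' hV t hL, stepR g' g hV' t hL.symm⟩
    exact ⟨hR, stepL g g' hV t hR, stepL g' g hV' t hR.symm⟩
  induction n with
  | zero =>
    apply fin
    constructor
    · intro h; have := g.rL _ _ h; omega
    · intro h; have := g'.rL _ _ h; omega
  | succ n ih =>
    apply fin
    rw [show ((n + 1 : ℕ) : ℤ) - 1 = n by omega]
    exact ih.2

lemma sub_of_V (hk1 : ∀ i, 1 ≤ k i) {N N'} (hN : hexPM (truncPar m k) N)
    (hN' : hexPM (truncPar m k) N') (hV : ∀ i t, eV i t ∈ N ↔ eV i t ∈ N') : N ⊆ N' := by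
  have g := good hk1 hN
  have g' := good hk1 hN'
  intro e he
  obtain ⟨i, t, rfl | rfl | rfl⟩ := edge_cases (hN.1 he)
  · exact (hV _ _).1 he
  · have := g.rR _ _ he
    obtain ⟨n, rfl⟩ := Int.eq_ofNat_of_zero_le (show 0 ≤ t by omega)
    exact (g.det g' hV i n).1.1 he
  · have := g.rL _ _ he
    obtain ⟨n, rfl⟩ := Int.eq_ofNat_of_zero_le (show 0 ≤ t by omega)
    exact (g.det g' hV i n).2.1 he

lemma eq_of_V (hk1 : ∀ i, 1 ≤ k i) {N N'} (hN : hexPM (truncPar m k) N)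
    (hN' : hexPM (truncPar m k) N') (hV : ∀ i t, eV i t ∈ N ↔ eV i t ∈ N') : N = N' :=
  (sub_of_V hk1 hN hN' hV).antisymm (sub_of_V hk1 hN' hN fun i t => (hV i t).symm)

/-- The edge `L (m-1) 0` pins down all vertical edges. -/
lemma Good.allV (hk1 : ∀ i, 1 ≤ k i) {N} (g : Good m k N) (hm : 1 ≤ m)
    (h : eL ((m : ℤ) - 1) 0 ∈ N) (i t : ℤ) :
    eV i t ∈ N ↔ (0 ≤ i ∧ i < m ∧ t = 0) := by
  have hp := K_pos hk1 (i := (m : ℤ) - 1) (by omega) (by omega)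
  have h0 : eV ((m : ℤ) - 1) 0 ∈ N := by
    rcases g.cE ((m : ℤ) - 1) 0 (by omega) with h1 | h1 | h1
    · exact h1
    · exact absurd h (g.ORL _ _ h1)
    · have := g.rL _ _ h1
      omega
  have hall : ∀ n : ℕ, n < m → eV ((m : ℤ) - 1 - n) 0 ∈ N := by
    intro n
    induction n with
    | zero => intro _; simpa using h0
    | succ n ih =>
      intro hn
      obtain ⟨r, h1, h2⟩ := g.up hk1 (ih (by omega)) (by omega)
      have := g.rV _ _ h2
      obtain rfl : r = 0 := by omega
      rw [show (m : ℤ) - 1 - ((n + 1 : ℕ) : ℤ) = (m : ℤ) - 1 - n - 1 by push_cast; ring]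
      exact h2
  have hall' : ∀ i : ℤ, 0 ≤ i → i < m → eV i 0 ∈ N := by
    intro i h1 h2
    have := hall ((m : ℤ) - 1 - i).toNat (by omega)
    rwa [show (m : ℤ) - 1 - (((m : ℤ) - 1 - i).toNat : ℤ) = i by omega] at this
  constructor
  · intro h1
    have hr := g.rV _ _ h1
    have hK := K_range (m := m) (k := k) (i := i) (by omega)
    exact ⟨hK.1, hK.2, g.uniq hk1 h1 (hall' i hK.1 hK.2)⟩
  · rintro ⟨h1, h2, rfl⟩
    exact hall' i h1 h2

lemma Good.base (hk1 : ∀ i, 1 ≤ k i) {N} (g : Good m k N) (hm : 1 ≤ m)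
    (h : ∀ i t, 0 < t → eV i t ∉ N) : eL ((m : ℤ) - 1) 0 ∈ N := by
  have hp := K_pos hk1 (i := (m : ℤ) - 1) (by omega) (by omega)
  have hout : K m k ((m : ℤ) - 1 + 1) = -1 := K_out (by omega)
  rcases g.cO ((m : ℤ) - 1) 0 (by omega) with h1 | h1 | h1
  · have := g.rV _ _ h1
    omega
  · exfalso
    have hall : ∀ n : ℕ, (n : ℤ) ≤ K m k ((m : ℤ) - 1) → eR ((m : ℤ) - 1) n ∈ N := by
      intro n
      induction n with
      | zero => intro _; simpa using h1
      | succ n ih =>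
        intro hn
        have h2 := ih (by omega)
        rcases g.cE ((m : ℤ) - 1) ((n + 1 : ℕ) : ℤ) (by omega) with h3 | h3 | h3
        · exact absurd h3 (h _ _ (by omega))
        · exact h3
        · rw [show ((n + 1 : ℕ) : ℤ) - 1 = n by omega] at h3
          exact absurd h3 (g.ORL _ _ h2)
    have := g.rR _ _ (hall (K m k ((m : ℤ) - 1)).toNat (by omega))
    omega
  · exact h1

/-- Either only leftmost vertical edges, or a flippable hexagon. -/
lemma Good.exists_flip (hk1 : ∀ i, 1 ≤ k i) {N} (g : Good m k N)
    (h : ¬ ∀ i t, 0 < t → eV i t ∉ N) :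
    ∃ i t, 0 ≤ t ∧ t < K m k i ∧ eV i (t + 1) ∈ N ∧ eR i t ∈ N ∧ eL (i - 1) t ∈ N := by
  classical
  push Not at h
  have hex : ∃ n : ℕ, ∃ t, 0 < t ∧ eV n t ∈ N := by
    obtain ⟨i, t, h0, h1⟩ := h
    have hr := g.rV _ _ h1
    have hK := K_range (m := m) (k := k) (i := i) (by omega)
    obtain ⟨n, rfl⟩ := Int.eq_ofNat_of_zero_le hK.1
    exact ⟨n, t, h0, h1⟩
  obtain ⟨t, h0, h1⟩ := Nat.find_spec hex
  set n := Nat.find hex with hn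
  have hmin : ∀ n' < n, ∀ t, 0 < t → eV (n' : ℤ) t ∉ N := by
    intro n' hn' t ht h2
    exact Nat.find_min hex hn' ⟨t, ht, h2⟩
  have hr := g.rV _ _ h1
  refine ⟨n, t - 1, by omega, by omega, ?_, ?_, ?_⟩
  · rwa [sub_add_cancel]
  · exact g.right hk1 (by rwa [sub_add_cancel]) (by omega)
  · rcases g.back h1 0 (by left; push_cast; omega) with ⟨r, h2, h3, h4⟩ | h2
    · exfalso
      have hr' := g.rV _ _ h4
      have hK := K_range (m := m) (k := k) (i := (n : ℤ) - 1) (by omega)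
      push_cast at h2
      refine hmin (n - 1) (by omega) r (by omega) ?_
      rwa [show ((n - 1 : ℕ) : ℤ) = (n : ℤ) - 1 by omega]
    · simpa using h2

lemma swap_pm {V : Type*} {G : SimpleGraph V} {A : Set V} {N P Q : Set (Sym2 V)}
    (hN : IsPMOn G A N) (hP : P ⊆ N) (hQ : Q ⊆ G.edgeSet)
    (hpair : Q.Pairwise fun e f => ∀ v, v ∈ e → v ∉ f)
    (hv : ∀ v, (∃ e ∈ P, v ∈ e) ↔ (∃ e ∈ Q, v ∈ e)) : IsPMOn G A ((N \ P) ∪ Q) := by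
  obtain ⟨h1, h2, h3, h4⟩ := hN
  have cross : ∀ e ∈ N \ P, ∀ f ∈ Q, ∀ v, v ∈ e → v ∉ f := by
    intro e he f hf v hve hvf
    obtain ⟨p, hp, hvp⟩ := (hv v).2 ⟨f, hf, hvf⟩
    refine h3 he.1 (hP hp) ?_ v hve hvp
    rintro rfl
    exact he.2 hp
  refine ⟨?_, ?_, ?_, ?_⟩
  · rintro e (he | he)
    · exact h1 he.1
    · exact hQ he
  · rintro e (he | he) v hve
    · exact h2 e he.1 v hve
    · obtain ⟨p, hp, hvp⟩ := (hv v).2 ⟨e, he, hve⟩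
      exact h2 p (hP hp) v hvp
  · rintro e (he | he) f (hf | hf) hne v hve hvf
    · exact h3 he.1 hf.1 hne v hve hvf
    · exact cross e he f hf v hve hvf
    · exact cross f hf e he v hvf hve
    · exact hpair he hf hne v hve hvf
  · intro v hvA
    obtain ⟨e, he, hve⟩ := h4 v hvA
    by_cases hp : e ∈ P
    · obtain ⟨q, hq, hvq⟩ := (hv v).1 ⟨e, hp, hve⟩
      exact ⟨q, Or.inr hq, hvq⟩
    · exact ⟨e, Or.inl ⟨he, hp⟩, hve⟩

lemma pm_sub_eq {V : Type*} {G : SimpleGraph V} {A : Set V} {N N' : Set (Sym2 V)}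
    (hN : IsPMOn G A N) (hN' : IsPMOn G A N') (h : N ⊆ N') : N' = N := by
  refine Set.Subset.antisymm ?_ h
  intro e he
  induction e with | _ u v
  obtain ⟨f, hf, huf⟩ := hN.2.2.2 u (hN'.2.1 _ he u (by simp))
  by_contra hne
  refine hN'.2.2.1 he (h hf) ?_ u (by simp) huf
  rintro rfl
  exact hne hf

lemma self_forcing {V : Type*} {G : SimpleGraph V} {A : Set V} {N : Set (Sym2 V)}
    (hN : IsPMOn G A N) : IsForcingOn G A N N :=
  ⟨subset_rfl, fun _ h1 h2 => pm_sub_eq hN h1 h2⟩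

lemma forcing_attained {V : Type*} {G : SimpleGraph V} {A : Set V} {N : Set (Sym2 V)}
    (hN : IsPMOn G A N) : ∃ S, IsForcingOn G A N S ∧ S.ncard = forcingNumOn G A N :=
  Nat.sInf_mem (s := {n | ∃ S, IsForcingOn G A N S ∧ S.ncard = n}) ⟨_, N, self_forcing hN, rfl⟩

lemma forcing_le {V : Type*} {G : SimpleGraph V} {A : Set V} {N S : Set (Sym2 V)}
    (h : IsForcingOn G A N S) : forcingNumOn G A N ≤ S.ncard :=
  Nat.sInf_le ⟨S, h, rfl⟩

def hP (i t : ℤ) : Set (Sym2 (ℤ × ℤ)) := {eV i (t + 1), eR i t, eL (i - 1) t}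
def hQ (i t : ℤ) : Set (Sym2 (ℤ × ℤ)) := {eV i t, eR (i - 1) (t + 1), eL i t}

lemma hPQ_verts (i t : ℤ) (v : ℤ × ℤ) : (∃ e ∈ hP i t, v ∈ e) ↔ (∃ e ∈ hQ i t, v ∈ e) := by
  simp only [hP, hQ, eV, eR, eL, Set.mem_insert_iff, Set.mem_singleton_iff, exists_eq_or_imp,
    exists_eq_left, Sym2.mem_iff]
  tauto

lemma hP_pair (i t : ℤ) : (hP i t).Pairwise fun e f => ∀ v, v ∈ e → v ∉ f := by
  intro e he f hf hne v hve hvf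
  simp only [hP, Set.mem_insert_iff, Set.mem_singleton_iff] at he hf
  rcases he with rfl | rfl | rfl <;> rcases hf with rfl | rfl | rfl <;>
    first
    | exact hne rfl
    | (simp only [eV, eR, eL, Sym2.mem_iff] at hve hvf
       rcases hve with rfl | rfl <;>
       simp only [Ev, Od, Prod.mk.injEq] at hvf <;> omega)

lemma hQ_pair (i t : ℤ) : (hQ i t).Pairwise fun e f => ∀ v, v ∈ e → v ∉ f := by
  intro e he f hf hne v hve hvf
  simp only [hQ, Set.mem_insert_iff, Set.mem_singleton_iff] at he hf
  rcases he with rfl | rfl | rfl <;> rcases hf with rfl | rfl | rfl <;>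
    first
    | exact hne rfl
    | (simp only [eV, eR, eL, Sym2.mem_iff] at hve hvf
       rcases hve with rfl | rfl <;>
       simp only [Ev, Od, Prod.mk.injEq] at hvf <;> omega)

lemma hPQ_disj {i t : ℤ} {e : Sym2 (ℤ × ℤ)} (h1 : e ∈ hP i t) (h2 : e ∈ hQ i t) : False := by
  simp only [hP, hQ, Set.mem_insert_iff, Set.mem_singleton_iff] at h1 h2
  rcases h1 with rfl | rfl | rfl <;>
    simp [eV_inj, eR_inj, eL_inj, eVR, eVL, eRL, eVR.symm, eVL.symm, eRL.symm] at h2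

lemma hP_edge {i t : ℤ} (h0 : 0 ≤ t) (h1 : t < K m k i) :
    hP i t ⊆ (hexGraph (truncPar m k)).edgeSet := by
  intro e he
  simp only [hP, Set.mem_insert_iff, Set.mem_singleton_iff] at he
  exact mem_edge.2 ⟨i, t, h0, h1, by tauto⟩

lemma hQ_edge {i t : ℤ} (h0 : 0 ≤ t) (h1 : t < K m k i) :
    hQ i t ⊆ (hexGraph (truncPar m k)).edgeSet := by
  intro e he
  simp only [hQ, Set.mem_insert_iff, Set.mem_singleton_iff] at he
  exact mem_edge.2 ⟨i, t, h0, h1, by tauto⟩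

lemma cells_finite : {p : ℤ × ℤ | 0 ≤ p.2 ∧ p.2 < K m k p.1}.Finite := by
  have : {p : ℤ × ℤ | 0 ≤ p.2 ∧ p.2 < K m k p.1} ⊆
      ⋃ i ∈ Set.Icc (0 : ℤ) m, ({i} : Set ℤ) ×ˢ Set.Icc 0 (K m k i) := by
    rintro ⟨i, t⟩ ⟨h0, h1⟩
    simp only at h0 h1
    have hK := K_range (m := m) (k := k) (i := i) (by omega)
    simp only [Set.mem_iUnion]
    exact ⟨i, ⟨hK.1, hK.2.le⟩, rfl, h0, h1.le⟩
  refine Set.Finite.subset ?_ this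
  exact (Set.finite_Icc _ _).biUnion fun i _ => (Set.finite_singleton i).prod (Set.finite_Icc _ _)

lemma edges_finite : (hexGraph (truncPar m k)).edgeSet.Finite := by
  have : (hexGraph (truncPar m k)).edgeSet ⊆
      ⋃ p ∈ {p : ℤ × ℤ | 0 ≤ p.2 ∧ p.2 < K m k p.1}, hP p.1 p.2 ∪ hQ p.1 p.2 := by
    intro e he
    obtain ⟨i, t, h0, h1, h2⟩ := mem_edge.1 he
    simp only [Set.mem_iUnion]
    refine ⟨(i, t), ⟨h0, h1⟩, ?_⟩
    simp only [hP, hQ, Set.mem_union, Set.mem_insert_iff, Set.mem_singleton_iff]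
    tauto
  refine Set.Finite.subset (cells_finite.biUnion fun p _ => ?_) this
  exact Set.Finite.union (by simp [hP]) (by simp [hQ])

/-- Flipping a hexagon. -/
def flip (i t : ℤ) (N : Set (Sym2 (ℤ × ℤ))) : Set (Sym2 (ℤ × ℤ)) := (N \ hP i t) ∪ hQ i t

lemma flip_pm {i t : ℤ} (h0 : 0 ≤ t) (h1 : t < K m k i) {N} (hN : hexPM (truncPar m k) N)
    (h : hP i t ⊆ N) : hexPM (truncPar m k) (flip i t N) :=
  swap_pm hN h (hQ_edge h0 h1) (hQ_pair i t) (hPQ_verts i t)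

lemma Q_not_mem {i t : ℤ} {N} (hN : hexPM (truncPar m k) N)
    (h : hP i t ⊆ N) {e} (he : e ∈ hQ i t) : e ∉ N := by
  intro heN
  induction e with | _ u v
  obtain ⟨p, hp, hup⟩ := (hPQ_verts i t u).2 ⟨_, he, by simp⟩
  refine hN.2.2.1 heN (h hp) ?_ u (by simp) hup
  rintro rfl
  exact hPQ_disj hp he

lemma flip_inj {i t : ℤ} {N N'} (hN : hexPM (truncPar m k) N) (hN' : hexPM (truncPar m k) N')
    (h : hP i t ⊆ N) (h' : hP i t ⊆ N') (heq : flip i t N' = flip i t N) : N' = N := by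
  have aux : ∀ {N N'}, hexPM (truncPar m k) N → hP i t ⊆ N' → flip i t N = flip i t N' →
      hP i t ⊆ N → N ⊆ N' := by
    intro N N' hN h' heq h e he
    by_cases hp : e ∈ hP i t
    · exact h' hp
    · have : e ∈ flip i t N := Or.inl ⟨he, hp⟩
      rw [heq] at this
      rcases this with h1 | h1
      · exact h1.1
      · exact absurd he (Q_not_mem hN h h1)
  exact (aux hN' h heq h').antisymm (aux hN h' heq.symm h)

lemma flip_forcing (hk1 : ∀ i, 1 ≤ k i) {i t : ℤ} (h0 : 0 ≤ t) (h1 : t < K m k i) {N}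
    (hN : hexPM (truncPar m k) N) (h : hP i t ⊆ N) :
    hexForcingNum (truncPar m k) N ≤ hexForcingNum (truncPar m k) (flip i t N) + 1 := by
  have hN1 := flip_pm h0 h1 hN h
  obtain ⟨S, hS, hcard⟩ := forcing_attained hN1
  have hSfin : S.Finite := edges_finite.subset (hS.1.trans hN1.1)
  have hmeet : ∃ q ∈ S, q ∈ hQ i t := by
    by_contra hno
    push Not at hno
    have hSN : S ⊆ N := by
      intro e he
      rcases hS.1 he with h2 | h2
      · exact h2.1
      · exact absurd h2 (hno e he)
    have := hS.2 N hN hSN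
    have hV : eV i (t + 1) ∈ hP i t := by simp [hP]
    have h3 := h hV
    rw [this] at h3
    rcases h3 with h3 | h3
    · exact h3.2 hV
    · exact hPQ_disj hV h3
  obtain ⟨q, hqS, hqQ⟩ := hmeet
  set S' : Set (Sym2 (ℤ × ℤ)) := (S \ hQ i t) ∪ {eV i (t + 1), eL (i - 1) t} with hS'
  have hforce : IsForcingOn (hexGraph (truncPar m k)) (hexVertexSet (truncPar m k)) N S' := by
    refine ⟨?_, ?_⟩
    · rintro e (he | he)
      · rcases hS.1 he.1 with h2 | h2
        · exact h2.1
        · exact absurd h2 he.2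
      · apply h
        simp only [hP, Set.mem_insert_iff, Set.mem_singleton_iff] at he ⊢
        tauto
    · intro N' hN' hsub
      have hV : eV i (t + 1) ∈ N' := hsub (Or.inr (by simp))
      have hL : eL (i - 1) t ∈ N' := hsub (Or.inr (by simp))
      have hR : eR i t ∈ N' := (good hk1 hN').right hk1 hV h0
      have hPN : hP i t ⊆ N' := by
        intro e he
        simp only [hP, Set.mem_insert_iff, Set.mem_singleton_iff] at he
        rcases he with rfl | rfl | rfl <;> assumption
      refine flip_inj hN hN' h hPN (hS.2 _ (flip_pm h0 h1 hN' hPN) ?_)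
      intro e he
      by_cases hq : e ∈ hQ i t
      · exact Or.inr hq
      · refine Or.inl ⟨hsub (Or.inl ⟨he, hq⟩), ?_⟩
        intro hp
        rcases hS.1 he with h2 | h2
        · exact h2.2 hp
        · exact hq h2
  have hle : forcingNumOn _ _ N ≤ S'.ncard := forcing_le hforce
  have hc1 : S'.ncard ≤ (S \ hQ i t).ncard + 2 :=
    (Set.ncard_union_le _ _).trans (by gcongr; exact (Set.ncard_insert_le _ _).trans (by rw [Set.ncard_singleton]))
  have hc2 : (S \ hQ i t).ncard < S.ncard :=
    Set.ncard_lt_ncard ⟨Set.sdiff_subset, fun hsub => (hsub hqS).2 hqQ⟩ hSfin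
  unfold hexForcingNum
  omega

lemma edge_verts {e : Sym2 (ℤ × ℤ)} (he : e ∈ (hexGraph (truncPar m k)).edgeSet) {v : ℤ × ℤ}
    (hv : v ∈ e) : v ∈ hexVertexSet (truncPar m k) := by
  obtain ⟨i, t, h0, h1, h⟩ := mem_edge.1 he
  refine mem_A.2 ⟨i, t, h0, h1, ?_⟩
  rw [hexVerts_Ev]
  rcases h with rfl | rfl | rfl | rfl | rfl | rfl <;>
    simp only [eV, eR, eL, Sym2.mem_iff] at hv <;> tauto

/-- The bottom matching. -/
def M0 (m : ℕ) (k : Fin m → ℕ) : Set (Sym2 (ℤ × ℤ)) :=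
  {e | (∃ i : ℤ, 0 ≤ i ∧ i < m ∧ e = eV i 0) ∨
    (∃ i t : ℤ, 1 ≤ t ∧ t ≤ K m k (i + 1) ∧ e = eR i t) ∨
    (∃ t : ℤ, 0 ≤ t ∧ t < K m k ((m : ℤ) - 1) ∧ e = eL ((m : ℤ) - 1) t)}

lemma M0_Ev {e} (he : e ∈ M0 m k) {i t : ℤ} (h : Ev i t ∈ e) :
    e = if t = 0 then eV i 0 else if i = (m : ℤ) - 1 then eL i (t - 1) else eR i t := by
  rcases he with ⟨i', h1, h2, rfl⟩ | ⟨i', t', h1, h2, rfl⟩ | ⟨t', h1, h2, rfl⟩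
  · obtain ⟨rfl, rfl⟩ := Ev_mem_eV.1 h
    simp
  · obtain ⟨rfl, rfl⟩ := Ev_mem_eR.1 h
    have hK := K_range (m := m) (k := k) (i := i' + 1) (by omega)
    rw [if_neg (by omega), if_neg (by omega)]
  · obtain ⟨rfl, rfl⟩ := Ev_mem_eL.1 h
    rw [if_neg (by omega), if_pos rfl]

lemma M0_Od {e} (he : e ∈ M0 m k) {i t : ℤ} (h : Od i t ∈ e) :
    e = if i = (m : ℤ) - 1 then eL i t else if t = 0 then eV (i + 1) 0 else eR i t := by
  rcases he with ⟨i', h1, h2, rfl⟩ | ⟨i', t', h1, h2, rfl⟩ | ⟨t', h1, h2, rfl⟩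
  · obtain ⟨rfl, rfl⟩ := Od_mem_eV.1 h
    rw [if_neg (by omega), if_pos rfl]
  · obtain ⟨rfl, rfl⟩ := Od_mem_eR.1 h
    have hK := K_range (m := m) (k := k) (i := i' + 1) (by omega)
    rw [if_neg (by omega), if_neg (by omega)]
  · obtain ⟨rfl, rfl⟩ := Od_mem_eL.1 h
    rw [if_pos rfl]

lemma M0_pm (hk1 : ∀ i, 1 ≤ k i) (hmono : Monotone k) :
    hexPM (truncPar m k) (M0 m k) := by
  have hE : M0 m k ⊆ (hexGraph (truncPar m k)).edgeSet := by
    rintro e (⟨i', h1, h2, rfl⟩ | ⟨i', t', h1, h2, rfl⟩ | ⟨t', h1, h2, rfl⟩)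
    · have := K_pos hk1 h1 h2
      exact (eV_mem hk1).2 ⟨by omega, by omega⟩
    · exact eR_mem.2 (Or.inr ⟨h1, h2⟩)
    · exact eL_mem.2 (Or.inl ⟨h1, h2⟩)
  have hout : K m k ((m : ℤ) - 1 + 1) = -1 := K_out (by omega)
  refine ⟨hE, fun e he v hv => edge_verts (hE he) hv, ?_, ?_⟩
  · intro e he f hf hne v hve hvf
    obtain ⟨i, t, rfl | rfl⟩ := A_cases (edge_verts (hE he) hve)
    · exact hne ((M0_Ev he hve).trans (M0_Ev hf hvf).symm)
    · exact hne ((M0_Od he hve).trans (M0_Od hf hvf).symm)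
  · intro v hv
    obtain ⟨i, t, rfl | rfl⟩ := A_cases hv
    · rw [Ev_mem hk1] at hv
      by_cases ht : t = 0
      · subst ht
        have hK := K_range (m := m) (k := k) (i := i) (by omega)
        exact ⟨eV i 0, Or.inl ⟨i, hK.1, hK.2, rfl⟩, by simp [Ev_mem_eV]⟩
      · by_cases hi : i = (m : ℤ) - 1
        · subst hi
          exact ⟨eL ((m : ℤ) - 1) (t - 1), Or.inr (Or.inr ⟨t - 1, by omega, by omega, rfl⟩),
            by simp [Ev_mem_eL]⟩
        · refine ⟨eR i t, Or.inr (Or.inl ⟨i, t, by omega, ?_, rfl⟩), by simp [Ev_mem_eR]⟩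
          rcases hv with hv | hv
          · have hK := K_range (m := m) (k := k) (i := i) (by omega)
            have := K_mono hmono (i := i) (by omega) (by omega)
            omega
          · exact hv.2
    · rw [Od_mem hk1] at hv
      by_cases hi : i = (m : ℤ) - 1
      · subst hi
        exact ⟨eL ((m : ℤ) - 1) t, Or.inr (Or.inr ⟨t, by omega, by omega, rfl⟩),
          by simp [Od_mem_eL]⟩
      · by_cases ht : t = 0
        · subst ht
          refine ⟨eV (i + 1) 0, Or.inl ⟨i + 1, ?_, ?_, rfl⟩, by simp [Od_mem_eV]⟩
          · rcases hv with hv | hv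
            · have hK := K_range (m := m) (k := k) (i := i) (by omega)
              omega
            · exact (K_range (m := m) (k := k) (i := i + 1) (by omega)).1
          · rcases hv with hv | hv
            · have hK := K_range (m := m) (k := k) (i := i) (by omega)
              omega
            · exact (K_range (m := m) (k := k) (i := i + 1) (by omega)).2
        · refine ⟨eR i t, Or.inr (Or.inl ⟨i, t, by omega, ?_, rfl⟩), by simp [Od_mem_eR]⟩
          rcases hv with hv | hv
          · have hK := K_range (m := m) (k := k) (i := i) (by omega)
            have := K_mono hmono (i := i) (by omega) (by omega)
            omega
          · exact hv.2

lemma two_pm (hm : 1 ≤ m) (hk1 : ∀ i, 1 ≤ k i) (hmono : Monotone k) :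
    ∃ N, hexPM (truncPar m k) N ∧ N ≠ M0 m k := by
  have hp := K_pos hk1 (i := (m : ℤ) - 1) (by omega) (by omega)
  refine ⟨(M0 m k \ hQ ((m : ℤ) - 1) 0) ∪ hP ((m : ℤ) - 1) 0,
    swap_pm (M0_pm hk1 hmono) ?_ (hP_edge le_rfl (by omega)) (hP_pair _ _)
      (fun v => (hPQ_verts _ _ v).symm), ?_⟩
  · intro e he
    simp only [hQ, Set.mem_insert_iff, Set.mem_singleton_iff] at he
    rcases he with rfl | rfl | rfl
    · exact Or.inl ⟨_, by omega, by omega, rfl⟩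
    · refine Or.inr (Or.inl ⟨_, _, by omega, ?_, rfl⟩)
      rw [sub_add_cancel]; omega
    · exact Or.inr (Or.inr ⟨0, by omega, by omega, rfl⟩)
  · intro heq
    have h1 : eV ((m : ℤ) - 1) (0 + 1) ∈ M0 m k := by
      rw [← heq]; right; simp [hP]
    rcases h1 with ⟨i', h1, h2, h3⟩ | ⟨i', t', h1, h2, h3⟩ | ⟨t', h1, h2, h3⟩
    · rw [eV_inj] at h3; omega
    · exact eVR h3
    · exact eVL h3

lemma forcing_pos (hm : 1 ≤ m) (hk1 : ∀ i, 1 ≤ k i) (hmono : Monotone k) {N}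
    (hN : hexPM (truncPar m k) N) : 1 ≤ hexForcingNum (truncPar m k) N := by
  by_contra hlt
  obtain ⟨S, hS, hcard⟩ := forcing_attained hN
  have hSfin : S.Finite := edges_finite.subset (hS.1.trans hN.1)
  have h0 : S.ncard = 0 := by unfold hexForcingNum at hlt; omega
  rw [Set.ncard_eq_zero hSfin] at h0
  subst h0
  obtain ⟨N', hN', hne⟩ := two_pm hm hk1 hmono
  have h1 := hS.2 N' hN' (Set.empty_subset _)
  have h2 := hS.2 _ (M0_pm hk1 hmono) (Set.empty_subset _)
  exact hne (h1.trans h2.symm)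

lemma forcing_base (hm : 1 ≤ m) (hk1 : ∀ i, 1 ≤ k i) {N}
    (hN : hexPM (truncPar m k) N) (h : ∀ i t, 0 < t → eV i t ∉ N) :
    hexForcingNum (truncPar m k) N ≤ 1 := by
  have g := good hk1 hN
  have hL := g.base hk1 hm h
  have : IsForcingOn (hexGraph (truncPar m k)) (hexVertexSet (truncPar m k)) N
      {eL ((m : ℤ) - 1) 0} := by
    refine ⟨by simpa using hL, fun N' hN' hsub => ?_⟩
    have hL' : eL ((m : ℤ) - 1) 0 ∈ N' := hsub rfl
    refine eq_of_V hk1 hN' hN fun i t => ?_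
    rw [(good hk1 hN').allV hk1 hm hL', g.allV hk1 hm hL]
  have h2 := forcing_le this
  rwa [Set.ncard_singleton] at h2

/-- The area to the left of the vertical edges. -/
def D (N : Set (Sym2 (ℤ × ℤ))) : Set (ℤ × ℤ) := {p | 0 ≤ p.2 ∧ ∃ t, p.2 < t ∧ eV p.1 t ∈ N}

lemma D_lt (hk1 : ∀ i, 1 ≤ k i) {N} (hN : hexPM (truncPar m k) N) {i t : ℤ} (h0 : 0 ≤ t)
    (h : hP i t ⊆ N) : (D (flip i t N)).ncard < (D N).ncard := by
  have g := good hk1 hN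
  have hV : eV i (t + 1) ∈ hP i t := by simp [hP]
  refine Set.ncard_lt_ncard ⟨?_, ?_⟩ ?_
  · rintro ⟨i', s⟩ ⟨h1, t', h2, h3 | h3⟩
    · exact ⟨h1, t', h2, h3.1⟩
    · simp only [hQ, Set.mem_insert_iff, Set.mem_singleton_iff, eV_inj, eVR, eVL, or_false] at h3
      obtain ⟨rfl, rfl⟩ := h3
      exact ⟨h1, t' + 1, by omega, h hV⟩
  · intro hsub
    have hmem : ((i, t) : ℤ × ℤ) ∈ D N := ⟨h0, t + 1, by simp, h hV⟩
    obtain ⟨-, t', h2, h3 | h3⟩ := hsub hmem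
    · have : t' = t + 1 := g.uniq hk1 h3.1 (h hV)
      subst this
      exact h3.2 hV
    · simp only [hQ, Set.mem_insert_iff, Set.mem_singleton_iff, eV_inj, eVR, eVL, or_false] at h3
      simp only at h2
      omega
  · refine (cells_finite (m := m) (k := k)).subset ?_
    rintro ⟨i', s⟩ ⟨h1, t', h2, h3⟩
    have := g.rV _ _ h3
    exact ⟨h1, lt_of_lt_of_le h2 this.2⟩

lemma descend (hm : 1 ≤ m) (hk1 : ∀ i, 1 ≤ k i) (j : ℕ) (hj : 1 ≤ j) (n : ℕ) :
    ∀ N, hexPM (truncPar m k) N → (D N).ncard = n → j ≤ hexForcingNum (truncPar m k) N →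
      ∃ M, hexPM (truncPar m k) M ∧ hexForcingNum (truncPar m k) M = j := by
  induction n using Nat.strong_induction_on with
  | _ n ih =>
    intro N hN hn hle
    by_cases hb : ∀ i t, 0 < t → eV i t ∉ N
    · exact ⟨N, hN, le_antisymm ((forcing_base hm hk1 hN hb).trans hj) hle⟩
    · rcases hle.eq_or_lt with heq | hlt
      · exact ⟨N, hN, heq.symm⟩
      · obtain ⟨i, t, h0, h1, hV, hR, hL⟩ := (good hk1 hN).exists_flip hk1 hb
        have hPN : hP i t ⊆ N := by
          intro e he
          simp only [hP, Set.mem_insert_iff, Set.mem_singleton_iff] at he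
          rcases he with rfl | rfl | rfl <;> assumption
        have hf := flip_forcing hk1 h0 h1 hN hPN
        exact ih _ (hn ▸ D_lt hk1 hN h0 hPN) (flip i t N) (flip_pm h0 h1 hN hPN) rfl (by omega)

end TP

/-- The forcing spectrum of a truncated parallelogram is an integer interval
`{1, 2, …, F}` where `F` is the maximum forcing number. -/
theorem forcingSpectrum_truncPar_interval (m : ℕ) (hm : 1 ≤ m) (k : Fin m → ℕ)
    (hk1 : ∀ i, 1 ≤ k i) (hmono : Monotone k) :
    ∃ F : ℕ, 1 ≤ F ∧
      {i | ∃ M, hexPM (truncPar m k) M ∧ hexForcingNum (truncPar m k) M = i} =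
        Set.Icc 1 F := by
  set X := {i | ∃ M, hexPM (truncPar m k) M ∧ hexForcingNum (truncPar m k) M = i} with hX
  have hne : X.Nonempty := ⟨_, TP.M0 m k, TP.M0_pm hk1 hmono, rfl⟩
  have hbdd : BddAbove X := by
    refine ⟨(hexGraph (truncPar m k)).edgeSet.ncard, ?_⟩
    rintro i ⟨M, hM, rfl⟩
    exact (TP.forcing_le (TP.self_forcing hM)).trans (Set.ncard_le_ncard hM.1 TP.edges_finite)
  have hmem : sSup X ∈ X := Nat.sSup_mem hne hbdd
  have hpos : ∀ i ∈ X, 1 ≤ i := by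
    rintro i ⟨M, hM, rfl⟩
    exact TP.forcing_pos hm hk1 hmono hM
  refine ⟨sSup X, hpos _ hmem, ?_⟩
  ext j
  constructor
  · intro hj
    exact ⟨hpos j hj, le_csSup hbdd hj⟩
  · rintro ⟨h1, h2⟩
    obtain ⟨M, hM, hMF⟩ := hmem
    exact TP.descend hm hk1 j h1 _ M hM rfl (by omega)
end

section
/- There is a bijection between the perfect matchings of the monotonic constructable hexagonal system CHS(k_1,...,k_m; h_1,...,h_m) and the non-decreasing integer sequences (a_1,...,a_m) with a_i ∈ {h_i−1, h_i, ..., k_i} for each i. In particular, the number of perfect matchings of CHS equals the number of such sequences. -/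
open SimpleGraph

/-- The monotonic constructable hexagonal system `CHS(k_1,…,k_m;h_1,…,h_m)`:
row `i` consists of the hexagons at positions `h i, …, k i`. -/
def chsHexes (m : ℕ) (k h : Fin m → ℕ) : Set (ℤ × ℤ) :=
  {p | ∃ i : Fin m, ∃ j : ℕ, h i ≤ j ∧ j ≤ k i ∧
    p = (2 * ((j : ℤ) - 1) + (i : ℤ), -(i : ℤ))}

/-- Vertices without a downward edge at level `L`. -/
def uV (L b : ℤ) : ℤ × ℤ := (2 * b + L - 1, 1 - L)

/-- Vertices with a downward edge at level `L`. -/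
def dV (L b : ℤ) : ℤ × ℤ := (2 * b + L, 1 - L)

theorem uV_inj {L b L' b' : ℤ} : uV L b = uV L' b' ↔ L = L' ∧ b = b' := by
  simp only [uV, Prod.mk.injEq]; omega

theorem dV_inj {L b L' b' : ℤ} : dV L b = dV L' b' ↔ L = L' ∧ b = b' := by
  simp only [dV, Prod.mk.injEq]; omega

theorem uV_ne_dV {L b L' b' : ℤ} : uV L b ≠ dV L' b' := by
  simp only [dV, uV, Ne, Prod.mk.injEq]; omega

theorem dV_ne_uV {L b L' b' : ℤ} : dV L b ≠ uV L' b' := uV_ne_dV.symm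

theorem vert_cases (v : ℤ × ℤ) : ∃ L b, v = uV L b ∨ v = dV L b := by
  obtain ⟨x, y⟩ := v
  rcases Int.even_or_odd' (x - (1 - y)) with ⟨b, hb | hb⟩
  · exact ⟨1 - y, b, Or.inr (by simp only [dV, Prod.mk.injEq]; omega)⟩
  · exact ⟨1 - y, b + 1, Or.inl (by simp only [uV, Prod.mk.injEq]; omega)⟩

theorem edge_inj {L b L' b' x y x' y' : ℤ} :
    s(dV L b, uV x y) = s(dV L' b', uV x' y') ↔ (L = L' ∧ b = b') ∧ x = x' ∧ y = y' := by
  rw [Sym2.eq_iff, dV_inj, uV_inj]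
  constructor
  · rintro (h | h)
    · exact h
    · exact absurd h.1 dV_ne_uV
  · exact Or.inl

/-- Hexagons given by integer-indexed bounds. -/
def hxs (C K : ℤ → ℤ) : Set (ℤ × ℤ) :=
  {p | ∃ i b : ℤ, C i ≤ b ∧ b < K i ∧ p = (2 * b + i, -i)}

/-- Edge set with given indicator predicates. -/
def edgesOf (P Q V : ℤ → ℤ → Prop) : Set (Sym2 (ℤ × ℤ)) :=
  {e | ∃ L b, (e = s(dV L b, uV L b) ∧ P L b) ∨ (e = s(dV L b, uV L (b + 1)) ∧ Q L b) ∨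
    (e = s(dV L b, uV (L + 1) b) ∧ V L b)}

theorem mem_edgesOf_P {P Q V : ℤ → ℤ → Prop} {L b : ℤ} :
    s(dV L b, uV L b) ∈ edgesOf P Q V ↔ P L b := by
  constructor
  · rintro ⟨L', b', ⟨h, h'⟩ | ⟨h, h'⟩ | ⟨h, h'⟩⟩ <;> rw [edge_inj] at h
    · obtain ⟨⟨rfl, rfl⟩, -⟩ := h; exact h'
    · omega
    · omega
  · exact fun h => ⟨L, b, Or.inl ⟨rfl, h⟩⟩

theorem mem_edgesOf_Q {P Q V : ℤ → ℤ → Prop} {L b : ℤ} :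
    s(dV L b, uV L (b + 1)) ∈ edgesOf P Q V ↔ Q L b := by
  constructor
  · rintro ⟨L', b', ⟨h, h'⟩ | ⟨h, h'⟩ | ⟨h, h'⟩⟩ <;> rw [edge_inj] at h
    · omega
    · obtain ⟨⟨rfl, rfl⟩, -⟩ := h; exact h'
    · omega
  · exact fun h => ⟨L, b, Or.inr (Or.inl ⟨rfl, h⟩)⟩

theorem mem_edgesOf_V {P Q V : ℤ → ℤ → Prop} {L b : ℤ} :
    s(dV L b, uV (L + 1) b) ∈ edgesOf P Q V ↔ V L b := by
  constructor
  · rintro ⟨L', b', ⟨h, h'⟩ | ⟨h, h'⟩ | ⟨h, h'⟩⟩ <;> rw [edge_inj] at h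
    · omega
    · omega
    · obtain ⟨⟨rfl, rfl⟩, -⟩ := h; exact h'
  · exact fun h => ⟨L, b, Or.inr (Or.inr ⟨rfl, h⟩)⟩

theorem mem_edgesOf_d {P Q V : ℤ → ℤ → Prop} {L b : ℤ} {e : Sym2 (ℤ × ℤ)}
    (he : e ∈ edgesOf P Q V) (hd : dV L b ∈ e) :
    (e = s(dV L b, uV L b) ∧ P L b) ∨ (e = s(dV L b, uV L (b + 1)) ∧ Q L b) ∨
    (e = s(dV L b, uV (L + 1) b) ∧ V L b) := by
  obtain ⟨L', b', ⟨rfl, h'⟩ | ⟨rfl, h'⟩ | ⟨rfl, h'⟩⟩ := he <;>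
  · simp only [Sym2.mem_iff, dV_inj, dV_ne_uV, or_false] at hd
    obtain ⟨rfl, rfl⟩ := hd
    simp [h']

theorem mem_edgesOf_u {P Q V : ℤ → ℤ → Prop} {L b : ℤ} {e : Sym2 (ℤ × ℤ)}
    (he : e ∈ edgesOf P Q V) (hd : uV L b ∈ e) :
    (e = s(dV L b, uV L b) ∧ P L b) ∨ (e = s(dV L (b - 1), uV L b) ∧ Q L (b - 1)) ∨
    (e = s(dV (L - 1) b, uV L b) ∧ V (L - 1) b) := by
  obtain ⟨L', b', ⟨rfl, h'⟩ | ⟨rfl, h'⟩ | ⟨rfl, h'⟩⟩ := he <;>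
  · simp only [Sym2.mem_iff, uV_inj, uV_ne_dV, false_or] at hd
    obtain ⟨rfl, rfl⟩ := hd
    simp [h']

/-- Existence of the three kinds of edges and two kinds of vertices. -/
def Pex (C K : ℤ → ℤ) (L b : ℤ) : Prop :=
  (C (L - 1) ≤ b ∧ b < K (L - 1)) ∨ (C L < b ∧ b ≤ K L)
def Qex (C K : ℤ → ℤ) (L b : ℤ) : Prop :=
  (C (L - 1) ≤ b ∧ b < K (L - 1)) ∨ (C L ≤ b ∧ b < K L)
def Vex (C K : ℤ → ℤ) (L b : ℤ) : Prop := C L ≤ b ∧ b ≤ K L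
def Uex (C K : ℤ → ℤ) (L b : ℤ) : Prop :=
  (C (L - 1) ≤ b ∧ b ≤ K (L - 1)) ∨ (C L < b ∧ b ≤ K L)
def Dex (C K : ℤ → ℤ) (L b : ℤ) : Prop :=
  (C (L - 1) ≤ b ∧ b < K (L - 1)) ∨ (C L ≤ b ∧ b ≤ K L)

theorem mem_hexVerts (i b : ℤ) (v : ℤ × ℤ) : v ∈ hexVerts (2 * b + i, -i) ↔
    v = uV (i + 1) b ∨ v = dV (i + 1) b ∨ v = uV (i + 1) (b + 1) ∨
    v = dV i b ∨ v = uV i (b + 1) ∨ v = dV i (b + 1) := by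
  obtain ⟨x, y⟩ := v
  simp only [hexVerts, Set.mem_insert_iff, Set.mem_singleton_iff, uV, dV, Prod.mk.injEq]
  omega

theorem mem_vset {C K : ℤ → ℤ} {v : ℤ × ℤ} : v ∈ hexVertexSet (hxs C K) ↔
    ∃ i b, C i ≤ b ∧ b < K i ∧ (v = uV (i + 1) b ∨ v = dV (i + 1) b ∨ v = uV (i + 1) (b + 1) ∨
    v = dV i b ∨ v = uV i (b + 1) ∨ v = dV i (b + 1)) := by
  simp only [hexVertexSet, Set.mem_iUnion, hxs, Set.mem_ofPred_eq, exists_prop]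
  constructor
  · rintro ⟨c, ⟨i, b, h1, h2, rfl⟩, h⟩
    exact ⟨i, b, h1, h2, (mem_hexVerts _ _ _).1 h⟩
  · rintro ⟨i, b, h1, h2, h⟩
    exact ⟨_, ⟨i, b, h1, h2, rfl⟩, (mem_hexVerts _ _ _).2 h⟩

theorem u_mem {C K : ℤ → ℤ} (hCK : ∀ i, C i < K i ∨ C i = K i + 1) {L b : ℤ} :
    uV L b ∈ hexVertexSet (hxs C K) ↔ Uex C K L b := by
  rw [mem_vset]
  simp only [uV_inj, uV_ne_dV, false_or, or_false, Uex]
  constructor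
  · rintro ⟨i, b', h1, h2, ⟨rfl, rfl⟩ | ⟨rfl, rfl⟩ | ⟨rfl, rfl⟩⟩
    · left; rw [add_sub_cancel_right]; omega
    · left; rw [add_sub_cancel_right]; omega
    · right; omega
  · have := hCK (L - 1)
    rintro (h | h)
    · by_cases hb : b < K (L - 1)
      · exact ⟨L - 1, b, h.1, hb, by omega⟩
      · exact ⟨L - 1, b - 1, by omega, by omega, by omega⟩
    · exact ⟨L, b - 1, by omega, by omega, by omega⟩

theorem d_mem {C K : ℤ → ℤ} (hCK : ∀ i, C i < K i ∨ C i = K i + 1) {L b : ℤ} :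
    dV L b ∈ hexVertexSet (hxs C K) ↔ Dex C K L b := by
  rw [mem_vset]
  simp only [dV_inj, dV_ne_uV, false_or, Dex]
  constructor
  · rintro ⟨i, b', h1, h2, ⟨rfl, rfl⟩ | ⟨rfl, rfl⟩ | ⟨rfl, rfl⟩⟩
    · left; rw [add_sub_cancel_right]; omega
    · right; omega
    · right; omega
  · have := hCK L
    rintro (h | h)
    · exact ⟨L - 1, b, h.1, h.2, by omega⟩
    · by_cases hb : b < K L
      · exact ⟨L, b, h.1, hb, by omega⟩
      · exact ⟨L, b - 1, by omega, by omega, by omega⟩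

theorem brick_dd {L b L' b' : ℤ} : ¬ brickAdj (dV L b) (dV L' b') := by
  simp only [brickAdj, dV, Int.even_iff]; omega

theorem brick_uu {L b L' b' : ℤ} : ¬ brickAdj (uV L b) (uV L' b') := by
  simp only [brickAdj, uV, Int.even_iff]; omega

theorem brick_du {L b L' b' : ℤ} : brickAdj (dV L b) (uV L' b') ↔
    (L' = L ∧ b' = b) ∨ (L' = L ∧ b' = b + 1) ∨ (L' = L + 1 ∧ b' = b) := by
  simp only [brickAdj, uV, dV, Int.even_iff]; omega

theorem brick_symm {x y : ℤ × ℤ} (h : brickAdj x y) : brickAdj y x := by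
  simp only [brickAdj] at *
  rcases h with h | ⟨h, h'⟩
  · left; omega
  · right; rw [← h]; tauto

theorem hex_adj {C K : ℤ → ℤ} {x y : ℤ × ℤ} : (hexGraph (hxs C K)).Adj x y ↔
    brickAdj x y ∧ ∃ i b, C i ≤ b ∧ b < K i ∧ x ∈ hexVerts (2 * b + i, -i) ∧
      y ∈ hexVerts (2 * b + i, -i) := by
  rw [hexGraph, SimpleGraph.fromRel_adj]
  constructor
  · rintro ⟨-, ⟨h, c, ⟨i, b, h1, h2, rfl⟩, h3, h4⟩ | ⟨h, c, ⟨i, b, h1, h2, rfl⟩, h3, h4⟩⟩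
    · exact ⟨h, i, b, h1, h2, h3, h4⟩
    · exact ⟨brick_symm h, i, b, h1, h2, h4, h3⟩
  · rintro ⟨h, i, b, h1, h2, h3, h4⟩
    refine ⟨?_, Or.inl ⟨h, _, ⟨i, b, h1, h2, rfl⟩, h3, h4⟩⟩
    rintro rfl
    simp only [brickAdj] at h
    omega

theorem adj_P {C K : ℤ → ℤ} {L b : ℤ} :
    (hexGraph (hxs C K)).Adj (dV L b) (uV L b) ↔ Pex C K L b := by
  simp only [hex_adj, brick_du, mem_hexVerts, uV_inj, dV_inj, uV_ne_dV, dV_ne_uV, false_or,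
    or_false, Pex]
  constructor
  · rintro ⟨-, i, b', h1, h2, h3, h4⟩
    obtain rfl | rfl : i = L ∨ i = L - 1 := by omega
    · right; omega
    · left; omega
  · rintro (h | h)
    · exact ⟨by simp, L - 1, b, h.1, h.2, by omega, by omega⟩
    · exact ⟨by simp, L, b - 1, by omega, by omega, by omega, by omega⟩

theorem adj_Q {C K : ℤ → ℤ} {L b : ℤ} :
    (hexGraph (hxs C K)).Adj (dV L b) (uV L (b + 1)) ↔ Qex C K L b := by
  simp only [hex_adj, brick_du, mem_hexVerts, uV_inj, dV_inj, uV_ne_dV, dV_ne_uV, false_or,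
    or_false, Qex]
  constructor
  · rintro ⟨-, i, b', h1, h2, h3, h4⟩
    obtain rfl | rfl : i = L ∨ i = L - 1 := by omega
    · right; omega
    · left; omega
  · rintro (h | h)
    · exact ⟨by simp, L - 1, b, h.1, h.2, by omega, by omega⟩
    · exact ⟨by simp, L, b, by omega, by omega, by omega, by omega⟩

theorem adj_V {C K : ℤ → ℤ} (hCK : ∀ i, C i < K i ∨ C i = K i + 1) {L b : ℤ} :
    (hexGraph (hxs C K)).Adj (dV L b) (uV (L + 1) b) ↔ Vex C K L b := by
  simp only [hex_adj, brick_du, mem_hexVerts, uV_inj, dV_inj, uV_ne_dV, dV_ne_uV, false_or,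
    or_false, Vex]
  constructor
  · rintro ⟨-, i, b', h1, h2, h3, h4⟩
    obtain rfl : i = L := by omega
    omega
  · intro h
    have := hCK L
    refine ⟨by simp, ?_⟩
    by_cases hb : b < K L
    · exact ⟨L, b, h.1, hb, by omega, by omega⟩
    · exact ⟨L, b - 1, by omega, by omega, by omega, by omega⟩

theorem edgeSet_eq {C K : ℤ → ℤ} (hCK : ∀ i, C i < K i ∨ C i = K i + 1) :
    (hexGraph (hxs C K)).edgeSet = edgesOf (Pex C K) (Qex C K) (Vex C K) := by
  have key : ∀ L b L' b', (hexGraph (hxs C K)).Adj (dV L b) (uV L' b') →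
      s(dV L b, uV L' b') ∈ edgesOf (Pex C K) (Qex C K) (Vex C K) := by
    intro L b L' b' h
    rcases brick_du.1 (hex_adj.1 h).1 with ⟨rfl, rfl⟩ | ⟨rfl, rfl⟩ | ⟨rfl, rfl⟩
    · exact mem_edgesOf_P.2 (adj_P.1 h)
    · exact mem_edgesOf_Q.2 (adj_Q.1 h)
    · exact mem_edgesOf_V.2 ((adj_V hCK).1 h)
  ext e
  constructor
  · induction e using Sym2.ind with
    | _ x y =>
    intro h
    rw [SimpleGraph.mem_edgeSet] at h
    obtain ⟨L, b, rfl | rfl⟩ := vert_cases x <;> obtain ⟨L', b', rfl | rfl⟩ := vert_cases y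
    · exact absurd (hex_adj.1 h).1 brick_uu
    · rw [Sym2.eq_swap]; exact key _ _ _ _ h.symm
    · exact key _ _ _ _ h
    · exact absurd (hex_adj.1 h).1 brick_dd
  · rintro ⟨L, b, ⟨rfl, h⟩ | ⟨rfl, h⟩ | ⟨rfl, h⟩⟩
    · exact adj_P.2 h
    · exact adj_Q.2 h
    · exact (adj_V hCK).2 h

theorem edge_end_mem {H : Set (ℤ × ℤ)} {e : Sym2 (ℤ × ℤ)} (he : e ∈ (hexGraph H).edgeSet)
    {v : ℤ × ℤ} (hv : v ∈ e) : v ∈ hexVertexSet H := by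
  induction e using Sym2.ind with
  | _ x y =>
  rw [SimpleGraph.mem_edgeSet, hexGraph, SimpleGraph.fromRel_adj] at he
  simp only [hexVertexSet, Set.mem_iUnion, exists_prop]
  rw [Sym2.mem_iff] at hv
  obtain ⟨-, ⟨h, c, h1, h3, h4⟩ | ⟨h, c, h1, h3, h4⟩⟩ := he <;> rcases hv with rfl | rfl
  exacts [⟨c, h1, h3⟩, ⟨c, h1, h4⟩, ⟨c, h1, h4⟩, ⟨c, h1, h3⟩]

/-- Row specification: the vertical edges of a row. -/
def RowSpec (C K : ℤ) (W : ℤ → Prop) (a : ℤ) : Prop :=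
  C - 1 ≤ a ∧ a ≤ K ∧ (C < K → C ≤ a) ∧ ∀ b, W b ↔ b = a ∧ C ≤ b ∧ b ≤ K

theorem RowSpec.unique {C K : ℤ} (hCK : C < K ∨ C = K + 1) {W : ℤ → Prop} {a a' : ℤ}
    (h : RowSpec C K W a) (h' : RowSpec C K W a') : a = a' := by
  obtain ⟨h1, h2, h3, h4⟩ := h
  obtain ⟨h1', h2', h3', h4'⟩ := h'
  rcases hCK with hc | hc
  · have := (h4 a).2 ⟨rfl, h3 hc, h2⟩
    exact ((h4' a).1 this).1
  · omega

theorem level_lemma {C' K' C K : ℤ} (hC : C' ≤ C) (hK : K' ≤ K)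
    (h'act : C' < K' ∨ C' = K' + 1) (hact : C < K ∨ C = K + 1)
    {P Q V W : ℤ → Prop} {u : ℤ} (hu : RowSpec C' K' V u)
    (hP : ∀ b, P b → (C' ≤ b ∧ b < K') ∨ (C < b ∧ b ≤ K))
    (hQ : ∀ b, Q b → (C' ≤ b ∧ b < K') ∨ (C ≤ b ∧ b < K))
    (hW : ∀ b, W b → (C ≤ b ∧ b ≤ K))
    (hU : ∀ b, (C' ≤ b ∧ b ≤ K') ∨ (C < b ∧ b ≤ K) → Q (b - 1) ∨ P b ∨ V b)
    (hU1 : ∀ b, Q (b - 1) → ¬ P b) (hU2 : ∀ b, P b → ¬ V b) 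
    (hD : ∀ b, (C' ≤ b ∧ b < K') ∨ (C ≤ b ∧ b ≤ K) → P b ∨ Q b ∨ W b)
    (hD1 : ∀ b, P b → ¬ Q b) (hD2 : ∀ b, P b → ¬ W b) (hD3 : ∀ b, Q b → ¬ W b) :
    ∃ a, RowSpec C K W a ∧ u ≤ a ∧
      (∀ b, P b ↔ (C' ≤ b ∧ b < u) ∨ (a < b ∧ b ≤ K)) ∧
      (∀ b, Q b ↔ (u ≤ b ∧ b < a) ∧ ((C' ≤ b ∧ b < K') ∨ (C ≤ b ∧ b < K))) := by
  obtain ⟨hu1, hu2, hu3, hu4⟩ := hu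
  -- left part
  have L1 : ∀ b, C' ≤ b → b < u → P b := by
    intro b hb
    induction b, hb using Int.leInduction with
    | base =>
      intro h
      rcases hU C' (by omega) with h1 | h1 | h1
      · have := hQ _ h1; omega
      · exact h1
      · have := (hu4 _).1 h1; omega
    | succ n hn ih =>
      intro h
      have h0 := ih (by omega)
      rcases hU (n + 1) (by omega) with h1 | h1 | h1
      · rw [add_sub_cancel_right] at h1; exact absurd h1 (hD1 _ h0)
      · exact h1
      · have := (hu4 _).1 h1; omega
  have W1 : ∀ b, W b → u ≤ b := by
    intro b hb
    by_contra hlt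
    have := hW b hb
    exact hD2 b (L1 b (by omega) (by omega)) hb
  -- middle part
  have L2 : ∀ b, u ≤ b → (∀ c, c < b → ¬ W c) → ¬ P b := by
    intro b hb
    induction b, hb using Int.leInduction with
    | base =>
      intro _ h
      rcases h'act with h1 | h1
      · exact hU2 u h ((hu4 u).2 ⟨rfl, hu3 h1, hu2⟩)
      · have := hP _ h; omega
    | succ n hn ih =>
      intro h hPn
      have h0 := ih (fun c hc => h c (by omega))
      have h2 := hP _ hPn
      have h3 := h n (by omega)
      have hQn : Q n := by
        rcases hD n (by omega) with h1 | h1 | h1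
        · exact absurd h1 h0
        · exact h1
        · exact absurd h1 h3
      exact hU1 (n + 1) (by rwa [add_sub_cancel_right]) hPn
  -- the position a
  obtain ⟨a, ha, hmin, hWa⟩ : ∃ a, (C - 1 ≤ a ∧ a ≤ K ∧ (C < K → C ≤ a) ∧ u ≤ a) ∧
      (∀ c, c < a → ¬ W c) ∧ (C < K → W a) := by
    rcases hact with hc | hc
    · have hex : ∃ b, W b := by
        by_contra hno
        push Not at hno
        have h1 := L2 K (by omega) (fun c _ => hno c)
        rcases hD K (by omega) with h2 | h2 | h2
        · exact h1 h2
        · have := hQ _ h2; omega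
        · exact hno _ h2
      obtain ⟨a, ha, hmin⟩ := Int.exists_least_of_bdd (P := W) ⟨u, W1⟩ hex
      have := hW a ha
      have := W1 a ha
      refine ⟨a, by omega, fun c hc hWc => ?_, fun _ => ha⟩
      have := hmin c hWc
      omega
    · refine ⟨K, by omega, fun c _ hWc => ?_, by omega⟩
      have := hW c hWc; omega
  obtain ⟨ha1, ha2, ha3, ha4⟩ := ha
  -- right part
  have L3 : ∀ b, a + 1 ≤ b → b ≤ K → P b := by
    intro b hb
    induction b, hb using Int.leInduction with
    | base =>
      intro h
      have hc : C < K := by omega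
      rcases hU (a + 1) (by have := ha3 hc; omega) with h1 | h1 | h1
      · rw [add_sub_cancel_right] at h1; exact absurd (hWa hc) (hD3 _ h1)
      · exact h1
      · have := (hu4 _).1 h1; omega
    | succ n hn ih =>
      intro h
      have h0 := ih (by omega)
      rcases hU (n + 1) (by omega) with h1 | h1 | h1
      · rw [add_sub_cancel_right] at h1; exact absurd h1 (hD1 _ h0)
      · exact h1
      · have := (hu4 _).1 h1; omega
  have W2 : ∀ b, W b → b = a := by
    intro b hb
    have := hW b hb
    rcases lt_trichotomy b a with h | h | h
    · exact absurd hb (hmin b h)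
    · exact h
    · exact absurd hb (hD2 _ (L3 b (by omega) (by omega)))
  have PP : ∀ b, P b ↔ (C' ≤ b ∧ b < u) ∨ (a < b ∧ b ≤ K) := by
    intro b
    constructor
    · intro h
      have h1 := hP b h
      by_contra hno
      have h2 : u ≤ b := by omega
      have h3 : b ≤ a := by omega
      exact L2 b h2 (fun c hc => hmin c (by omega)) h
    · rintro (h | h)
      · exact L1 b h.1 h.2
      · exact L3 b (by omega) h.2
  have WW : ∀ b, W b ↔ b = a ∧ C ≤ b ∧ b ≤ K := by
    intro b
    constructor
    · intro h; exact ⟨W2 b h, hW b h⟩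
    · rintro ⟨rfl, h1, h2⟩; exact hWa (by omega)
  refine ⟨a, ⟨ha1, ha2, ha3, WW⟩, ha4, PP, fun b => ?_⟩
  constructor
  · intro h
    have h1 := hQ b h
    have h2 : ¬ P b := fun h' => hD1 b h' h
    have h3 := hD3 b h
    rw [PP] at h2
    rw [WW] at h3
    refine ⟨?_, h1⟩
    omega
  · rintro ⟨h, h1⟩
    rcases hD b (by omega) with h2 | h2 | h2
    · rw [PP] at h2; omega
    · exact h2
    · rw [WW] at h2; omega

/-- Valid integer-indexed sequences. -/
def Valid (C K a : ℤ → ℤ) : Prop :=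
  Monotone a ∧ ∀ i, C i - 1 ≤ a i ∧ a i ≤ K i ∧ (C i < K i → C i ≤ a i)

/-- The matching of a sequence. -/
def matchOf (C K a : ℤ → ℤ) : Set (Sym2 (ℤ × ℤ)) :=
  edgesOf
    (fun L b => (C (L - 1) ≤ b ∧ b < a (L - 1)) ∨ (a L < b ∧ b ≤ K L))
    (fun L b => (a (L - 1) ≤ b ∧ b < a L) ∧ Qex C K L b)
    (fun L b => b = a L ∧ C L ≤ b ∧ b ≤ K L)

theorem matchOf_inj {C K a a' : ℤ → ℤ} (hCK : ∀ i, C i < K i ∨ C i = K i + 1)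
    (ha : Valid C K a) (ha' : Valid C K a') (h : matchOf C K a = matchOf C K a') : a = a' := by
  funext i
  have h1 := ha.2 i
  have h2 := ha'.2 i
  refine RowSpec.unique (C := C i) (K := K i) (hCK i)
    (W := fun b => s(dV i b, uV (i + 1) b) ∈ matchOf C K a)
    ⟨h1.1, h1.2.1, h1.2.2, fun b => mem_edgesOf_V⟩ ?_
  rw [h]
  exact ⟨h2.1, h2.2.1, h2.2.2, fun b => mem_edgesOf_V⟩

theorem matchOf_pm {C K a : ℤ → ℤ} (hCK : ∀ i, C i < K i ∨ C i = K i + 1)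
    (hC : Monotone C) (hK : Monotone K) (ha : Valid C K a) :
    hexPM (hxs C K) (matchOf C K a) := by
  obtain ⟨hm, ha⟩ := ha
  have hsub : matchOf C K a ⊆ (hexGraph (hxs C K)).edgeSet := by
    rw [edgeSet_eq hCK]
    rintro e ⟨L, b, ⟨rfl, h⟩ | ⟨rfl, h⟩ | ⟨rfl, h⟩⟩
    · refine mem_edgesOf_P.2 ?_
      have := ha L; have := ha (L - 1); have := hCK L; have := hCK (L - 1)
      simp only [Pex]; omega
    · exact mem_edgesOf_Q.2 h.2
    · exact mem_edgesOf_V.2 h.2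
  refine ⟨hsub, fun e he v hv => edge_end_mem (hsub he) hv, ?_, ?_⟩
  · intro e he f hf hne v hve hvf
    apply hne
    obtain ⟨L, b, rfl | rfl⟩ := vert_cases v
    · have h1 := mem_edgesOf_u he hve
      have h2 := mem_edgesOf_u hf hvf
      have a1 := hm (show L - 1 ≤ L by omega)
      have a2 := ha L; have a3 := ha (L - 1)
      simp only [Qex] at h1 h2
      rcases h1 with ⟨rfl, h1⟩ | ⟨rfl, h1⟩ | ⟨rfl, h1⟩ <;>
      rcases h2 with ⟨rfl, h2⟩ | ⟨rfl, h2⟩ | ⟨rfl, h2⟩ <;> first | rfl | (exfalso; omega)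
    · have h1 := mem_edgesOf_d he hve
      have h2 := mem_edgesOf_d hf hvf
      have a1 := hm (show L - 1 ≤ L by omega)
      have a2 := ha L; have a3 := ha (L - 1)
      simp only [Qex] at h1 h2
      rcases h1 with ⟨rfl, h1⟩ | ⟨rfl, h1⟩ | ⟨rfl, h1⟩ <;>
      rcases h2 with ⟨rfl, h2⟩ | ⟨rfl, h2⟩ | ⟨rfl, h2⟩ <;> first | rfl | (exfalso; omega)
  · intro v hv
    obtain ⟨L, b, rfl | rfl⟩ := vert_cases v
    · rw [u_mem hCK, Uex] at hv
      have a1 := hm (show L - 1 ≤ L by omega)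
      have a2 := ha L; have a3 := ha (L - 1); have a4 := hCK L; have a5 := hCK (L - 1)
      have a6 := hC (show L - 1 ≤ L by omega); have a7 := hK (show L - 1 ≤ L by omega)
      by_cases c1 : (C (L - 1) ≤ b ∧ b < a (L - 1)) ∨ (a L < b ∧ b ≤ K L)
      · exact ⟨_, mem_edgesOf_P.2 c1, Sym2.mem_mk_right _ _⟩
      · by_cases c2 : b = a (L - 1) ∧ C (L - 1) ≤ b ∧ b ≤ K (L - 1)
        · refine ⟨s(dV (L - 1) b, uV (L - 1 + 1) b), mem_edgesOf_V.2 c2, ?_⟩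
          rw [sub_add_cancel]; exact Sym2.mem_mk_right _ _
        · refine ⟨s(dV L (b - 1), uV L (b - 1 + 1)), mem_edgesOf_Q.2 ?_, ?_⟩
          · simp only [Qex]; omega
          · rw [sub_add_cancel]; exact Sym2.mem_mk_right _ _
    · rw [d_mem hCK, Dex] at hv
      have a1 := hm (show L - 1 ≤ L by omega)
      have a2 := ha L; have a3 := ha (L - 1); have a4 := hCK L; have a5 := hCK (L - 1)
      have a6 := hC (show L - 1 ≤ L by omega); have a7 := hK (show L - 1 ≤ L by omega)
      by_cases c1 : (C (L - 1) ≤ b ∧ b < a (L - 1)) ∨ (a L < b ∧ b ≤ K L)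
      · exact ⟨_, mem_edgesOf_P.2 c1, Sym2.mem_mk_left _ _⟩
      · by_cases c2 : b = a L ∧ C L ≤ b ∧ b ≤ K L
        · exact ⟨_, mem_edgesOf_V.2 c2, Sym2.mem_mk_left _ _⟩
        · refine ⟨_, mem_edgesOf_Q.2 ?_, Sym2.mem_mk_left _ _⟩
          simp only [Qex]; omega

theorem pm_exists {C K : ℤ → ℤ} (hCK : ∀ i, C i < K i ∨ C i = K i + 1)
    (hC : Monotone C) (hK : Monotone K) (hneg : ∀ i < 0, C i = K i + 1)
    {M : Set (Sym2 (ℤ × ℤ))} (hM : hexPM (hxs C K) M) :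
    ∃ a, Valid C K a ∧ M = matchOf C K a := by
  obtain ⟨hsub, -, hdis, hcov⟩ := hM
  rw [edgeSet_eq hCK] at hsub
  have hdis' : ∀ {e f v}, e ∈ M → f ∈ M → v ∈ e → v ∈ f → e = f := by
    intro e f v he hf hve hvf
    by_contra hne
    exact hdis he hf hne v hve hvf
  set P : ℤ → ℤ → Prop := fun L b => s(dV L b, uV L b) ∈ M with hPdef
  set Q : ℤ → ℤ → Prop := fun L b => s(dV L b, uV L (b + 1)) ∈ M with hQdef
  set V : ℤ → ℤ → Prop := fun L b => s(dV L b, uV (L + 1) b) ∈ M with hVdef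
  have step : ∀ L u, RowSpec (C (L - 1)) (K (L - 1)) (V (L - 1)) u →
      ∃ a, RowSpec (C L) (K L) (V L) a ∧ u ≤ a ∧
      (∀ b, P L b ↔ (C (L - 1) ≤ b ∧ b < u) ∨ (a < b ∧ b ≤ K L)) ∧
      (∀ b, Q L b ↔ (u ≤ b ∧ b < a) ∧
        ((C (L - 1) ≤ b ∧ b < K (L - 1)) ∨ (C L ≤ b ∧ b < K L))) := by
    intro L u hu
    refine level_lemma (hC (by omega)) (hK (by omega)) (hCK _) (hCK _) hu
      (fun b h => mem_edgesOf_P.1 (hsub h)) (fun b h => mem_edgesOf_Q.1 (hsub h))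
      (fun b h => mem_edgesOf_V.1 (hsub h)) ?_ ?_ ?_ ?_ ?_ ?_ ?_
    · intro b hb
      obtain ⟨e, he, hv⟩ := hcov _ ((u_mem hCK).2 hb)
      rcases mem_edgesOf_u (hsub he) hv with ⟨rfl, -⟩ | ⟨rfl, -⟩ | ⟨rfl, -⟩
      · exact Or.inr (Or.inl he)
      · left; simpa only [hQdef, sub_add_cancel] using he
      · right; right; simpa only [hVdef, sub_add_cancel] using he
    · intro b h1 h2
      simp only [hQdef, sub_add_cancel] at h1
      have := hdis' h1 h2 (Sym2.mem_mk_right _ _) (Sym2.mem_mk_right _ _)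
      rw [edge_inj] at this; omega
    · intro b h1 h2
      simp only [hVdef, sub_add_cancel] at h2
      have := hdis' h1 h2 (Sym2.mem_mk_right _ _) (Sym2.mem_mk_right _ _)
      rw [edge_inj] at this; omega
    · intro b hb
      obtain ⟨e, he, hv⟩ := hcov _ ((d_mem hCK).2 hb)
      rcases mem_edgesOf_d (hsub he) hv with ⟨rfl, -⟩ | ⟨rfl, -⟩ | ⟨rfl, -⟩
      · exact Or.inl he
      · exact Or.inr (Or.inl he)
      · exact Or.inr (Or.inr he)
    · intro b h1 h2
      have := hdis' h1 h2 (Sym2.mem_mk_left _ _) (Sym2.mem_mk_left _ _)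
      rw [edge_inj] at this; omega
    · intro b h1 h2
      have := hdis' h1 h2 (Sym2.mem_mk_left _ _) (Sym2.mem_mk_left _ _)
      rw [edge_inj] at this; omega
    · intro b h1 h2
      have := hdis' h1 h2 (Sym2.mem_mk_left _ _) (Sym2.mem_mk_left _ _)
      rw [edge_inj] at this; omega
  have rows : ∀ i, ∃ a, RowSpec (C i) (K i) (V i) a := by
    have neg : ∀ i < 0, ∃ a, RowSpec (C i) (K i) (V i) a := by
      intro i hi
      have h1 := hneg i hi
      refine ⟨K i, by omega, by omega, by omega, fun b => ⟨fun h => ?_, by omega⟩⟩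
      have := mem_edgesOf_V.1 (hsub h)
      simp only [Vex] at this
      omega
    intro i
    by_cases hi : i < -1
    · exact neg i (by omega)
    · have hi' : -1 ≤ i := by omega
      clear hi
      induction i, hi' using Int.leInduction with
      | base => exact neg _ (by omega)
      | succ n hn ih =>
        obtain ⟨u, hu⟩ := ih
        obtain ⟨a, ha, -⟩ := step (n + 1) u (by rwa [add_sub_cancel_right])
        exact ⟨a, ha⟩
  choose a ha using rows
  have full : ∀ L, a (L - 1) ≤ a L ∧
      (∀ b, P L b ↔ (C (L - 1) ≤ b ∧ b < a (L - 1)) ∨ (a L < b ∧ b ≤ K L)) ∧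
      (∀ b, Q L b ↔ (a (L - 1) ≤ b ∧ b < a L) ∧
        ((C (L - 1) ≤ b ∧ b < K (L - 1)) ∨ (C L ≤ b ∧ b < K L))) := by
    intro L
    obtain ⟨a', ha', h⟩ := step L (a (L - 1)) (ha _)
    rw [ha'.unique (hCK L) (ha L)] at h
    exact h
  refine ⟨a, ⟨monotone_int_of_le_succ fun n => ?_, fun i => ⟨(ha i).1, (ha i).2.1, (ha i).2.2.1⟩⟩, ?_⟩
  · have := (full (n + 1)).1
    rwa [add_sub_cancel_right] at this
  · ext e
    constructor
    · intro he
      obtain ⟨L, b, ⟨rfl, -⟩ | ⟨rfl, -⟩ | ⟨rfl, -⟩⟩ := hsub he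
      · exact mem_edgesOf_P.2 (((full L).2.1 b).1 he)
      · exact mem_edgesOf_Q.2 (((full L).2.2 b).1 he)
      · exact mem_edgesOf_V.2 (((ha L).2.2.2 b).1 he)
    · rintro ⟨L, b, ⟨rfl, h⟩ | ⟨rfl, h⟩ | ⟨rfl, h⟩⟩
      · exact ((full L).2.1 b).2 h
      · exact ((full L).2.2 b).2 h
      · exact ((ha L).2.2.2 b).2 h

/-- Extension of a finite sequence to all integers. -/
def extZ {m : ℕ} (f : Fin m → ℤ) (lo hi : ℤ) (i : ℤ) : ℤ :=
  if h : 0 ≤ i ∧ i < m then f ⟨i.toNat, by omega⟩ else if i < 0 then lo else hi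

theorem extZ_fin {m : ℕ} (f : Fin m → ℤ) (lo hi : ℤ) (i : Fin m) :
    extZ f lo hi (i : ℤ) = f i := by
  have := i.2
  rw [extZ, dif_pos (by omega)]
  simp

theorem extZ_neg {m : ℕ} (f : Fin m → ℤ) (lo hi : ℤ) {i : ℤ} (h : i < 0) :
    extZ f lo hi i = lo := by
  rw [extZ, dif_neg (by omega), if_pos h]

theorem extZ_big {m : ℕ} (f : Fin m → ℤ) (lo hi : ℤ) {i : ℤ} (h : (m : ℤ) ≤ i) :
    extZ f lo hi i = hi := by
  rw [extZ, dif_neg (by omega), if_neg (by omega)]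

theorem int_cases (m : ℕ) (i : ℤ) : i < 0 ∨ (m : ℤ) ≤ i ∨ ∃ j : Fin m, i = (j : ℤ) := by
  by_cases h : 0 ≤ i ∧ i < m
  · exact Or.inr (Or.inr ⟨⟨i.toNat, by omega⟩, by simp [h.1]⟩)
  · omega

theorem extZ_mono {m : ℕ} {f : Fin m → ℤ} {lo hi : ℤ} (hf : Monotone f)
    (hlo : ∀ i, lo ≤ f i) (hhi : ∀ i, f i ≤ hi) (h : lo ≤ hi) : Monotone (extZ f lo hi) := by
  intro i j hij
  rcases int_cases m i with hi | hi | ⟨i, rfl⟩ <;> rcases int_cases m j with hj | hj | ⟨j, rfl⟩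
  · rw [extZ_neg _ _ _ hi, extZ_neg _ _ _ hj]
  · rw [extZ_neg _ _ _ hi, extZ_big _ _ _ hj]; exact h
  · rw [extZ_neg _ _ _ hi, extZ_fin]; exact hlo j
  · omega
  · rw [extZ_big _ _ _ hi, extZ_big _ _ _ hj]
  · have := j.2; omega
  · omega
  · rw [extZ_fin, extZ_big _ _ _ hj]; exact hhi i
  · rw [extZ_fin, extZ_fin]; exact hf (by exact_mod_cast hij)

theorem chs_equiv (m : ℕ) (k h : Fin m → ℕ)
    (hmk : Monotone k) (hmh : Monotone h) (hkh : ∀ i, h i ≤ k i)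
    (hh1 : ∀ i, 1 ≤ h i) :
    Nonempty
      ({M : Set (Sym2 (ℤ × ℤ)) // hexPM (chsHexes m k h) M} ≃
        {a : Fin m → ℕ // Monotone a ∧ ∀ i, h i - 1 ≤ a i ∧ a i ≤ k i}) := by
  obtain ⟨T, hT⟩ : ∃ T : ℕ, ∀ i, k i ≤ T :=
    ⟨∑ i, k i, fun i => Finset.single_le_sum (fun _ _ => Nat.zero_le _) (Finset.mem_univ i)⟩
  set K : ℤ → ℤ := extZ (fun i => (k i : ℤ)) (-1) T with hKdef
  set C : ℤ → ℤ := extZ (fun i => (h i : ℤ) - 1) 0 (T + 1) with hCdef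
  have Kfin : ∀ i : Fin m, K (i : ℤ) = k i := fun i => extZ_fin _ _ _ i
  have Cfin : ∀ i : Fin m, C (i : ℤ) = (h i : ℤ) - 1 := fun i => extZ_fin _ _ _ i
  have Kneg : ∀ i < 0, K i = -1 := fun i hi => extZ_neg _ _ _ hi
  have Cneg : ∀ i < 0, C i = 0 := fun i hi => extZ_neg _ _ _ hi
  have Kbig : ∀ i, (m : ℤ) ≤ i → K i = T := fun i hi => extZ_big _ _ _ hi
  have Cbig : ∀ i, (m : ℤ) ≤ i → C i = T + 1 := fun i hi => extZ_big _ _ _ hi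
  have hK : Monotone K := by
    refine extZ_mono (fun i j hij => ?_) (fun i => ?_) (fun i => ?_) (by omega)
    · have := hmk hij; simpa using this
    · show (-1 : ℤ) ≤ k i; omega
    · show (k i : ℤ) ≤ T; have := hT i; omega
  have hC : Monotone C := by
    refine extZ_mono (fun i j hij => ?_) (fun i => ?_) (fun i => ?_) (by omega)
    · have := hmh hij; simpa using this
    · show (0 : ℤ) ≤ h i - 1; have := hh1 i; omega
    · show (h i : ℤ) - 1 ≤ T + 1; have := hT i; have := hkh i; omega
  have hCK : ∀ i, C i < K i ∨ C i = K i + 1 := by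
    intro i
    rcases int_cases m i with hi | hi | ⟨i, rfl⟩
    · rw [Kneg i hi, Cneg i hi]; omega
    · rw [Kbig i hi, Cbig i hi]; omega
    · rw [Kfin, Cfin]; have := hkh i; omega
  have hneg : ∀ i < 0, C i = K i + 1 := by
    intro i hi; rw [Kneg i hi, Cneg i hi]; omega
  have hH : chsHexes m k h = hxs C K := by
    ext p
    constructor
    · rintro ⟨i, j, h1, h2, rfl⟩
      refine ⟨i, (j : ℤ) - 1, ?_, ?_, rfl⟩
      · rw [Cfin]; omega
      · rw [Kfin]; omega
    · rintro ⟨i, b, h1, h2, rfl⟩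
      rcases int_cases m i with hi | hi | ⟨i, rfl⟩
      · rw [Kneg i hi] at h2; rw [Cneg i hi] at h1; omega
      · rw [Kbig i hi] at h2; rw [Cbig i hi] at h1; omega
      · rw [Kfin] at h2; rw [Cfin] at h1
        have := hh1 i
        refine ⟨i, (b + 1).toNat, by omega, by omega, ?_⟩
        have : (((b + 1).toNat : ℕ) : ℤ) = b + 1 := by omega
        rw [this]; simp
  rw [hH]
  let ext : (Fin m → ℕ) → ℤ → ℤ := fun a => extZ (fun i => (a i : ℤ)) (-1) T
  have extfin : ∀ a (i : Fin m), ext a (i : ℤ) = a i := fun a i => extZ_fin _ _ _ i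
  have hval : ∀ a : Fin m → ℕ, (Monotone a ∧ ∀ i, h i - 1 ≤ a i ∧ a i ≤ k i) →
      Valid C K (ext a) := by
    rintro a ⟨hm, ha⟩
    refine ⟨extZ_mono (fun i j hij => ?_) (fun i => ?_) (fun i => ?_) (by omega), fun i => ?_⟩
    · have := hm hij; simpa using this
    · show (-1 : ℤ) ≤ a i; omega
    · show (a i : ℤ) ≤ T; have := hT i; have := ha i; omega
    · rcases int_cases m i with hi | hi | ⟨i, rfl⟩
      · have : ext a i = -1 := extZ_neg _ _ _ hi
        rw [this, Kneg i hi, Cneg i hi]; omega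
      · have : ext a i = T := extZ_big _ _ _ hi
        rw [this, Kbig i hi, Cbig i hi]; omega
      · rw [extfin, Kfin, Cfin]
        have := ha i; have := hh1 i; omega
  refine ⟨(Equiv.ofBijective (fun a => ⟨matchOf C K (ext a.1),
    matchOf_pm hCK hC hK (hval a.1 a.2)⟩) ⟨?_, ?_⟩).symm⟩
  · intro a a' haa
    have h1 := matchOf_inj hCK (hval a.1 a.2) (hval a'.1 a'.2) (congrArg Subtype.val haa)
    apply Subtype.ext
    funext i
    have h2 := congrFun h1 (i : ℤ)
    rw [extfin, extfin] at h2
    exact_mod_cast h2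
  · rintro ⟨M, hM⟩
    obtain ⟨a, ⟨hm, ha⟩, rfl⟩ := pm_exists hCK hC hK hneg hM
    have hpos : ∀ i : Fin m, ((a i).toNat : ℤ) = a i ∧ (h i : ℤ) - 1 ≤ a i ∧ a i ≤ k i := by
      intro i
      have h1 := ha i
      rw [Cfin, Kfin] at h1
      have := hh1 i; have := hkh i
      omega
    refine ⟨⟨fun i => (a i).toNat, fun i j hij => ?_, fun i => ?_⟩, ?_⟩
    · have := hm (show (i : ℤ) ≤ j by exact_mod_cast hij)
      exact Int.toNat_le_toNat this
    · have := hpos i; beta_reduce; constructor <;> omega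
    · apply Subtype.ext
      show matchOf C K (ext (fun i => (a i).toNat)) = matchOf C K a
      congr 1
      funext i
      rcases int_cases m i with hi | hi | ⟨i, rfl⟩
      · have h1 : ext (fun i => (a i).toNat) i = -1 := extZ_neg _ _ _ hi
        have h2 := ha i
        rw [Kneg i hi, Cneg i hi] at h2; omega
      · have h1 : ext (fun i => (a i).toNat) i = T := extZ_big _ _ _ hi
        have h2 := ha i
        rw [Kbig i hi, Cbig i hi] at h2; omega
      · rw [extfin]; exact (hpos i).1

/-- Perfect matchings of a monotonic CHS are in bijection with non-decreasing
sequences `(a_1,…,a_m)` with `a_i ∈ {h_i − 1, …, k_i}`; in particular the numbers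
of each are equal. -/
theorem chs_pm_bijection (m : ℕ) (k h : Fin m → ℕ)
    (hmk : Monotone k) (hmh : Monotone h) (hkh : ∀ i, h i ≤ k i)
    (hh1 : ∀ i, 1 ≤ h i) :
    Nonempty
      ({M : Set (Sym2 (ℤ × ℤ)) // hexPM (chsHexes m k h) M} ≃
        {a : Fin m → ℕ // Monotone a ∧ ∀ i, h i - 1 ≤ a i ∧ a i ≤ k i}) ∧
    {M : Set (Sym2 (ℤ × ℤ)) | hexPM (chsHexes m k h) M}.ncard =
      {a : Fin m → ℕ | Monotone a ∧ ∀ i, h i - 1 ≤ a i ∧ a i ≤ k i}.ncard := by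
  obtain ⟨e⟩ := chs_equiv m k h hmk hmh hkh hh1
  refine ⟨⟨e⟩, ?_⟩
  rw [← Nat.card_coe_set_eq, ← Nat.card_coe_set_eq]
  exact Nat.card_congr e
end

section
/- The forcing polynomial of the hexagonal system CHS(1,...,1,k; 1,...,1 | 1,...,1,k; 1,...,1) (a '+'-shaped hexagonal system formed from a column of m hexagons and a column of m' hexagons sharing a turning row which is a linear chain of k hexagons, k ≥ 2, m, m' ≥ 2) equals k·m·m'·x^3 + x. -/
open SimpleGraph

/-- The CHS with one turning formed by a horizontal chain of `k` hexagons (the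
turning row) with an oblique column of `m − 1` hexagons attached above its
rightmost hexagon and an oblique column of `m' − 1` hexagons attached below it. -/
def plusShape (k m m' : ℕ) : Set (ℤ × ℤ) :=
  {p | ∃ j : ℕ, j < k ∧ p = (2 * (j : ℤ), 0)} ∪
    {p | ∃ t : ℕ, 1 ≤ t ∧ t ≤ m - 1 ∧ p = (2 * (k : ℤ) - 2 + (t : ℤ), (t : ℤ))} ∪
    {p | ∃ t : ℕ, 1 ≤ t ∧ t ≤ m' - 1 ∧ p = (2 * (k : ℤ) - 2 + (t : ℤ), -(t : ℤ))}


/-! ### Abstract model: three ladders glued around a central hexagon -/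

/-- Vertices of the model: branch, rail, position on the rail. -/
abbrev TW := Fin 3 × Bool × ℕ

def TVal (a : Fin 3 → ℕ) (w : TW) : Prop := w.2.2 ≤ 2 * a w.1

def TAdj (w w' : TW) : Prop :=
  (w.1 = w'.1 ∧ w.2.1 = w'.2.1 ∧ (w'.2.2 = w.2.2 + 1 ∨ w.2.2 = w'.2.2 + 1)) ∨
  (w.1 = w'.1 ∧ w'.2.1 = !w.2.1 ∧ w.2.2 = w'.2.2 ∧ w.2.2 % 2 = 0) ∨
  (w.2.2 = 0 ∧ w'.2.2 = 0 ∧ w.2.1 = true ∧ w'.2.1 = false ∧ w'.1 = w.1 + 1) ∨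
  (w.2.2 = 0 ∧ w'.2.2 = 0 ∧ w.2.1 = false ∧ w'.2.1 = true ∧ w.1 = w'.1 + 1)

/-- The explicit perfect matchings, as partner functions. -/
def tpf (J : Option (Fin 3 → ℕ)) (w : TW) : TW :=
  match J with
  | some J =>
    if w.2.2 = 2 * J w.1 then (w.1, !w.2.1, w.2.2)
    else if w.2.2 < 2 * J w.1 then
      (w.1, w.2.1, if w.2.2 % 2 = 0 then w.2.2 + 1 else w.2.2 - 1)
    else (w.1, w.2.1, if w.2.2 % 2 = 1 then w.2.2 + 1 else w.2.2 - 1)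
  | none =>
    if w.2.2 = 0 then (if w.2.1 then (w.1 + 1, false, 0) else (w.1 + 2, true, 0))
    else (w.1, w.2.1, if w.2.2 % 2 = 1 then w.2.2 + 1 else w.2.2 - 1)

def TOk (a : Fin 3 → ℕ) (J : Option (Fin 3 → ℕ)) : Prop := ∀ K, J = some K → ∀ c, K c ≤ a c

theorem tpf_val {a : Fin 3 → ℕ} {J} (hJ : TOk a J) {w : TW} (hw : TVal a w) :
    TVal a (tpf J w) := by
  obtain ⟨c, s, i⟩ := w
  cases J with
  | none =>
    simp only [tpf, TVal] at *
    split_ifs <;> simp <;> omega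
  | some K =>
    have := hJ K rfl c
    simp only [tpf, TVal] at *
    split_ifs <;> simp <;> omega

theorem fin3_a : ∀ c : Fin 3, c + 1 + 2 = c := by decide
theorem fin3_b : ∀ c : Fin 3, c + 2 + 1 = c := by decide
theorem fin3_c : ∀ c : Fin 3, c + 1 ≠ c := by decide
theorem fin3_d : ∀ c d : Fin 3, d = c + 1 ∨ d = c + 1 + 1 ∨ d = c + 1 + 1 + 1 := by decide

theorem tpf_adj {J} (w : TW) : TAdj w (tpf J w) := by
  obtain ⟨c, s, i⟩ := w
  cases J with
  | none =>
    simp only [tpf, TAdj]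
    split_ifs with h1 h2 h2
    · simp_all
    · right; right; right
      exact ⟨h1, rfl, by simpa using h2, rfl, (fin3_b c).symm⟩
    · simp
    · left; simp; omega
  | some K =>
    simp only [tpf, TAdj]
    split_ifs with h1 h2 h3 h3
    · right; left; simp; omega
    · simp
    · left; simp; omega
    · simp
    · left; simp; omega

theorem tpf_invol {J} (w : TW) : tpf J (tpf J w) = w := by
  obtain ⟨c, s, i⟩ := w
  cases J with
  | none =>
    have h1 := fin3_a c
    have h2 := fin3_b c
    simp only [tpf]
    split_ifs <;> simp_all <;> omega
  | some K =>
    simp only [tpf]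
    split_ifs <;> simp_all <;> omega

/-- A perfect matching of the model as a relation. -/
structure TPM (a : Fin 3 → ℕ) (r : TW → TW → Prop) : Prop where
  symm : ∀ {u v}, r u v → r v u
  adj : ∀ {u v}, r u v → TAdj u v
  val : ∀ {u v}, r u v → TVal a u
  uniq : ∀ {u v w}, r u v → r u w → v = w
  ex : ∀ {u}, TVal a u → ∃ v, r u v

namespace TPM
variable {a : Fin 3 → ℕ} {r : TW → TW → Prop}

theorem odd (h : TPM a r) {c s t} (ht : 2 * t + 1 ≤ 2 * a c) :
    r (c, s, 2 * t + 1) (c, s, 2 * t) ∨ r (c, s, 2 * t + 1) (c, s, 2 * t + 2) := by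
  obtain ⟨⟨c', s', i'⟩, hv⟩ := h.ex (u := (c, s, 2 * t + 1)) ht
  have := h.adj hv
  simp only [TAdj] at this
  rcases this with ⟨rfl, rfl, h1 | h1⟩ | ⟨_, _, _, h1⟩ | ⟨h1, _⟩ | ⟨h1, _⟩
  · subst h1; exact Or.inr hv
  · obtain rfl : i' = 2 * t := by omega
    exact Or.inl hv
  all_goals omega

theorem rungSymm (h : TPM a r) {c j} (hr : r (c, false, 2 * j) (c, true, 2 * j)) (s : Bool) :
    r (c, s, 2 * j) (c, !s, 2 * j) := by
  cases s
  · exact hr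
  · exact h.symm hr

theorem up (h : TPM a r) {c j} (hr : r (c, false, 2 * j) (c, true, 2 * j)) (s : Bool) (n : ℕ) :
    2 * (j + n) + 1 ≤ 2 * a c → r (c, s, 2 * (j + n) + 1) (c, s, 2 * (j + n) + 2) := by
  induction n with
  | zero =>
    intro hn
    rcases h.odd (s := s) hn with h1 | h1
    · have := h.uniq (h.symm h1) (h.rungSymm hr s)
      simp at this
    · exact h1
  | succ n ih =>
    intro hn
    rcases h.odd (s := s) hn with h1 | h1
    · have := h.uniq (h.symm h1) (h.symm (ih (by omega)))
      simp at this
    · exact h1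

theorem down (h : TPM a r) {c j} (hr : r (c, false, 2 * j) (c, true, 2 * j)) (s : Bool) (n : ℕ) :
    ∀ t, t + 1 + n = j → r (c, s, 2 * t + 1) (c, s, 2 * t) := by
  have hj : 2 * j ≤ 2 * a c := h.val hr
  induction n with
  | zero =>
    intro t ht
    rcases h.odd (c := c) (s := s) (t := t) (by omega) with h1 | h1
    · exact h1
    · have h2 := h.rungSymm hr s
      rw [show 2 * j = 2 * t + 2 by omega] at h2
      have := h.uniq (h.symm h1) h2
      simp at this
  | succ n ih =>
    intro t ht
    rcases h.odd (c := c) (s := s) (t := t) (by omega) with h1 | h1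
    · exact h1
    · have h2 := h.symm (ih (t + 1) (by omega))
      have := h.uniq (h.symm h1) h2
      simp at this

theorem rung (h : TPM a r) {c} {J : Fin 3 → ℕ} (hr : r (c, false, 2 * J c) (c, true, 2 * J c))
    (s : Bool) {i : ℕ} (hi : i ≤ 2 * a c) : r (c, s, i) (tpf (some J) (c, s, i)) := by
  simp only [tpf]
  split_ifs with h1 h2 h3 h3
  · subst h1; exact h.rungSymm hr s
  · obtain ⟨t, rfl⟩ : ∃ t, i = 2 * t := ⟨i / 2, by omega⟩
    exact h.symm (h.down hr s (J c - t - 1) t (by omega))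
  · obtain ⟨t, rfl⟩ : ∃ t, i = 2 * t + 1 := ⟨i / 2, by omega⟩
    exact h.down hr s (J c - t - 1) t (by omega)
  · obtain ⟨t, rfl⟩ : ∃ t, i = 2 * (J c + t) + 1 := ⟨i / 2 - J c, by omega⟩
    exact h.up hr s t (by omega)
  · obtain ⟨t, rfl⟩ : ∃ t, i = 2 * (J c + t) + 2 := ⟨i / 2 - J c - 1, by omega⟩
    exact h.symm (h.up hr s t (by omega))

theorem noRungAux (h : TPM a r) {c}
    (hr : ∀ j, ¬ r (c, false, 2 * j) (c, true, 2 * j)) (s : Bool) (n : ℕ) :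
    ∀ t, t + 1 + n = a c → r (c, s, 2 * t + 2) (c, s, 2 * t + 1) := by
  induction n with
  | zero =>
    intro t ht
    rcases h.odd (c := c) (s := s) (t := t) (by omega) with h1 | h1
    · exfalso
      obtain ⟨⟨c', s', i'⟩, hv⟩ := h.ex (u := (c, s, 2 * t + 2)) (by simp only [TVal]; omega)
      have hval := h.val (h.symm hv)
      have := h.adj hv
      simp only [TAdj, TVal] at this hval
      rcases this with ⟨rfl, rfl, h2 | h2⟩ | ⟨rfl, rfl, rfl, h2⟩ | ⟨h2, _⟩ | ⟨h2, _⟩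
      · omega
      · obtain rfl : i' = 2 * t + 1 := by omega
        have := h.uniq h1 (h.symm hv)
        simp at this
      · cases s
        · exact hr (t + 1) hv
        · exact hr (t + 1) (h.symm hv)
      all_goals omega
    · exact h.symm h1
  | succ n ih =>
    intro t ht
    rcases h.odd (c := c) (s := s) (t := t) (by omega) with h1 | h1
    · exfalso
      obtain ⟨⟨c', s', i'⟩, hv⟩ := h.ex (u := (c, s, 2 * t + 2)) (by simp only [TVal]; omega)
      have := h.adj hv
      simp only [TAdj] at this
      rcases this with ⟨rfl, rfl, h2 | h2⟩ | ⟨rfl, rfl, rfl, h2⟩ | ⟨h2, _⟩ | ⟨h2, _⟩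
      · subst h2
        have := h.uniq (h.symm hv) (h.symm (ih (t + 1) (by omega)))
        simp at this
      · obtain rfl : i' = 2 * t + 1 := by omega
        have := h.uniq h1 (h.symm hv)
        simp at this
      · cases s
        · exact hr (t + 1) hv
        · exact hr (t + 1) (h.symm hv)
      all_goals omega
    · exact h.symm h1

theorem noRung (h : TPM a r) {c}
    (hr : ∀ j, ¬ r (c, false, 2 * j) (c, true, 2 * j))
    (s : Bool) {i : ℕ} (hi : i ≤ 2 * a c) : r (c, s, i) (tpf none (c, s, i)) := by
  by_cases h0 : i = 0
  · subst h0
    obtain ⟨⟨c', s', i'⟩, hv⟩ := h.ex (u := (c, s, 0)) hi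
    have hval := h.val (h.symm hv)
    have := h.adj hv
    simp only [TAdj, TVal] at this hval
    rcases this with ⟨rfl, rfl, h2 | h2⟩ | ⟨rfl, rfl, rfl, h2⟩ | ⟨_, rfl, rfl, rfl, rfl⟩ |
      ⟨_, rfl, rfl, rfl, rfl⟩
    · subst h2
      have := h.uniq (h.symm hv) (h.symm (h.noRungAux hr s (a c - 1) 0 (by omega)))
      simp at this
    · omega
    · exfalso
      cases s
      · exact hr 0 hv
      · exact hr 0 (h.symm hv)
    · simpa [tpf] using hv
    · have := fin3_a c'
      simpa [tpf, this] using hv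
  · simp only [tpf, if_neg h0]
    split_ifs with h3
    · obtain ⟨t, rfl⟩ : ∃ t, i = 2 * t + 1 := ⟨i / 2, by omega⟩
      exact h.symm (h.noRungAux hr s (a c - 1 - t) t (by omega))
    · obtain ⟨t, rfl⟩ : ∃ t, i = 2 * t + 2 := ⟨i / 2 - 1, by omega⟩
      exact h.noRungAux hr s (a c - 1 - t) t (by omega)

/-- A connecting edge forces the next branch to have no rung. -/
theorem cross (h : TPM a r) {c} (hc : r (c, true, 0) (c + 1, false, 0)) (j : ℕ) :
    ¬ r (c + 1, false, 2 * j) (c + 1, true, 2 * j) := by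
  intro hr
  have h1 := h.rung (J := fun _ => j) hr false (i := 0) (by omega)
  have h2 := h.uniq h1 (h.symm hc)
  have h3 := fin3_c c
  simp only [tpf] at h2
  split_ifs at h2 <;> simp_all

theorem allNone (h : TPM a r) {c} (hc : r (c, true, 0) (c + 1, false, 0)) {w} (hw : TVal a w) :
    r w (tpf none w) := by
  have step : ∀ c, r (c, true, 0) (c + 1, false, 0) → r (c + 1, true, 0) (c + 1 + 1, false, 0) := by
    intro c hc
    have := h.noRung (h.cross hc) true (i := 0) (by omega)
    simpa [tpf] using this
  have hn : ∀ d, ∀ j, ¬ r (d, false, 2 * j) (d, true, 2 * j) := by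
    intro d
    have h1 := step _ hc
    have h2 := step _ h1
    have := fin3_d c d
    rcases this with rfl | rfl | rfl
    · exact h.cross hc
    · exact h.cross h1
    · exact h.cross h2
  obtain ⟨c, s, i⟩ := w
  exact h.noRung (hn c) s hw

theorem classify (h : TPM a r) : ∃ J, TOk a J ∧ ∀ w, TVal a w → r w (tpf J w) := by
  by_cases hn : ∃ c, ∀ j, ¬ r (c, false, 2 * j) (c, true, 2 * j)
  · obtain ⟨c, hc⟩ := hn
    refine ⟨none, by simp [TOk], fun w hw => ?_⟩
    have := h.noRung hc true (i := 0) (by omega)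
    exact h.allNone (c := c) (by simpa [tpf] using this) hw
  · push Not at hn
    choose J hJ using hn
    refine ⟨some J, ?_, ?_⟩
    · rintro K ⟨⟩ c
      have := h.val (hJ c)
      simp only [TVal] at this
      omega
    · rintro ⟨c, s, i⟩ hw
      exact h.rung (hJ c) s hw

end TPM

/-! ### Transfer to a graph -/

section Transfer
variable {V : Type*}

/-- The graph `G` on `A` is a copy of the model. -/
structure TModel (G : SimpleGraph V) (A : Set V) (a : Fin 3 → ℕ) (φ : TW → V) : Prop where
  inj : ∀ {u v}, TVal a u → TVal a v → φ u = φ v → u = v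
  img : ∀ v, v ∈ A ↔ ∃ w, TVal a w ∧ φ w = v
  adj : ∀ {u v}, TVal a u → TVal a v → (G.Adj (φ u) (φ v) ↔ TAdj u v)

/-- The explicit matchings. -/
def tM (a : Fin 3 → ℕ) (φ : TW → V) (J : Option (Fin 3 → ℕ)) : Set (Sym2 V) :=
  {e | ∃ w, TVal a w ∧ s(φ w, φ (tpf J w)) = e}

namespace TModel
variable {G : SimpleGraph V} {A : Set V} {a : Fin 3 → ℕ} {φ : TW → V}

theorem mem_tM (T : TModel G A a φ) {J} (hJ : TOk a J) {u v} (hu : TVal a u) (hv : TVal a v) :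
    s(φ u, φ v) ∈ tM a φ J ↔ tpf J u = v := by
  constructor
  · rintro ⟨w, hw, he⟩
    rcases Sym2.eq_iff.1 he with ⟨h1, h2⟩ | ⟨h1, h2⟩
    · rw [← T.inj hw hu h1, T.inj (tpf_val hJ hw) hv h2]
    · rw [← T.inj hw hv h1, ← T.inj (tpf_val hJ hw) hu h2, tpf_invol]
  · rintro rfl
    exact ⟨u, hu, rfl⟩

theorem isPM (T : TModel G A a φ) {J} (hJ : TOk a J) : IsPMOn G A (tM a φ J) := by
  have key : ∀ e ∈ tM a φ J, ∀ v ∈ e, ∃ w, TVal a w ∧ φ w = v ∧ e = s(φ w, φ (tpf J w)) := by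
    rintro e ⟨w, hw, rfl⟩ v hv
    rcases Sym2.mem_iff.1 hv with rfl | rfl
    · exact ⟨w, hw, rfl, rfl⟩
    · exact ⟨_, tpf_val hJ hw, rfl, by rw [tpf_invol, Sym2.eq_swap]⟩
  refine ⟨?_, ?_, ?_, ?_⟩
  · rintro e ⟨w, hw, rfl⟩
    rw [SimpleGraph.mem_edgeSet]
    exact (T.adj hw (tpf_val hJ hw)).2 (tpf_adj w)
  · intro e he v hv
    obtain ⟨w, hw, h1, _⟩ := key e he v hv
    exact (T.img v).2 ⟨w, hw, h1⟩
  · intro e he f hf hne v hve hvf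
    obtain ⟨w, hw, h1, h2⟩ := key e he v hve
    obtain ⟨w', hw', h1', h2'⟩ := key f hf v hvf
    have := T.inj hw hw' (h1.trans h1'.symm)
    subst this
    exact hne (h2.trans h2'.symm)
  · intro v hv
    obtain ⟨w, hw, rfl⟩ := (T.img v).1 hv
    exact ⟨_, ⟨w, hw, rfl⟩, Sym2.mem_mk_left _ _⟩

theorem exists_rep (T : TModel G A a φ) {M} (hM : IsPMOn G A M) {e} (he : e ∈ M) :
    ∃ u v, TVal a u ∧ TVal a v ∧ e = s(φ u, φ v) := by
  induction e using Sym2.ind with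
  | _ x y =>
    obtain ⟨u, hu, rfl⟩ := (T.img x).1 (hM.2.1 _ he x (Sym2.mem_mk_left _ _))
    obtain ⟨v, hv, rfl⟩ := (T.img y).1 (hM.2.1 _ he y (Sym2.mem_mk_right _ _))
    exact ⟨u, v, hu, hv, rfl⟩

theorem toTPM (T : TModel G A a φ) {M} (hM : IsPMOn G A M) :
    TPM a (fun u v => TVal a u ∧ TVal a v ∧ s(φ u, φ v) ∈ M) where
  symm := fun ⟨h1, h2, h3⟩ => ⟨h2, h1, by rwa [Sym2.eq_swap]⟩
  adj := fun ⟨h1, h2, h3⟩ => (T.adj h1 h2).1 (hM.1 h3)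
  val := fun h => h.1
  uniq := by
    rintro u v w ⟨h1, h2, h3⟩ ⟨_, h4, h5⟩
    by_contra hne
    refine hM.2.2.1 h3 h5 ?_ (φ u) (Sym2.mem_mk_left _ _) (Sym2.mem_mk_left _ _)
    intro h
    exact hne (T.inj h2 h4 (Sym2.congr_right.1 h))
  ex := by
    intro u hu
    obtain ⟨e, he, hue⟩ := hM.2.2.2 (φ u) ((T.img _).2 ⟨u, hu, rfl⟩)
    obtain ⟨x, y, hx, hy, rfl⟩ := T.exists_rep hM he
    rcases Sym2.mem_iff.1 hue with h | h
    · rw [← h] at he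
      exact ⟨y, hu, hy, he⟩
    · rw [← h] at he
      exact ⟨x, hu, hx, by rwa [Sym2.eq_swap]⟩

theorem eq_tM (T : TModel G A a φ) {M} (hM : IsPMOn G A M) {J}
    (h : ∀ w, TVal a w → s(φ w, φ (tpf J w)) ∈ M) (hJ : TOk a J) : M = tM a φ J := by
  ext e
  constructor
  · intro he
    obtain ⟨u, v, hu, hv, rfl⟩ := T.exists_rep hM he
    rw [T.mem_tM hJ hu hv]
    exact (T.toTPM hM).uniq ⟨hu, tpf_val hJ hu, h u hu⟩ ⟨hu, hv, he⟩
  · rintro ⟨w, hw, rfl⟩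
    exact h w hw

theorem classify (T : TModel G A a φ) {M} (hM : IsPMOn G A M) :
    ∃ J, TOk a J ∧ M = tM a φ J := by
  obtain ⟨J, hJ, h⟩ := (T.toTPM hM).classify
  exact ⟨J, hJ, T.eq_tM hM (fun w hw => (h w hw).2.2) hJ⟩

theorem tM_finite (a : Fin 3 → ℕ) (φ : TW → V) (J) : (tM a φ J).Finite := by
  have hf : {w : TW | TVal a w}.Finite := by
    refine Set.Finite.subset (Set.toFinite
      ((Finset.univ ×ˢ (Finset.univ ×ˢ Finset.range (2 * (a 0 + a 1 + a 2) + 1)) : Finset TW) : Set TW)) ?_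
    rintro ⟨c, s, i⟩ hw
    simp only [TVal, Set.mem_ofPred_eq] at hw
    simp
    fin_cases c <;> simp at hw <;> omega
  refine (hf.image (fun w => s(φ w, φ (tpf J w)))).subset ?_
  rintro e ⟨w, hw, rfl⟩
  exact ⟨w, hw, rfl⟩

theorem tpf_rung (J : Fin 3 → ℕ) (c : Fin 3) :
    tpf (some J) (c, false, 2 * J c) = (c, true, 2 * J c) := by
  simp [tpf]

theorem rung_mem_iff (T : TModel G A a φ) {J : Fin 3 → ℕ} (hJ : TOk a (some J)) {c j}
    (hj : j ≤ a c) :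
    s(φ (c, false, 2 * j), φ (c, true, 2 * j)) ∈ tM a φ (some J) ↔ J c = j := by
  rw [T.mem_tM hJ (by simp only [TVal]; omega) (by simp only [TVal]; omega)]
  constructor
  · intro h
    simp only [tpf] at h
    split_ifs at h <;> simp at h
    omega
  · rintro rfl
    exact tpf_rung J c

theorem tM_inj (T : TModel G A a φ) {J J' : Fin 3 → ℕ} (hJ : TOk a (some J))
    (hJ' : TOk a (some J')) (h : tM a φ (some J) = tM a φ (some J')) : J = J' := by
  funext c
  have h1 := (T.rung_mem_iff hJ (c := c) (hJ J rfl c)).2 rfl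
  rw [h] at h1
  exact ((T.rung_mem_iff hJ' (hJ J rfl c)).1 h1).symm

theorem tM_ne (T : TModel G A a φ) {J : Fin 3 → ℕ} (hJ : TOk a (some J)) :
    tM a φ (some J) ≠ tM a φ none := by
  intro h
  have h1 := (T.rung_mem_iff hJ (c := 0) (hJ J rfl 0)).2 rfl
  have hb := hJ J rfl 0
  rw [h, T.mem_tM (by simp [TOk]) (by simp only [TVal]; omega) (by simp only [TVal]; omega)] at h1
  simp only [tpf] at h1
  split_ifs at h1 <;> simp at h1

theorem forcing_none (T : TModel G A a φ) : forcingNumOn G A (tM a φ none) = 1 := by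
  have hok : TOk a none := by simp [TOk]
  have hok0 : TOk a (some fun _ => 0) := by rintro K ⟨⟩ c; exact Nat.zero_le _
  have hv : ∀ c s, TVal a (c, s, 0) := fun c s => Nat.zero_le _
  refine le_antisymm (Nat.sInf_le ⟨{s(φ (0, true, 0), φ (1, false, 0))}, ⟨?_, ?_⟩, by simp⟩)
    (le_csInf ⟨_, _, ⟨subset_rfl, ?_⟩, rfl⟩ ?_)
  · rw [Set.singleton_subset_iff, T.mem_tM hok (hv _ _) (hv _ _)]
    rfl
  · intro M' hM' hS
    refine T.eq_tM hM' (fun w hw => ?_) hok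
    exact ((T.toTPM hM').allNone (c := 0) ⟨hv _ _, hv _ _, hS rfl⟩ hw).2.2
  · intro M' hM' hS
    exact T.eq_tM hM' (fun w hw => hS ⟨w, hw, rfl⟩) hok
  · rintro n ⟨S, ⟨hS, hF⟩, rfl⟩
    by_contra hlt
    have h0 : S = ∅ := (Set.ncard_eq_zero ((tM_finite a φ none).subset hS)).1 (by omega)
    subst h0
    exact T.tM_ne hok0 (hF _ (T.isPM hok0) (Set.empty_subset _))

theorem tpf_congr {J J' : Fin 3 → ℕ} {w : TW} (h : J w.1 = J' w.1) :
    tpf (some J) w = tpf (some J') w := by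
  simp [tpf, h]

theorem tpf_branch (J : Fin 3 → ℕ) (w : TW) : (tpf (some J) w).1 = w.1 := by
  simp only [tpf]
  split_ifs <;> rfl

theorem forcing_some (T : TModel G A a φ) (ha : ∀ c, 1 ≤ a c) {J : Fin 3 → ℕ}
    (hJ : TOk a (some J)) : forcingNumOn G A (tM a φ (some J)) = 3 := by
  have hb : ∀ c, J c ≤ a c := hJ J rfl
  have hv : ∀ c s, TVal a (c, s, 2 * J c) := by
    intro c s
    have := hb c
    simp only [TVal]; omega
  have lower : ∀ S, IsForcingOn G A (tM a φ (some J)) S → 3 ≤ S.ncard := by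
    rintro S ⟨hS, hF⟩
    have hfin := (tM_finite a φ (some J)).subset hS
    have hex : ∀ c : Fin 3, ∃ w, TVal a w ∧ w.1 = c ∧ s(φ w, φ (tpf (some J) w)) ∈ S := by
      intro c
      by_contra hno
      push Not at hno
      obtain ⟨j, hj, hne⟩ : ∃ j, j ≤ a c ∧ j ≠ J c := by
        by_cases h : J c = 0
        · exact ⟨1, ha c, by omega⟩
        · exact ⟨0, by omega, by omega⟩
      have hJ' : TOk a (some (Function.update J c j)) := by
        rintro K ⟨⟩ d
        by_cases hd : d = c
        · subst hd; simpa using hj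
        · simpa [hd] using hb d
      have heq := hF _ (T.isPM hJ') (by
        intro e he
        obtain ⟨w, hw, hwe⟩ := hS he
        subst hwe
        have hwc : w.1 ≠ c := fun h => hno w hw h he
        exact ⟨w, hw, by rw [tpf_congr (J' := J)]; simp [hwc]⟩)
      have := congrFun (T.tM_inj hJ' hJ heq) c
      simp at this
      exact hne this
    choose w hw hwc hwS using hex
    have hinj : Function.Injective (fun c => s(φ (w c), φ (tpf (some J) (w c)))) := by
      intro c d hcd
      rcases Sym2.eq_iff.1 hcd with ⟨h1, _⟩ | ⟨h1, _⟩
      · rw [← hwc c, ← hwc d, T.inj (hw c) (hw d) h1]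
      · rw [← hwc c, ← hwc d, T.inj (hw c) (tpf_val hJ (hw d)) h1, tpf_branch]
    have hcard := Set.ncard_le_ncard (s := Set.range (fun c => s(φ (w c), φ (tpf (some J) (w c)))))
      (by rintro e ⟨c, rfl⟩; exact hwS c) hfin
    rw [← Set.image_univ, Set.ncard_image_of_injective _ hinj, Set.ncard_univ] at hcard
    simpa using hcard
  have hforce : IsForcingOn G A (tM a φ (some J))
      (Set.range fun c => s(φ (c, false, 2 * J c), φ (c, true, 2 * J c))) := by
    refine ⟨?_, ?_⟩
    · rintro e ⟨c, rfl⟩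
      exact (T.rung_mem_iff hJ (hb c)).2 rfl
    · intro M' hM' hS
      refine T.eq_tM hM' (fun w hw => ?_) hJ
      obtain ⟨c, s, i⟩ := w
      exact ((T.toTPM hM').rung (c := c) (J := J) ⟨hv _ _, hv _ _, hS ⟨c, rfl⟩⟩ s hw).2.2
  have hle : (Set.range fun c => s(φ (c, false, 2 * J c), φ (c, true, 2 * J c))).ncard ≤ 3 := by
    rw [← Set.image_univ]
    refine (Set.ncard_image_le Set.finite_univ).trans ?_
    simp [Set.ncard_univ]
  have hmem : (Set.range fun c => s(φ (c, false, 2 * J c), φ (c, true, 2 * J c))).ncard ∈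
      {n | ∃ S, IsForcingOn G A (tM a φ (some J)) S ∧ S.ncard = n} := ⟨_, hforce, rfl⟩
  refine le_antisymm ((Nat.sInf_le hmem).trans hle) (le_csInf ⟨_, hmem⟩ ?_)
  rintro n ⟨S, hS, rfl⟩
  exact lower S hS

theorem main (T : TModel G A a φ) (ha : ∀ c, 1 ≤ a c) :
    {M | IsPMOn G A M ∧ forcingNumOn G A M = 1}.ncard = 1 ∧
    {M | IsPMOn G A M ∧ forcingNumOn G A M = 3}.ncard = ∏ c, (a c + 1) ∧
    ∀ M, IsPMOn G A M → forcingNumOn G A M = 1 ∨ forcingNumOn G A M = 3 := by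
  refine ⟨?_, ?_, ?_⟩
  · rw [Set.ncard_eq_one]
    refine ⟨tM a φ none, ?_⟩
    ext M
    constructor
    · rintro ⟨hM, h1⟩
      obtain ⟨J, hJ, rfl⟩ := T.classify hM
      cases J with
      | none => rfl
      | some J => rw [T.forcing_some ha hJ] at h1; omega
    · rintro rfl
      exact ⟨T.isPM (by simp [TOk]), T.forcing_none⟩
  · have hok : ∀ J : (c : Fin 3) → Fin (a c + 1), TOk a (some fun c => (J c : ℕ)) := by
      rintro J K ⟨⟩ c
      exact Nat.le_of_lt_succ (J c).2
    have himg : {M | IsPMOn G A M ∧ forcingNumOn G A M = 3} =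
        (fun J : (c : Fin 3) → Fin (a c + 1) => tM a φ (some fun c => (J c : ℕ))) '' Set.univ := by
      ext M
      constructor
      · rintro ⟨hM, h1⟩
        obtain ⟨J, hJ, rfl⟩ := T.classify hM
        cases J with
        | none => rw [T.forcing_none] at h1; omega
        | some J => exact ⟨fun c => ⟨J c, Nat.lt_succ_of_le (hJ J rfl c)⟩, trivial, rfl⟩
      · rintro ⟨J, _, rfl⟩
        exact ⟨T.isPM (hok J), T.forcing_some ha (hok J)⟩
    rw [himg, Set.ncard_image_of_injective, Set.ncard_univ]
    · simp
    · intro J J' h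
      have := T.tM_inj (hok J) (hok J') h
      funext c
      exact Fin.ext (congrFun this c)
  · intro M hM
    obtain ⟨J, hJ, rfl⟩ := T.classify hM
    cases J with
    | none => exact Or.inl T.forcing_none
    | some J => exact Or.inr (T.forcing_some ha hJ)

end TModel
end Transfer

/-! ### The concrete hexagonal system -/

def plusA (k m m' : ℕ) : Fin 3 → ℕ := ![k - 1, m - 1, m' - 1]

def plusPhi (k : ℕ) (w : TW) : ℤ × ℤ :=
  match w with
  | (0, false, i) => (2 * k - 2 - i, 0)
  | (0, true, i) => (2 * k - 2 - i, 1)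
  | (1, false, i) => (2 * k - 1 + (i / 2 : ℕ), ((i + 1) / 2 : ℕ) + 1)
  | (1, true, i) => (2 * k + ((i + 1) / 2 : ℕ), (i / 2 : ℕ) + 1)
  | (2, false, i) => (2 * k + ((i + 1) / 2 : ℕ), -(i / 2 : ℕ))
  | (2, true, i) => (2 * k - 1 + (i / 2 : ℕ), -((i + 1) / 2 : ℕ))

theorem plus_inj {k m m' : ℕ} (hk : 2 ≤ k) {u v : TW}
    (hu : TVal (plusA k m m') u) (hv : TVal (plusA k m m') v)
    (h : plusPhi k u = plusPhi k v) : u = v := by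
  obtain ⟨c, s, i⟩ := u
  obtain ⟨d, t, j⟩ := v
  simp only [TVal, plusA] at hu hv
  fin_cases c <;> cases s <;> fin_cases d <;> cases t <;>
    simp [plusPhi] at h hu hv ⊢ <;> omega

theorem mem_hexVerts_s13 (c p : ℤ × ℤ) : p ∈ hexVerts c ↔
    (c.1 ≤ p.1 ∧ p.1 ≤ c.1 + 2 ∧ c.2 ≤ p.2 ∧ p.2 ≤ c.2 + 1) := by
  obtain ⟨x, y⟩ := p
  obtain ⟨a, b⟩ := c
  simp only [hexVerts, Set.mem_insert_iff, Set.mem_singleton_iff, Prod.mk.injEq]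
  omega

theorem mem_hexVertexSet (H : Set (ℤ × ℤ)) (p) :
    p ∈ hexVertexSet H ↔ ∃ c ∈ H, p ∈ hexVerts c := by
  simp [hexVertexSet]

theorem plus_hex {k m m' : ℕ} (c : ℤ × ℤ) : c ∈ plusShape k m m' ↔
    (∃ j : ℕ, j < k ∧ c = (2 * (j : ℤ), 0)) ∨
    (∃ t : ℕ, 1 ≤ t ∧ t ≤ m - 1 ∧ c = (2 * (k : ℤ) - 2 + (t : ℤ), (t : ℤ))) ∨
    (∃ t : ℕ, 1 ≤ t ∧ t ≤ m' - 1 ∧ c = (2 * (k : ℤ) - 2 + (t : ℤ), -(t : ℤ))) := by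
  simp only [plusShape, Set.mem_union, Set.mem_ofPred_eq, or_assoc]

/-- Pairs of adjacent model vertices lie on a common hexagon. -/
theorem plus_common {k m m' : ℕ} (hk : 2 ≤ k) (hm : 2 ≤ m) (hm' : 2 ≤ m') {u v : TW}
    (hu : TVal (plusA k m m') u) (hv : TVal (plusA k m m') v) (h : TAdj u v) :
    ∃ c ∈ plusShape k m m', plusPhi k u ∈ hexVerts c ∧ plusPhi k v ∈ hexVerts c := by
  obtain ⟨c, s, i⟩ := u
  obtain ⟨d, t, j⟩ := v
  simp only [TAdj] at h
  have central : ((2 * (k : ℤ) - 2, 0) : ℤ × ℤ) ∈ plusShape k m m' :=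
    (plus_hex _).2 (Or.inl ⟨k - 1, by omega, by
      rw [Prod.mk.injEq]; exact ⟨by omega, rfl⟩⟩)
  by_cases hcd : c = d
  · subst hcd
    obtain ⟨q, hh, h1, h2, h3, h4⟩ : ∃ h, h < plusA k m m' c ∧ 2 * h ≤ i ∧ i ≤ 2 * h + 2 ∧
        2 * h ≤ j ∧ j ≤ 2 * h + 2 := by
      have ha : 1 ≤ plusA k m m' c := by fin_cases c <;> simp [plusA] <;> omega
      have hc : c ≠ c + 1 := (fin3_c c).symm
      simp only [TVal] at hu hv
      by_cases hi : min i j = 2 * plusA k m m' c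
      · exact ⟨plusA k m m' c - 1, by omega, by omega, by omega, by omega, by omega⟩
      · refine ⟨min i j / 2, ?_⟩
        rcases h with ⟨_, _, h⟩ | ⟨_, _, h⟩ | ⟨_, _, _, _, h⟩ | ⟨_, _, _, _, h⟩
        · omega
        · omega
        · exact absurd h hc
        · exact absurd h hc
    fin_cases c
    · simp [plusA] at hh
      refine ⟨_, (plus_hex _).2 (Or.inl ⟨k - 2 - q, by omega, rfl⟩), ?_⟩
      simp only [mem_hexVerts_s13]
      cases s <;> cases t <;> simp [plusPhi] <;> omega
    · simp [plusA] at hh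
      refine ⟨_, (plus_hex _).2 (Or.inr (Or.inl ⟨q + 1, by omega, by omega, rfl⟩)), ?_⟩
      simp only [mem_hexVerts_s13]
      cases s <;> cases t <;> simp [plusPhi] <;> omega
    · simp [plusA] at hh
      refine ⟨_, (plus_hex _).2 (Or.inr (Or.inr ⟨q + 1, by omega, by omega, rfl⟩)), ?_⟩
      simp only [mem_hexVerts_s13]
      cases s <;> cases t <;> simp [plusPhi] <;> omega
  · refine ⟨_, central, ?_⟩
    simp only [mem_hexVerts_s13]
    rcases h with ⟨h1, _⟩ | ⟨h1, _⟩ | ⟨rfl, rfl, rfl, rfl, rfl⟩ | ⟨rfl, rfl, rfl, rfl, rfl⟩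
    · exact absurd h1 hcd
    · exact absurd h1 hcd
    · fin_cases c <;> simp [plusPhi]
    · fin_cases d <;> simp [plusPhi]

theorem plus_brick {k m m' : ℕ} (hk : 2 ≤ k) {u v : TW}
    (hu : TVal (plusA k m m') u) (hv : TVal (plusA k m m') v) :
    brickAdj (plusPhi k u) (plusPhi k v) ↔ TAdj u v := by
  obtain ⟨c, s, i⟩ := u
  obtain ⟨d, t, j⟩ := v
  simp only [TVal, plusA] at hu hv
  simp only [brickAdj, TAdj, Int.even_iff]
  fin_cases c <;> cases s <;> fin_cases d <;> cases t <;>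
    simp [plusPhi] at hu hv ⊢ <;> omega

theorem plus_img {k m m' : ℕ} (hk : 2 ≤ k) (hm : 2 ≤ m) (hm' : 2 ≤ m') (p : ℤ × ℤ) :
    p ∈ hexVertexSet (plusShape k m m') ↔ ∃ w, TVal (plusA k m m') w ∧ plusPhi k w = p := by
  rw [mem_hexVertexSet]
  constructor
  · rintro ⟨c, hc, hp⟩
    rcases (plus_hex c).1 hc with ⟨j, hj, rfl⟩ | ⟨t, h1, h2, rfl⟩ | ⟨t, h1, h2, rfl⟩
    · rw [mem_hexVerts_s13] at hp
      obtain ⟨x, y⟩ := p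
      simp only at hp
      obtain ⟨hx, hx', hy, hy'⟩ := hp
      have hy2 : y = 0 ∨ y = 1 := by omega
      by_cases hxk : x ≤ 2 * k - 2
      · rcases hy2 with rfl | rfl
        · refine ⟨(0, false, (2 * k - 2 - x).toNat), ?_, ?_⟩
          · simp [TVal, plusA]; omega
          · simp [plusPhi]; omega
        · refine ⟨(0, true, (2 * k - 2 - x).toNat), ?_, ?_⟩
          · simp [TVal, plusA]; omega
          · simp [plusPhi]; omega
      · obtain rfl | rfl : x = 2 * k - 1 ∨ x = 2 * k := by omega
        · rcases hy2 with rfl | rfl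
          · exact ⟨(2, true, 0), Nat.zero_le _, by simp [plusPhi]⟩
          · exact ⟨(1, false, 0), Nat.zero_le _, by simp [plusPhi]⟩
        · rcases hy2 with rfl | rfl
          · exact ⟨(2, false, 0), Nat.zero_le _, by simp [plusPhi]⟩
          · exact ⟨(1, true, 0), Nat.zero_le _, by simp [plusPhi]⟩
    · obtain ⟨h, rfl⟩ : ∃ h, t = h + 1 := ⟨t - 1, by omega⟩
      simp only [hexVerts, Set.mem_insert_iff, Set.mem_singleton_iff] at hp
      have key : ∀ s i, i ≤ 2 * h + 2 → plusPhi k (1, s, i) = p →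
          ∃ w, TVal (plusA k m m') w ∧ plusPhi k w = p := by
        intro s i hi hp
        exact ⟨_, by simp [TVal, plusA]; omega, hp⟩
      rcases hp with hp | hp | hp | hp | hp | hp <;> rw [hp] at key ⊢
      · exact key false (2 * h) (by omega) (by simp [plusPhi]; omega)
      · exact key true (2 * h) (by omega) (by simp [plusPhi]; omega)
      · exact key true (2 * h + 1) (by omega) (by simp [plusPhi]; omega)
      · exact key false (2 * h + 1) (by omega) (by simp [plusPhi]; omega)
      · exact key false (2 * h + 2) (by omega) (by simp [plusPhi]; omega)
      · exact key true (2 * h + 2) (by omega) (by simp [plusPhi]; omega)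
    · obtain ⟨h, rfl⟩ : ∃ h, t = h + 1 := ⟨t - 1, by omega⟩
      simp only [hexVerts, Set.mem_insert_iff, Set.mem_singleton_iff] at hp
      have key : ∀ s i, i ≤ 2 * h + 2 → plusPhi k (2, s, i) = p →
          ∃ w, TVal (plusA k m m') w ∧ plusPhi k w = p := by
        intro s i hi hp
        exact ⟨_, by simp [TVal, plusA]; omega, hp⟩
      rcases hp with hp | hp | hp | hp | hp | hp <;> rw [hp] at key ⊢
      · exact key true (2 * h + 1) (by omega) (by simp [plusPhi]; omega)
      · exact key true (2 * h + 2) (by omega) (by simp [plusPhi]; omega)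
      · exact key false (2 * h + 2) (by omega) (by simp [plusPhi]; omega)
      · exact key true (2 * h) (by omega) (by simp [plusPhi]; omega)
      · exact key false (2 * h) (by omega) (by simp [plusPhi]; omega)
      · exact key false (2 * h + 1) (by omega) (by simp [plusPhi]; omega)
  · rintro ⟨w, hw, rfl⟩
    obtain ⟨c, hc, h1, _⟩ := plus_common hk hm hm' hw
      (tpf_val (J := none) (by simp [TOk]) hw) (tpf_adj w)
    exact ⟨c, hc, h1⟩

theorem tadj_symm {u v : TW} (h : TAdj u v) : TAdj v u := by
  obtain ⟨c, s, i⟩ := u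
  obtain ⟨d, t, j⟩ := v
  simp only [TAdj] at *
  rcases h with ⟨rfl, rfl, h⟩ | ⟨rfl, rfl, rfl, h⟩ | h | h
  · exact Or.inl ⟨rfl, rfl, h.symm⟩
  · exact Or.inr (Or.inl ⟨rfl, by simp, rfl, h⟩)
  · exact Or.inr (Or.inr (Or.inr ⟨h.2.1, h.1, h.2.2.2.1, h.2.2.1, h.2.2.2.2⟩))
  · exact Or.inr (Or.inr (Or.inl ⟨h.2.1, h.1, h.2.2.2.1, h.2.2.1, h.2.2.2.2⟩))

theorem tadj_irrefl (u : TW) : ¬ TAdj u u := by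
  obtain ⟨c, s, i⟩ := u
  simp [TAdj]

theorem plus_model {k m m' : ℕ} (hk : 2 ≤ k) (hm : 2 ≤ m) (hm' : 2 ≤ m') :
    TModel (hexGraph (plusShape k m m')) (hexVertexSet (plusShape k m m'))
      (plusA k m m') (plusPhi k) where
  inj := plus_inj hk
  img := plus_img hk hm hm'
  adj := by
    intro u v hu hv
    simp only [hexGraph, SimpleGraph.fromRel_adj]
    constructor
    · rintro ⟨_, ⟨h, _⟩ | ⟨h, _⟩⟩
      · exact (plus_brick hk hu hv).1 h
      · exact tadj_symm ((plus_brick hk hv hu).1 h)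
    · intro h
      refine ⟨?_, Or.inl ⟨(plus_brick hk hu hv).2 h, plus_common hk hm hm' hu hv h⟩⟩
      intro he
      rw [plus_inj hk hu hv he] at h
      exact tadj_irrefl _ h

/-- The forcing polynomial of `CHS(1,…,1,k;1,…,1|1,…,1,k;1,…,1)` with `k ≥ 2` and
`m, m' ≥ 2` is `k·m·m'·x³ + x`. -/
theorem forcingPoly_plusShape (k m m' : ℕ) (hk : 2 ≤ k) (hm : 2 ≤ m) (hm' : 2 ≤ m') :
    {M | hexPM (plusShape k m m') M ∧ hexForcingNum (plusShape k m m') M = 1}.ncard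
        = 1 ∧
    {M | hexPM (plusShape k m m') M ∧ hexForcingNum (plusShape k m m') M = 3}.ncard
        = k * m * m' ∧
    ∀ M, hexPM (plusShape k m m') M →
      hexForcingNum (plusShape k m m') M = 1 ∨
        hexForcingNum (plusShape k m m') M = 3 := by
  have h := (plus_model hk hm hm').main (by intro c; fin_cases c <;> simp [plusA] <;> omega)
  have hprod : ∏ c, (plusA k m m' c + 1) = k * m * m' := by
    simp [Fin.prod_univ_three, plusA]
    rw [Nat.sub_add_cancel (by omega), Nat.sub_add_cancel (by omega),
      Nat.sub_add_cancel (by omega)]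
  rw [hprod] at h
  exact h
end
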